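/- Let k be an algebraically closed field of characteristic zero. A proper variety X over k is groupless if and only if for every abelian variety A over k, every rational map A ⇢ X is constant. -/

import Mathlib

/-!
Formalization of a statement from "The Lang–Vojta conjectures on projective
pseudo-hyperbolic varieties" (Javanpeykar).

Notions not available in Mathlib (analytifications, genus, ample degrees, Hom-schemes, ...)
are encoded by explicit definitions or structures below; see the docstrings for the
conventions used.
-/

open CategoryTheory AlgebraicGeometry Limits

noncomputable section

/-- `Spec R` as a scheme, for a commutative ring `R`. -/
abbrev SR (R : Type) [CommRing R] : Scheme := Spec (CommRingCat.of R)

/-- The category of schemes over `Spec R`. -/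
abbrev OverR (R : Type) [CommRing R] := Over (SR R)

/-- A morphism of schemes over `Spec R` is constant if it factors through the base `Spec R`. -/
def IsConstant {R : Type} [CommRing R] {X Y : OverR R} (f : X ⟶ Y) : Prop :=
  ∃ y : SR R ⟶ Y.left, f.left = X.hom ≫ y

/-- A morphism `g : V ⟶ W` of schemes, where `V` has structure morphism `sV` to `Spec R`,
is constant if it factors through `Spec R`. -/
def IsConstantHom {R : Type} [CommRing R] {V W : Scheme} (sV : V ⟶ SR R) (g : V ⟶ W) : Prop :=
  ∃ y : SR R ⟶ W, g = sV ≫ y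

/-- A variety over `R`: a finite type, separated scheme over `Spec R`. -/
def IsVarietyOver {R : Type} [CommRing R] (X : OverR R) : Prop :=
  LocallyOfFiniteType X.hom ∧ QuasiCompact X.hom ∧ IsSeparated X.hom

/-- The multiplicative group scheme `𝔾ₘ` over `R`, i.e. the spectrum of the Laurent
polynomial ring over `R` (only its underlying scheme over `Spec R` is needed). -/
def GmO (R : Type) [CommRing R] : OverR R :=
  Over.mk (Spec.map (CommRingCat.ofHom (algebraMap R (LaurentPolynomial R))))

/-- The affine line over `R`. -/
def A1O (R : Type) [CommRing R] : OverR R :=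
  Over.mk (Spec.map (CommRingCat.ofHom (algebraMap R (Polynomial R))))

/-- `Spec R` as the terminal object of the category of schemes over `Spec R`. -/
def ptO (R : Type) [CommRing R] : OverR R := Over.mk (𝟙 (SR R))

/-- A group scheme over `R`, presented via a group structure on its functor of points:
by the Yoneda lemma this is the same as a group object in the category of schemes
over `Spec R`. -/
structure GroupScheme (R : Type) [CommRing R] where
  G : OverR R
  mul : ∀ {T : OverR R}, (T ⟶ G) → (T ⟶ G) → (T ⟶ G)
  one : ∀ (T : OverR R), T ⟶ G
  inv : ∀ {T : OverR R}, (T ⟶ G) → (T ⟶ G)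
  mul_assoc : ∀ {T : OverR R} (a b c : T ⟶ G), mul (mul a b) c = mul a (mul b c)
  one_mul : ∀ {T : OverR R} (a : T ⟶ G), mul (one T) a = a
  inv_mul : ∀ {T : OverR R} (a : T ⟶ G), mul (inv a) a = one T
  mul_natural : ∀ {T T' : OverR R} (f : T ⟶ T') (a b : T' ⟶ G),
    f ≫ mul a b = mul (f ≫ a) (f ≫ b)
  one_natural : ∀ {T T' : OverR R} (f : T ⟶ T'), f ≫ one T' = one T

/-- A finite type, connected group scheme over `R`. -/
def GroupScheme.IsFiniteTypeConnected {R : Type} [CommRing R] (Γ : GroupScheme R) : Prop :=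
  LocallyOfFiniteType Γ.G.hom ∧ QuasiCompact Γ.G.hom ∧ ConnectedSpace Γ.G.left

/-- An abelian variety over `R`: a connected finite type proper group scheme. (Over an
algebraically closed field of characteristic zero this agrees with the usual definition,
since group schemes are then automatically smooth by Cartier's theorem.) -/
def GroupScheme.IsAbelianVariety {R : Type} [CommRing R] (Γ : GroupScheme R) : Prop :=
  Γ.IsFiniteTypeConnected ∧ IsProper Γ.G.hom

/-- A scheme over `R` is groupless if every morphism to it from `𝔾ₘ` and from any abelian
variety over `R` is constant. -/
def IsGroupless (R : Type) [CommRing R] (X : OverR R) : Prop :=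
  (∀ f : GmO R ⟶ X, IsConstant f) ∧
  (∀ Γ : GroupScheme R, Γ.IsAbelianVariety → ∀ f : Γ.G ⟶ X, IsConstant f)

/-- A subset `Z` of a topological space has codimension at least two: every point of
`Z` admits a chain of two strict generizations (this computes the codimension of the
closure of each point of `Z` via the specialization order). -/
def CodimAtLeastTwo {T : Type} [TopologicalSpace T] (Z : Set T) : Prop :=
  ∀ z ∈ Z, ∃ x y : T, x ⤳ y ∧ y ⤳ z ∧ ¬(y ⤳ x) ∧ ¬(z ⤳ y)

/-- `X` is groupless modulo the closed subset `Δ` if for every finite type connected group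
scheme `G` over `R` and every dense open `U ⊆ G` whose complement has codimension at least
two, every non-constant morphism `U ⟶ X` over `R` factors over `Δ`. -/
def GrouplessModulo (R : Type) [CommRing R] (X : OverR R) (Δ : Set X.left) : Prop :=
  ∀ (Γ : GroupScheme R), Γ.IsFiniteTypeConnected →
    ∀ (U : Γ.G.left.Opens), Dense (U : Set Γ.G.left) →
      CodimAtLeastTwo ((U : Set Γ.G.left)ᶜ) →
      ∀ g : U.toScheme ⟶ X.left, g ≫ X.hom = U.ι ≫ Γ.G.hom →
        ¬ IsConstantHom (U.ι ≫ Γ.G.hom) g → Set.range g.base ⊆ Δ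

/-- `X` is pseudo-groupless if it is groupless modulo some proper closed subset. -/
def PseudoGroupless (R : Type) [CommRing R] (X : OverR R) : Prop :=
  ∃ Δ : Set X.left, IsClosed Δ ∧ Δ ≠ Set.univ ∧ GrouplessModulo R X Δ

section
open CategoryTheory AlgebraicGeometry Limits
noncomputable section
namespace PtF

variable {k : Type} [Field k]

/-- Spec of an algebra as an object over the base -/
abbrev SpO (k : Type) [Field k] (R : Type) [CommRing R] [Algebra k R] : OverR k :=
  Over.mk (Spec.map (CommRingCat.ofHom (algebraMap k R)))

section
variable {R S T : Type} [CommRing R] [CommRing S] [CommRing T] [Algebra k R] [Algebra k S] [Algebra k T]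

def sm (φ : R →ₐ[k] S) : SpO k S ⟶ SpO k R :=
  Over.homMk (Spec.map (CommRingCat.ofHom φ.toRingHom)) (by
    simp only [Over.mk_left, Over.mk_hom]
    rw [← Spec.map_comp, ← CommRingCat.ofHom_comp]
    congr 2
    exact φ.comp_algebraMap)

@[simp] lemma sm_left (φ : R →ₐ[k] S) : (sm φ).left = Spec.map (CommRingCat.ofHom φ.toRingHom) := rfl

lemma sm_comp (φ : R →ₐ[k] S) (ψ : S →ₐ[k] T) : sm (ψ.comp φ) = sm ψ ≫ sm φ := by
  ext1
  simp only [Over.comp_left, sm_left]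
  rw [← Spec.map_comp, ← CommRingCat.ofHom_comp]; rfl

lemma sm_id : sm (AlgHom.id k R) = 𝟙 _ := by
  ext1; exact Spec.map_id _

lemma sm_surj (f : SpO k S ⟶ SpO k R) : ∃ φ : R →ₐ[k] S, sm φ = f := by
  obtain ⟨φ, hφ⟩ := Spec.map_surjective f.left
  have h := Over.w f
  simp only [Over.mk_left, Over.mk_hom] at h
  rw [← hφ, ← Spec.map_comp] at h
  have h' := congrArg CommRingCat.Hom.hom (Spec.map_injective h)
  refine ⟨{ φ.hom with commutes' := fun r => ?_ }, ?_⟩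
  · exact DFunLike.congr_fun h' r
  · ext1; rw [← hφ]; rfl

lemma sm_inj {φ ψ : R →ₐ[k] S} (h : sm φ = sm ψ) : φ = ψ := by
  have h1 := congrArg CommaMorphism.left h
  simp only [sm_left] at h1
  have h2 := congrArg CommRingCat.Hom.hom (Spec.map_injective h1)
  ext x
  exact DFunLike.congr_fun h2 x
end

/-- uniqueness along injections of domains -/
lemma pt_ext {X : OverR k} (hX : IsSeparated X.hom) {R S : Type} [CommRing R] [CommRing S] [Algebra k R] [Algebra k S]
    [IsDomain R] (φ : R →ₐ[k] S) (hφ : Function.Injective φ) {z z' : SpO k R ⟶ X}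
    (h : sm φ ≫ z = sm φ ≫ z') : z = z' := by
  have := hX
  have hd : IsDominant (Spec.map (CommRingCat.ofHom φ.toRingHom)) := by
    refine ⟨?_⟩
    have : DenseRange (PrimeSpectrum.comap φ.toRingHom) := by
      rw [PrimeSpectrum.denseRange_comap_iff_ker_le_nilRadical]
      have : RingHom.ker φ.toRingHom = ⊥ := (RingHom.injective_iff_ker_eq_bot _).mp hφ
      rw [this]; exact bot_le
    exact this
  have : IsDomain (CommRingCat.of R) := ‹IsDomain R›
  have : IsReduced (SpO k R).left := by dsimp; infer_instance
  ext1
  have h1 := congrArg CommaMorphism.left h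
  simp only [Over.comp_left, sm_left] at h1
  refine ext_of_isDominant_of_isSeparated X.hom ?_ (Spec.map (CommRingCat.ofHom φ.toRingHom)) h1
  rw [Over.w, Over.w]

lemma pt_extend {X : OverR k} (hX : IsProper X.hom) {V L : Type} [CommRing V] [IsDomain V] [ValuationRing V]
    [Field L] [Algebra V L] [IsFractionRing V L] [Algebra k V] [Algebra k L] [IsScalarTower k V L]
    (ξ : SpO k L ⟶ X) : ∃ z : SpO k V ⟶ X, sm (IsScalarTower.toAlgHom k V L) ≫ z = ξ := by
  have hv : ValuativeCriterion X.hom := by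
    rw [IsProper.eq_valuativeCriterion] at hX
    exact hX.1.1.1
  have w := Over.w ξ
  simp only [Over.mk_hom] at w
  let sq : ValuativeCommSq X.hom :=
    { R := V, K := L, i₁ := ξ.left, i₂ := Spec.map (CommRingCat.ofHom (algebraMap k V))
      commSq := ⟨by
        rw [w, ← Spec.map_comp, ← CommRingCat.ofHom_comp, ← IsScalarTower.algebraMap_eq]⟩ }
  obtain ⟨l⟩ := (hv.existence sq).exists_lift
  refine ⟨Over.homMk l.l l.fac_right, ?_⟩
  ext1
  exact l.fac_left

/-- a chart at a rational point -/
lemma exists_chart {X : OverR k} (hX : LocallyOfFiniteType X.hom) (x : X.left) :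
    ∃ (C : Type) (_ : CommRing C) (_ : Algebra k C) (ι : SpO k C ⟶ X), Algebra.FiniteType k C ∧
      IsOpenImmersion ι.left ∧ x ∈ Set.range ι.left := by
  obtain ⟨_, ⟨U, hU, rfl⟩, hxU, -⟩ := X.left.isBasis_affineOpens.exists_subset_of_mem_open
    (Set.mem_univ x) isOpen_univ
  replace hU : IsAffineOpen U := hU
  let f : Spec Γ(X.left, U) ⟶ SR k := hU.fromSpec ≫ X.hom
  obtain ⟨φ, hφ⟩ := Spec.map_surjective f
  let : Algebra k Γ(X.left, U) := φ.hom.toAlgebra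
  have hl : LocallyOfFiniteType f := by
    have := hX
    have h1 : LocallyOfFiniteType hU.fromSpec := inferInstance
    exact MorphismProperty.comp_mem _ _ _ h1 hX
  have hft : φ.hom.FiniteType := by
    rw [← hφ] at hl
    exact (HasRingHomProperty.Spec_iff (P := @LocallyOfFiniteType)).mp hl
  refine ⟨Γ(X.left, U), inferInstance, inferInstance, Over.homMk hU.fromSpec ?_, hft, ?_, ?_⟩
  · exact hφ.symm
  · exact (inferInstance : IsOpenImmersion hU.fromSpec)
  · show x ∈ Set.range hU.fromSpec
    rw [hU.range_fromSpec]; exact hxU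

lemma lift_chart {X T : OverR k} {C : Type} [CommRing C] [Algebra k C] (ι : SpO k C ⟶ X)
    (hι : IsOpenImmersion ι.left) (f : T ⟶ X) (hf : Set.range f.left ⊆ Set.range ι.left) :
    ∃ g : T ⟶ SpO k C, g ≫ ι = f := by
  refine ⟨Over.homMk (IsOpenImmersion.lift ι.left f.left hf) ?_, ?_⟩
  · rw [← Over.w ι, IsOpenImmersion.lift_fac_assoc, Over.w]
  · ext1
    exact IsOpenImmersion.lift_fac _ _ _

lemma chart_mono {X T : OverR k} {C : Type} [CommRing C] [Algebra k C] (ι : SpO k C ⟶ X)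
    (hι : IsOpenImmersion ι.left) {f g : T ⟶ SpO k C} (h : f ≫ ι = g ≫ ι) : f = g := by
  ext1
  rw [← cancel_mono ι.left]
  exact congrArg CommaMorphism.left h

/-- points of local rings with closed point in the chart come from the chart -/
lemma lift_local {X : OverR k} {C : Type} [CommRing C] [Algebra k C] (ι : SpO k C ⟶ X)
    (hι : IsOpenImmersion ι.left) {R : Type} [CommRing R] [IsLocalRing R] [Algebra k R] (z : SpO k R ⟶ X)
    (h : z.left (IsLocalRing.closedPoint R) ∈ Set.range ι.left) :
    ∃ φ : C →ₐ[k] R, sm φ ≫ ι = z := by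
  obtain ⟨g, hg⟩ := lift_chart ι hι z (by
    rintro _ ⟨y, rfl⟩
    have hy : y ⤳ (IsLocalRing.closedPoint R : PrimeSpectrum R) := IsLocalRing.specializes_closedPoint y
    exact (hy.map z.left.continuous).mem_open (hι.base_open.isOpen_range) h)
  obtain ⟨φ, rfl⟩ := sm_surj g
  exact ⟨φ, hg⟩

lemma lift_field {X : OverR k} {C : Type} [CommRing C] [Algebra k C] (ι : SpO k C ⟶ X)
    (hι : IsOpenImmersion ι.left) {R L : Type} [CommRing R] [IsLocalRing R] [Algebra k R] [Field L] [Algebra k L]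
    (π : R →ₐ[k] L) (hπ : IsLocalHom π.toRingHom) (z : SpO k R ⟶ X) (ψ : C →ₐ[k] L)
    (h : sm π ≫ z = sm ψ ≫ ι) :
    ∃ φ : C →ₐ[k] R, sm φ ≫ ι = z ∧ π.comp φ = ψ := by
  have hcl : (sm π).left (IsLocalRing.closedPoint L) = IsLocalRing.closedPoint R :=
    IsLocalRing.comap_closedPoint π.toRingHom
  obtain ⟨φ, hφ⟩ := lift_local ι hι z (by
    have h1 := congrArg CommaMorphism.left h
    have h2 := congrArg (fun f => f (IsLocalRing.closedPoint L)) h1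
    have h3 : z.left ((sm π).left (IsLocalRing.closedPoint L)) =
      ι.left ((sm ψ).left (IsLocalRing.closedPoint L)) := h2
    rw [hcl] at h3
    exact ⟨_, h3.symm⟩)
  refine ⟨φ, hφ, sm_inj (chart_mono ι hι ?_)⟩
  rw [← h, sm_comp, Category.assoc, hφ]

end PtF
end

end

section
open CategoryTheory AlgebraicGeometry Limits
noncomputable section

namespace Cartier
open MvPolynomial IsLocalRing

section
variable {k O ι : Type} [Field k] [CommRing O] [Algebra k O] [IsLocalRing O]

/-- `P` is a form of degree `d` representing `g` modulo `m^(d+1)`. -/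
def LF (k : Type) {O ι : Type} [Field k] [CommRing O] [Algebra k O] [IsLocalRing O] (x : ι → O) (g : O) (d : ℕ) (P : MvPolynomial ι k) : Prop :=
  P.IsHomogeneous d ∧ g - aeval x P ∈ maximalIdeal O ^ (d + 1)

lemma aeval_mem {x : ι → O} (hx : ∀ i, x i ∈ maximalIdeal O) {d : ℕ} {P : MvPolynomial ι k}
    (hP : P.IsHomogeneous d) : aeval x P ∈ maximalIdeal O ^ d := by
  rw [aeval_def, eval₂_eq]
  refine Ideal.sum_mem _ fun s hs => Ideal.mul_mem_left _ _ ?_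
  have h1 := hP (mem_support_iff.1 hs)
  have : ∏ i ∈ s.support, x i ^ s i ∈ ∏ i ∈ s.support, maximalIdeal O ^ s i :=
    Ideal.prod_mem_prod fun i _ => Ideal.pow_mem_pow (hx i) _
  rw [Finset.prod_pow_eq_pow_sum] at this
  convert this using 2
  rw [← h1, Finsupp.weight_apply]
  simp [Finsupp.sum]

lemma LF.mem {x : ι → O} (hx : ∀ i, x i ∈ maximalIdeal O) {g : O} {d : ℕ}
    {P : MvPolynomial ι k} (h : LF k x g d P) : g ∈ maximalIdeal O ^ d := by
  have := Ideal.add_mem _ (Ideal.pow_le_pow_right (Nat.le_succ d) h.2) (aeval_mem hx h.1)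
  simpa using this

lemma LF.mul {x : ι → O} (hx : ∀ i, x i ∈ maximalIdeal O) {g h : O} {d e : ℕ}
    {P Q : MvPolynomial ι k} (hg : LF k x g d P) (hh : LF k x h e Q) :
    LF k x (g * h) (d + e) (P * Q) := by
  refine ⟨hg.1.mul hh.1, ?_⟩
  have e1 : g * h - aeval x (P * Q) = (g - aeval x P) * h + aeval x P * (h - aeval x Q) := by
    rw [map_mul]; ring
  rw [e1]
  refine Ideal.add_mem _ ?_ ?_
  · have := Ideal.mul_mem_mul hg.2 (hh.mem hx)
    rw [← pow_add] at this
    convert this using 2; ring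
  · have := Ideal.mul_mem_mul (aeval_mem hx hg.1) hh.2
    rw [← pow_add] at this
    convert this using 2; ring

lemma LF.pow {x : ι → O} (hx : ∀ i, x i ∈ maximalIdeal O) {g : O} {d : ℕ}
    {P : MvPolynomial ι k} (hg : LF k x g d P) (l : ℕ) :
    LF k x (g ^ l) (l * d) (P ^ l) := by
  induction l with
  | zero => exact ⟨by simpa using isHomogeneous_one ι k, by simp⟩
  | succ l ih =>
    rw [pow_succ, pow_succ, Nat.succ_mul]
    exact ih.mul hx hg

lemma exists_LF [Finite ι] {x : ι → O} (hx : Ideal.span (Set.range x) = maximalIdeal O)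
    (hk : ∀ g : O, ∃ c : k, g - algebraMap k O c ∈ maximalIdeal O) (d : ℕ) :
    ∀ g ∈ maximalIdeal O ^ d, ∃ P, LF k x g d P := by
  have hx' : ∀ i, x i ∈ maximalIdeal O := fun i => hx ▸ Ideal.subset_span ⟨i, rfl⟩
  have add : ∀ d (g h : O), (∃ P, LF k x g d P) → (∃ P, LF k x h d P) →
      ∃ P, LF k x (g + h) d P := by
    rintro d g h ⟨P, hP⟩ ⟨Q, hQ⟩
    refine ⟨P + Q, hP.1.add hQ.1, ?_⟩
    rw [map_add, add_sub_add_comm]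
    exact Ideal.add_mem _ hP.2 hQ.2
  have h0 : ∀ g : O, ∃ P, LF k x g 0 P := fun g => by
    obtain ⟨c, hc⟩ := hk g
    exact ⟨C c, isHomogeneous_C _ _, by simpa using hc⟩
  induction d with
  | zero => intro g _; exact h0 g
  | succ d ih =>
    intro g hg
    rw [pow_succ'] at hg
    refine Submodule.mul_induction_on hg ?_ (fun a b => add _ a b)
    intro a ha b hb
    obtain ⟨Q, hQ⟩ := ih b hb
    have : ∃ P, LF k x a 1 P := by
      rw [← hx] at ha
      refine Submodule.span_induction ?_ ?_ ?_ ?_ ha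
      · rintro _ ⟨i, rfl⟩
        exact ⟨X i, isHomogeneous_X _ _, by simp⟩
      · exact ⟨0, isHomogeneous_zero _ _ _, by simp⟩
      · intro a b _ _ h1 h2; exact add _ a b h1 h2
      · intro a b _ ⟨P, hP⟩
        obtain ⟨R, hR⟩ := h0 a
        have := hR.mul hx' hP
        exact ⟨_, by simpa using this⟩
    obtain ⟨P, hP⟩ := this
    exact ⟨P * Q, by simpa [add_comm] using hP.mul hx' hQ⟩

lemma deriv_mem {D : Derivation k O O} (d : ℕ) : ∀ g ∈ maximalIdeal O ^ (d + 1),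
    D g ∈ maximalIdeal O ^ d := by
  induction d with
  | zero => simp
  | succ d ih =>
    intro g hg
    rw [pow_succ'] at hg
    refine Submodule.mul_induction_on hg ?_ ?_
    · intro a ha b hb
      rw [Derivation.leibniz]
      refine Ideal.add_mem _ ?_ ?_
      · rw [pow_succ']; exact Ideal.mul_mem_mul ha (ih b hb)
      · exact Ideal.mul_mem_right _ _ hb
    · intro a b ha hb; rw [map_add]; exact Ideal.add_mem _ ha hb

lemma deriv_aeval [Fintype ι] (D : Derivation k O O) (x : ι → O) (P : MvPolynomial ι k) :
    D (aeval x P) = ∑ j, aeval x (pderiv j P) * D (x j) := by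
  classical
  induction P using MvPolynomial.induction_on with
  | C a => simp
  | add p q hp hq => simp [hp, hq, add_mul, Finset.sum_add_distrib]
  | mul_X p i hp =>
    simp only [map_mul, aeval_X, Derivation.leibniz, hp, smul_eq_mul, pderiv_X, map_add,
      add_mul, Finset.sum_add_distrib]
    rw [Finset.mul_sum]
    congr 1
    · rw [Finset.sum_eq_single i]
      · simp
      · intro b _ hb; simp [Pi.single_apply, hb.symm]
      · simp
    · refine Finset.sum_congr rfl fun j _ => by ring

lemma form_eq_zero [CharZero k] [Fintype ι] [DecidableEq ι] {x : ι → O}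
    (hx' : ∀ i, x i ∈ maximalIdeal O)
    (D : ι → Derivation k O O)
    (hD : ∀ i j, D i (x j) - (if i = j then 1 else 0) ∈ maximalIdeal O) (d : ℕ) :
    ∀ P : MvPolynomial ι k, P.IsHomogeneous d → aeval x P ∈ maximalIdeal O ^ (d + 1) → P = 0 := by
  induction d with
  | zero =>
    intro P hP h
    obtain ⟨c, rfl⟩ : ∃ c, P = C c := ⟨_, totalDegree_eq_zero_iff_eq_C.1 (by simpa using hP.totalDegree_le)⟩
    by_contra h0
    have hc : c ≠ 0 := by rintro rfl; simp at h0
    simp only [algHom_C, zero_add, pow_one] at h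
    exact h ((IsUnit.mk0 c hc).map (algebraMap k O))
  | succ d ih =>
    intro P hP h
    have key : ∀ i, pderiv i P = 0 := by
      intro i
      have hom : ∀ j, (pderiv j P).IsHomogeneous d := fun j => by simpa using hP.pderiv (i := j)
      refine ih _ (hom i) ?_
      have h1 := deriv_mem (D := D i) (d + 1) _ h
      rw [deriv_aeval] at h1
      have h2 : ∑ j, aeval x (pderiv j P) * (D i (x j) - (if i = j then 1 else 0))
          ∈ maximalIdeal O ^ (d + 1) := by
        refine Ideal.sum_mem _ fun j _ => ?_
        rw [pow_succ]
        exact Ideal.mul_mem_mul (aeval_mem hx' (hom j)) (hD i j)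
      have := Ideal.sub_mem _ h1 h2
      rw [← Finset.sum_sub_distrib] at this
      convert this
      simp [mul_sub]
    have := hP.sum_X_mul_pderiv
    simp only [key, mul_zero, Finset.sum_const_zero] at this
    have h3 := this.symm
    rw [nsmul_eq_mul, mul_eq_zero] at h3
    rcases h3 with h3 | h3
    · exfalso
      exact Nat.cast_ne_zero.2 (Nat.succ_ne_zero d) h3
    · exact h3

lemma LF.congr_zero {x : ι → O} {d : ℕ} {P Q : MvPolynomial ι k} {g : O}
    (A : ∀ d, ∀ P : MvPolynomial ι k, P.IsHomogeneous d → aeval x P ∈ maximalIdeal O ^ (d + 1) → P = 0)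
    (h : LF k x g d P) (h' : LF k x g d Q) : P = Q := by
  rw [← sub_eq_zero]
  refine A d _ (h.1.sub h'.1) ?_
  have := Ideal.sub_mem _ h'.2 h.2
  simpa using this

lemma exists_order [IsNoetherianRing O] {g : O} (hg : g ≠ 0) :
    ∃ d, g ∈ maximalIdeal O ^ d ∧ g ∉ maximalIdeal O ^ (d + 1) := by
  by_contra! H
  have : ∀ d, g ∈ maximalIdeal O ^ d := fun d => by
    induction d with
    | zero => simp
    | succ d ih => exact H d ih
  have h2 : g ∈ ⨅ i, maximalIdeal O ^ i := by simpa [Ideal.mem_iInf] using this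
  rw [Ideal.iInf_pow_eq_bot_of_isLocalRing _ (maximalIdeal.isMaximal O).ne_top] at h2
  exact hg h2

lemma exists_LF_ne [IsNoetherianRing O] [Finite ι] {x : ι → O}
    (hx : Ideal.span (Set.range x) = maximalIdeal O)
    (hk : ∀ g : O, ∃ c : k, g - algebraMap k O c ∈ maximalIdeal O) {g : O} (hg : g ≠ 0) :
    ∃ d P, LF k x g d P ∧ P ≠ 0 := by
  obtain ⟨d, h1, h2⟩ := exists_order hg
  obtain ⟨P, hP⟩ := exists_LF hx hk d g h1
  refine ⟨d, P, hP, ?_⟩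
  rintro rfl
  exact h2 (by simpa using hP.2)

lemma isDomain_of [IsNoetherianRing O] [Finite ι] {x : ι → O}
    (hx : Ideal.span (Set.range x) = maximalIdeal O)
    (hk : ∀ g : O, ∃ c : k, g - algebraMap k O c ∈ maximalIdeal O)
    (A : ∀ d, ∀ P : MvPolynomial ι k, P.IsHomogeneous d → aeval x P ∈ maximalIdeal O ^ (d + 1) → P = 0) :
    IsDomain O := by
  have hx' : ∀ i, x i ∈ maximalIdeal O := fun i => hx ▸ Ideal.subset_span ⟨i, rfl⟩
  have : NoZeroDivisors O := ⟨by
    intro a b hab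
    by_contra! H
    obtain ⟨d, P, hP, hP0⟩ := exists_LF_ne hx hk H.1
    obtain ⟨e, Q, hQ, hQ0⟩ := exists_LF_ne hx hk H.2
    have := hP.mul hx' hQ
    rw [hab] at this
    exact mul_ne_zero hP0 hQ0 (LF.congr_zero A this ⟨isHomogeneous_zero _ _ _, by simp⟩)⟩
  exact NoZeroDivisors.to_isDomain O

lemma hom_dvd {P Q : MvPolynomial ι k} {d e : ℕ} (hP : P.IsHomogeneous d) (hQ : Q.IsHomogeneous e)
    (hP0 : P ≠ 0) (h : Q ∣ P) : ∃ f R, d = e + f ∧ R.IsHomogeneous f ∧ P = Q * R := by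
  classical
  obtain ⟨R, rfl⟩ := h
  have hQ0 := left_ne_zero_of_mul hP0
  have hR0 := right_ne_zero_of_mul hP0
  have hd := hP.totalDegree hP0
  rw [totalDegree_mul_of_isDomain hQ0 hR0, hQ.totalDegree hQ0] at hd
  refine ⟨R.totalDegree, homogeneousComponent R.totalDegree R, hd.symm,
    homogeneousComponent_isHomogeneous _ _, ?_⟩
  let _ : GradedAlgebra (homogeneousSubmodule ι k) := gradedAlgebra
  have h1 := DirectSum.coe_decompose_mul_add_of_left_mem (homogeneousSubmodule ι k) (i := e) (j := R.totalDegree) (a := Q) (b := R) hQ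
  rw [hd] at h1
  rw [DirectSum.decompose_of_mem_same (homogeneousSubmodule ι k) hP] at h1
  rw [h1]; congr 1
  exact decomposition.decompose'_apply R _

lemma isIntegrallyClosed_of [IsNoetherianRing O] [Finite ι] {x : ι → O}
    (hx : Ideal.span (Set.range x) = maximalIdeal O)
    (hk : ∀ g : O, ∃ c : k, g - algebraMap k O c ∈ maximalIdeal O)
    (A : ∀ d, ∀ P : MvPolynomial ι k, P.IsHomogeneous d → aeval x P ∈ maximalIdeal O ^ (d + 1) → P = 0)
    [IsDomain O] :
    IsIntegrallyClosed O := by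
  have hx' : ∀ i, x i ∈ maximalIdeal O := fun i => hx ▸ Ideal.subset_span ⟨i, rfl⟩
  rw [isIntegrallyClosed_iff (FractionRing O)]
  intro h hh
  obtain ⟨p, q, hq, rfl⟩ := IsFractionRing.div_surjective O h
  have hq0 : q ≠ 0 := nonZeroDivisors.ne_zero hq
  set φ := algebraMap O (FractionRing O)
  have hφ : Function.Injective φ := IsFractionRing.injective _ _
  have hφq : φ q ≠ 0 := by simpa [φ] using hq0
  obtain ⟨e, Q, hQ, hQ0⟩ := exists_LF_ne (k := k) hx hk hq0
  -- one step
  have step : ∀ p', IsIntegral O (φ p' / φ q) → p' ≠ 0 → ∀ d, p' ∈ maximalIdeal O ^ d →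
      ∃ u, p' - q * u ∈ maximalIdeal O ^ (d + 1) := by
    intro p' hintg hp' d hd
    obtain ⟨P, hP⟩ := exists_LF (k := k) hx hk d _ hd
    by_cases hP0 : P = 0
    · subst hP0; exact ⟨0, by simpa using hP.2⟩
    obtain ⟨c, hc, hcl⟩ := hintg.isAlmostIntegral
    have hc0 : c ≠ 0 := nonZeroDivisors.ne_zero hc
    obtain ⟨dc, Pc, hPc, hPc0⟩ := exists_LF_ne (k := k) hx hk hc0
    have dv : ∀ l, Q ^ l ∣ Pc * P ^ l := by
      intro l
      obtain ⟨r, hr⟩ := hcl l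
      have e1 : c * p' ^ l = q ^ l * r := by
        apply hφ
        rw [map_mul, map_mul, map_pow, map_pow]
        change φ r = _ at hr
        rw [hr, Algebra.smul_def, div_pow]
        change _ = φ q ^ l * (φ c * _)
        field_simp
      have hr0 : r ≠ 0 := by
        rintro rfl
        rw [mul_zero] at e1
        exact mul_ne_zero hc0 (pow_ne_zero _ hp') e1
      obtain ⟨dr, Pr, hPr, hPr0⟩ := exists_LF_ne (k := k) hx hk hr0
      have L1 := hPc.mul hx' (hP.pow hx' l)
      have L2 := (hQ.pow hx' l).mul hx' hPr
      rw [e1] at L1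
      -- degrees agree
      have hdeg : dc + l * d = l * e + dr := by
        rcases lt_trichotomy (dc + l * d) (l * e + dr) with H | H | H
        · exfalso
          have := Ideal.pow_le_pow_right (I := maximalIdeal O) H (L2.mem hx')
          exact mul_ne_zero hPc0 (pow_ne_zero _ hP0)
            (LF.congr_zero A L1 ⟨isHomogeneous_zero _ _ _, by simpa using this⟩)
        · exact H
        · exfalso
          have := Ideal.pow_le_pow_right (I := maximalIdeal O) H (L1.mem hx')
          exact mul_ne_zero (pow_ne_zero _ hQ0) hPr0
            (LF.congr_zero A L2 ⟨isHomogeneous_zero _ _ _, by simpa using this⟩)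
      rw [hdeg] at L1
      exact ⟨Pr, LF.congr_zero A L1 L2⟩
    have hdvd : Q ∣ P := by
      let ψ := algebraMap (MvPolynomial ι k) (FractionRing (MvPolynomial ι k))
      have hψ : Function.Injective ψ := IsFractionRing.injective _ _
      have hψq : ψ Q ≠ 0 := by simpa [ψ] using hQ0
      have : IsAlmostIntegral (MvPolynomial ι k) (ψ P / ψ Q) := by
        refine ⟨Pc, mem_nonZeroDivisors_of_ne_zero hPc0, fun n => ?_⟩
        obtain ⟨r, hr⟩ := dv n
        refine ⟨r, ?_⟩
        change ψ r = _
        rw [Algebra.smul_def, div_pow]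
        change _ = ψ Pc * _
        rw [mul_div_assoc', eq_div_iff (pow_ne_zero _ hψq), ← map_pow, ← map_pow, ← map_mul, ← map_mul, hr, mul_comm]
      have h2 := (isIntegrallyClosed_iff (FractionRing (MvPolynomial ι k))).1 inferInstance
        this.isIntegral
      obtain ⟨y, hy⟩ := h2
      refine ⟨y, hψ ?_⟩
      change ψ y = _ at hy
      rw [map_mul, hy]; field_simp
    obtain ⟨f, R, hdf, hR, hPR⟩ := hom_dvd hP.1 hQ.1 hP0 hdvd
    refine ⟨aeval x R, ?_⟩
    have L3 : LF k x (aeval x R) f R := ⟨hR, by simp⟩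
    have L4 := hQ.mul hx' L3
    rw [← hdf, ← hPR] at L4
    have := Ideal.sub_mem _ hP.2 L4.2
    simpa using this
  have all : ∀ d, ∃ u, p - q * u ∈ maximalIdeal O ^ d := by
    intro d
    induction d with
    | zero => exact ⟨0, by simp⟩
    | succ d ih =>
      obtain ⟨u, hu⟩ := ih
      by_cases h0 : p - q * u = 0
      · exact ⟨u, by rw [h0]; simp⟩
      obtain ⟨v, hv⟩ := step (p - q * u) (by
        have : φ (p - q * u) / φ q = φ p / φ q - φ u := by
          rw [map_sub, map_mul]; field_simp
        rw [this]
        exact hh.sub (isIntegral_algebraMap)) h0 d hu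
      exact ⟨u + v, by convert hv using 1; ring⟩
  -- Krull
  have hmem : p ∈ Ideal.span {q} := by
    have h1 := Ideal.iInf_pow_smul_eq_bot_of_isLocalRing (M := O ⧸ Ideal.span {q})
      (maximalIdeal O) (maximalIdeal.isMaximal O).ne_top
    rw [← Ideal.Quotient.eq_zero_iff_mem, ← Submodule.mem_bot O, ← h1, Submodule.mem_iInf]
    intro i
    obtain ⟨u, hu⟩ := all i
    have : Ideal.Quotient.mk (Ideal.span {q}) p = (p - q * u) • (1 : O ⧸ Ideal.span {q}) := by
      rw [Algebra.smul_def, mul_one]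
      change _ = Ideal.Quotient.mk (Ideal.span {q}) _
      rw [Ideal.Quotient.eq]
      exact Ideal.mem_span_singleton.2 ⟨u, by ring⟩
    rw [this]
    exact Submodule.smul_mem_smul hu trivial
  obtain ⟨u, hu⟩ := Ideal.mem_span_singleton.1 hmem
  refine ⟨u, ?_⟩
  change φ u = _
  rw [hu, map_mul]; field_simp

/-- Cartier: a Noetherian local algebra with enough derivations is a normal domain. -/
theorem normal_of_derivations [CharZero k] [IsNoetherianRing O] [Fintype ι] [DecidableEq ι] {x : ι → O}
    (hx : Ideal.span (Set.range x) = maximalIdeal O)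
    (hk : ∀ g : O, ∃ c : k, g - algebraMap k O c ∈ maximalIdeal O)
    (D : ι → Derivation k O O)
    (hD : ∀ i j, D i (x j) - (if i = j then 1 else 0) ∈ maximalIdeal O) :
    IsDomain O ∧ IsIntegrallyClosed O := by
  have hx' : ∀ i, x i ∈ maximalIdeal O := fun i => hx ▸ Ideal.subset_span ⟨i, rfl⟩
  have A := form_eq_zero hx' D hD
  have := isDomain_of hx hk A
  exact ⟨this, isIntegrallyClosed_of hx hk A⟩

end
end Cartier
end

end

section
open CategoryTheory AlgebraicGeometry Limits
noncomputable section

namespace CurveSel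
open IsLocalRing

section
variable {k V : Type} [Field k] [CommRing V] [IsDomain V] [Algebra k V]

lemma exists_toPowerSeries_aux (π : V) (hπ : π ≠ 0) (hu : ¬ IsUnit π)
    (hk : ∀ g : V, ∃ c : k, ∃ u : V, g = algebraMap k V c + π * u) :
    ∃ (φ : V →ₐ[k] PowerSeries k) (T : V → V) , (∀ v, φ v = PowerSeries.C (PowerSeries.constantCoeff (φ v)) + PowerSeries.X * φ (T v)) ∧ ∀ v,
      v = algebraMap k V (PowerSeries.constantCoeff (φ v)) + π * T v := by
  choose r T hrT using hk
  have uniq : ∀ (c c' : k) (u u' : V), algebraMap k V c + π * u = algebraMap k V c' + π * u' →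
      c = c' ∧ u = u' := by
    intro c c' u u' h
    have hc : c = c' := by
      by_contra hne
      apply hu
      have h1 : algebraMap k V (c - c') = π * (u' - u) := by rw [map_sub]; linear_combination h
      exact isUnit_of_mul_isUnit_left (h1 ▸ (IsUnit.mk0 _ (sub_ne_zero.2 hne)).map (algebraMap k V))
    subst hc
    exact ⟨rfl, mul_left_cancel₀ hπ (add_left_cancel h)⟩
  have radd : ∀ v w, r (v + w) = r v + r w ∧ T (v + w) = T v + T w := fun v w => by
    apply uniq
    rw [← hrT, map_add]
    linear_combination hrT v + hrT w
  have rmul : ∀ v w, r (v * w) = r v * r w ∧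
      T (v * w) = T v * w + algebraMap k V (r v) * T w := fun v w => by
    apply uniq
    rw [← hrT, map_mul]
    linear_combination w * hrT v + algebraMap k V (r v) * hrT w
  have rC : ∀ c : k, r (algebraMap k V c) = c ∧ T (algebraMap k V c) = 0 := fun c => by
    apply uniq
    rw [← hrT]; ring
  have T0 : T 0 = 0 := by simpa using (rC 0).2
  have r0 : r 0 = 0 := by simpa using (rC 0).1
  let f : V → PowerSeries k := fun v => PowerSeries.mk fun n => r (T^[n] v)
  have fX : ∀ v, f v = PowerSeries.C (r v) + PowerSeries.X * f (T v) := by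
    intro v
    ext n
    cases n with
    | zero => simp [f]
    | succ n => simp [f, PowerSeries.coeff_succ_X_mul, PowerSeries.coeff_C]
  have Tadd : ∀ n v w, T^[n] (v + w) = T^[n] v + T^[n] w := by
    intro n
    induction n with
    | zero => simp
    | succ n ih => intro v w; simp [(radd v w).2, ih]
  have fadd : ∀ v w, f (v + w) = f v + f w := by
    intro v w; ext n; simp [f, Tadd, (radd _ _).1]
  have fC : ∀ c : k, f (algebraMap k V c) = PowerSeries.C c := by
    intro c
    rw [fX, (rC c).1, (rC c).2]
    have : f 0 = 0 := by
      have := fadd 0 0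
      simpa using this
    rw [this]; simp
  have fsmul : ∀ (n : ℕ) (c : k) (v : V), PowerSeries.coeff n (f (algebraMap k V c * v)) =
      c * PowerSeries.coeff n (f v) := by
    intro n
    induction n with
    | zero => intro c v; simp [f, (rmul _ _).1, (rC c).1]
    | succ n ih =>
      intro c v
      rw [fX, fX v, (rmul _ _).1, (rmul _ _).2, (rC c).1, (rC c).2]
      simp [PowerSeries.coeff_succ_X_mul, PowerSeries.coeff_C, ih]
  have fsmul' : ∀ (c : k) (v : V), f (algebraMap k V c * v) = PowerSeries.C c * f v := by
    intro c v; ext n; rw [fsmul, PowerSeries.coeff_C_mul]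
  have fmul : ∀ (n : ℕ) v w, PowerSeries.coeff n (f (v * w)) = PowerSeries.coeff n (f v * f w) := by
    intro n
    induction n with
    | zero => intro v w; simp [f, (rmul _ _).1]
    | succ n ih =>
      intro v w
      rw [fX (v * w), (rmul _ _).1, (rmul _ _).2, fadd, fsmul']
      have e : f v * f w = PowerSeries.C (r v) * PowerSeries.C (r w) +
        PowerSeries.X * (f (T v) * f w + PowerSeries.C (r v) * f (T w)) := by
        rw [fX v]
        conv_lhs => rw [add_mul, fX w]
        ring_nf
        rw [fX w]
        ring
      rw [e, map_add, map_add, ← map_mul, PowerSeries.coeff_succ_X_mul, PowerSeries.coeff_succ_X_mul,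
        map_add, map_add, ih]
  have fmul' : ∀ v w, f (v * w) = f v * f w := fun v w => by ext n; exact fmul n v w
  have cc : ∀ v, PowerSeries.constantCoeff (f v) = r v := fun v => by simp [f]
  let φ : V →ₐ[k] PowerSeries k :=
    { toFun := f
      map_one' := by simpa using fC 1
      map_mul' := fmul'
      map_zero' := by simpa using fC 0
      map_add' := fadd
      commutes' := fun c => by rw [fC]; rfl }
  refine ⟨φ, T, fun v => ?_, fun v => ?_⟩
  · change f v = PowerSeries.C (PowerSeries.constantCoeff (f v)) + _
    rw [cc]; exact fX v
  · change v = algebraMap k V (PowerSeries.constantCoeff (f v)) + _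
    rw [cc]; exact hrT v

lemma exists_toPowerSeries [IsLocalRing V] [IsNoetherianRing V] (π : V) (hπ : π ≠ 0)
    (hm : maximalIdeal V = Ideal.span {π})
    (hk : ∀ g : V, ∃ c : k, g - algebraMap k V c ∈ maximalIdeal V) :
    ∃ φ : V →ₐ[k] PowerSeries k, Function.Injective φ ∧
      ∀ v ∈ maximalIdeal V, PowerSeries.constantCoeff (φ v) = 0 := by
  have hu : ¬ IsUnit π := by
    have : π ∈ maximalIdeal V := hm ▸ Ideal.mem_span_singleton_self π
    exact this
  obtain ⟨φ, T, h1, h2⟩ := exists_toPowerSeries_aux (k := k) π hπ hu (fun g => by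
    obtain ⟨c, hc⟩ := hk g
    rw [hm] at hc
    obtain ⟨u, hu⟩ := Ideal.mem_span_singleton.1 hc
    exact ⟨c, u, by rw [← hu]; ring⟩)
  refine ⟨φ, ?_, ?_⟩
  · rw [injective_iff_map_eq_zero]
    intro v hv
    have key : ∀ n, ∀ v, φ v = 0 → v ∈ maximalIdeal V ^ n := by
      intro n
      induction n with
      | zero => simp
      | succ n ih =>
        intro v hv
        have a1 := h1 v
        have a2 := h2 v
        rw [hv] at a1 a2
        simp only [map_zero, zero_add] at a1 a2
        have := (mul_eq_zero.1 a1.symm).resolve_left PowerSeries.X_ne_zero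
        rw [a2, pow_succ']
        exact Ideal.mul_mem_mul (by rw [hm]; exact Ideal.mem_span_singleton_self π) (ih _ this)
    have h3 : v ∈ ⨅ i, maximalIdeal V ^ i := by
      rw [Ideal.mem_iInf]; exact fun n => key n v hv
    rw [Ideal.iInf_pow_eq_bot_of_isLocalRing _ (maximalIdeal.isMaximal V).ne_top] at h3
    exact h3
  · intro v hv
    by_contra hne
    refine hv ?_
    have e1 := h2 v
    have : IsUnit (algebraMap k V (PowerSeries.constantCoeff (φ v))) :=
      (IsUnit.mk0 _ hne).map (algebraMap k V)
    have h4 : algebraMap k V (PowerSeries.constantCoeff (φ v)) = v - π * T v := by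
      linear_combination -e1
    have h5 : v - π * T v ∈ maximalIdeal V :=
      Ideal.sub_mem _ hv (Ideal.mul_mem_right _ _ (by rw [hm]; exact Ideal.mem_span_singleton_self π))
    rw [← h4] at h5
    exact absurd this h5

end
end CurveSel
end

end

section
open CategoryTheory AlgebraicGeometry Limits
noncomputable section

namespace CurveSel
open IsLocalRing Polynomial

lemma residue_loc {k C V : Type} [Field k] [CommRing C] [Algebra k C] [CommRing V] [Algebra k V]
    [Algebra C V] [IsScalarTower k C V] (N : Ideal C) [N.IsPrime] [IsLocalization.AtPrime V N]
    [IsLocalRing V]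
    (hres : ∀ c : C, ∃ a : k, c - algebraMap k C a ∈ N) (v : V) :
    ∃ a : k, v - algebraMap k V a ∈ maximalIdeal V := by
  have hmap : ∀ c ∈ N, algebraMap C V c ∈ maximalIdeal V := fun c hc =>
    (IsLocalization.AtPrime.to_map_mem_maximal_iff V N c).2 hc
  obtain ⟨c, s, rfl⟩ := IsLocalization.exists_mk'_eq N.primeCompl v
  obtain ⟨a, ha⟩ := hres c
  obtain ⟨b, hb⟩ := hres s
  have hb0 : b ≠ 0 := by
    rintro rfl
    rw [map_zero, sub_zero] at hb
    exact s.2 hb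
  refine ⟨a / b, ?_⟩
  have hs : algebraMap C V s ∉ maximalIdeal V := fun h =>
    s.2 ((IsLocalization.AtPrime.to_map_mem_maximal_iff V N (s : C)).1 h)
  refine (((maximalIdeal.isMaximal V).isPrime.mem_or_mem ?_)).resolve_left hs
  rw [mul_sub, IsLocalization.mk'_spec']
  have e : algebraMap C V c - algebraMap C V s * algebraMap k V (a / b) =
      algebraMap C V (c - algebraMap k C a) -
        algebraMap C V (s - algebraMap k C b) * algebraMap k V (a/b) := by
    have : algebraMap k V (a/b) = algebraMap C V (algebraMap k C (a / b)) :=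
      IsScalarTower.algebraMap_apply k C V _
    rw [this, ← map_mul, ← map_mul, ← map_sub, ← map_sub]
    congr 1
    have : algebraMap k C a = algebraMap k C b * algebraMap k C (a/b) := by
      rw [← map_mul]; congr 1; field_simp
    rw [this]; ring
  rw [e]
  exact Ideal.sub_mem _ (hmap _ ha) (Ideal.mul_mem_right _ _ (hmap _ hb))

lemma curve_case {k B : Type} [Field k] [IsAlgClosed k] [CharZero k] [CommRing B] [IsDomain B]
    [Algebra k B] (f : Polynomial k →ₐ[k] B) (hinj : Function.Injective f) (hfin : f.Finite)
    (n : Ideal B) [n.IsPrime] (hn : f X ∈ n) :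
    ∃ φ : B →ₐ[k] PowerSeries k, Function.Injective φ ∧
      ∀ v ∈ n, PowerSeries.constantCoeff (φ v) = 0 := by
  algebraize [f.toRingHom]
  have hf : ∀ p, algebraMap k[X] B p = f p := fun _ => rfl
  have : FaithfulSMul k[X] B := (faithfulSMul_iff_algebraMap_injective _ _).2 hinj
  have : IsScalarTower k k[X] B := IsScalarTower.of_algHom f
  let L := FractionRing B
  let K := FractionRing k[X]
  have inj2 : Function.Injective (algebraMap k[X] L) := by
    rw [IsScalarTower.algebraMap_eq k[X] B L]
    exact (IsFractionRing.injective B L).comp hinj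
  have : FaithfulSMul k[X] L := (faithfulSMul_iff_algebraMap_injective _ _).2 inj2
  letI : Algebra K L := FractionRing.liftAlgebra k[X] L
  have : IsScalarTower k[X] K L := inferInstance
  have : Module.Finite k[X] B := hfin
  have hfd : FiniteDimensional K L := .of_isLocalization k[X] B (nonZeroDivisors k[X])
  have : CharZero K := charZero_of_injective_algebraMap (IsFractionRing.injective k[X] K)
  let C := integralClosure k[X] L
  have : IsDedekindDomain C := integralClosure.isDedekindDomain k[X] K L
  let g : B →ₐ[k[X]] C := IsIntegralClosure.lift k[X] C L
  have hg : ∀ b, algebraMap C L (g b) = algebraMap B L b :=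
    fun b => IsIntegralClosure.algebraMap_lift k[X] C L b
  have ginj : Function.Injective g := fun a b h => by
    apply IsFractionRing.injective B L
    rw [← hg, ← hg, h]
  letI : Algebra B C := g.toRingHom.toAlgebra
  have : IsScalarTower k[X] B C := IsScalarTower.of_algHom g
  have : Algebra.IsIntegral k[X] C := inferInstance
  have : Algebra.IsIntegral B C := Algebra.IsIntegral.tower_top (R := k[X])
  obtain ⟨N, -, hN, hNn⟩ := Ideal.exists_ideal_over_prime_of_isIntegral n (⊥ : Ideal C) (by
    intro a ha
    have h1 : g a = 0 := ha
    rw [(map_eq_zero_iff g ginj).1 h1]; exact Ideal.zero_mem _)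
  have hXN : algebraMap k[X] C X ∈ N := by
    have : f X ∈ N.comap (algebraMap B C) := hNn ▸ hn
    have h1 : algebraMap B C (f X) ∈ N := this
    rwa [← hf, ← IsScalarTower.algebraMap_apply] at h1
  have hN0 : N ≠ ⊥ := by
    rintro rfl
    have h1 : algebraMap k[X] C X = 0 := hXN
    have h2 : algebraMap k[X] L X = 0 := by
      rw [IsScalarTower.algebraMap_apply k[X] C L, h1, map_zero]
    exact Polynomial.X_ne_zero (inj2 (by rw [h2, map_zero]))
  -- residue
  have hres : ∀ c : C, ∃ a : k, c - algebraMap k C a ∈ N := by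
    have : Algebra.IsIntegral k (C ⧸ N) := by
      constructor
      intro y
      obtain ⟨c, rfl⟩ := Ideal.Quotient.mk_surjective y
      obtain ⟨p, hp, hpc⟩ := Algebra.IsIntegral.isIntegral (R := k[X]) c
      refine ⟨p.map (Polynomial.constantCoeff), hp.map _, ?_⟩
      have h3 : (Ideal.Quotient.mk N).comp (algebraMap k[X] C) =
          (algebraMap k (C ⧸ N)).comp Polynomial.constantCoeff := by
        apply Polynomial.ringHom_ext
        · intro a
          change Ideal.Quotient.mk N (algebraMap k[X] C (algebraMap k k[X] a)) = algebraMap k (C ⧸ N) _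
          rw [← IsScalarTower.algebraMap_apply k k[X] C]
          simp
        · simp only [RingHom.comp_apply, Polynomial.constantCoeff_apply, coeff_X_zero, map_zero]
          exact Ideal.Quotient.eq_zero_iff_mem.2 hXN
      rw [eval₂_map, ← h3, ← Polynomial.hom_eval₂, hpc, map_zero]
    intro c
    obtain ⟨a, ha⟩ := (IsAlgClosed.algebraMap_bijective_of_isIntegral (k := k) (K := C ⧸ N)).2
      (Ideal.Quotient.mk N c)
    refine ⟨a, ?_⟩
    rw [← Ideal.Quotient.eq, ← ha]; rfl
  let V := Localization.AtPrime N
  have : IsDiscreteValuationRing V :=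
    IsLocalization.AtPrime.isDiscreteValuationRing_of_dedekind_domain C hN0 V
  obtain ⟨π, hπ⟩ := IsDiscreteValuationRing.exists_irreducible V
  have hmap : ∀ c ∈ N, algebraMap C V c ∈ maximalIdeal V := fun c hc =>
    (IsLocalization.AtPrime.to_map_mem_maximal_iff V N c).2 hc
  have hresV : ∀ v : V, ∃ a : k, v - algebraMap k V a ∈ maximalIdeal V :=
    residue_loc (V := V) N hres
  obtain ⟨φ, hφ1, hφ2⟩ := exists_toPowerSeries (k := k) π hπ.ne_zero hπ.maximalIdeal_eq hresV
  let gk : B →ₐ[k] C := g.restrictScalars k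
  let ck : C →ₐ[k] V := IsScalarTower.toAlgHom k C V
  refine ⟨(φ.comp ck).comp gk, ?_, ?_⟩
  · refine (hφ1.comp ?_).comp ginj
    exact IsLocalization.injective V N.primeCompl_le_nonZeroDivisors
  · intro v hv
    refine hφ2 _ (hmap _ ?_)
    have : v ∈ N.comap (algebraMap B C) := hNn ▸ hv
    exact this
end CurveSel
end

end

section
open CategoryTheory AlgebraicGeometry Limits
noncomputable section

namespace CurveSel
open IsLocalRing Polynomial

lemma residue_max {k B : Type} [Field k] [IsAlgClosed k] [CommRing B] [Algebra k B]
    [Algebra.FiniteType k B] (n : Ideal B) [n.IsMaximal] (b : B) :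
    ∃ a : k, b - algebraMap k B a ∈ n := by
  let _ : Field (B ⧸ n) := Ideal.Quotient.field n
  have : Module.Finite k (B ⧸ n) := finite_of_finite_type_of_isJacobsonRing _ _
  obtain ⟨a, ha⟩ := (IsAlgClosed.algebraMap_bijective_of_isIntegral (k := k) (K := B ⧸ n)).2
    (Ideal.Quotient.mk n b)
  refine ⟨a, ?_⟩
  rw [← Ideal.Quotient.eq, ← ha]; rfl

/-- the algebra hom to `k` given by a maximal ideal. -/
lemma exists_hom_of_max {k B : Type} [Field k] [IsAlgClosed k] [CommRing B] [Algebra k B]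
    [Algebra.FiniteType k B] (n : Ideal B) [n.IsMaximal] :
    ∃ φ : B →ₐ[k] k, RingHom.ker φ = n := by
  let _ : Field (B ⧸ n) := Ideal.Quotient.field n
  have : Module.Finite k (B ⧸ n) := finite_of_finite_type_of_isJacobsonRing _ _
  let e : k ≃ₐ[k] (B ⧸ n) := AlgEquiv.ofBijective (Algebra.ofId k (B ⧸ n))
    (IsAlgClosed.algebraMap_bijective_of_isIntegral (k := k) (K := B ⧸ n))
  refine ⟨e.symm.toAlgHom.comp (Ideal.Quotient.mkₐ k n), ?_⟩
  ext b
  simp [RingHom.mem_ker, Ideal.Quotient.eq_zero_iff_mem]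

theorem curve_selection {k B : Type} [Field k] [IsAlgClosed k] [CharZero k] [CommRing B] [IsDomain B]
    [Algebra k B] [Algebra.FiniteType k B] (n : Ideal B) [hmax : n.IsMaximal] (p : B) (hp : p ≠ 0) :
    ∃ φ : B →ₐ[k] PowerSeries k, (∀ v ∈ n, PowerSeries.constantCoeff (φ v) = 0) ∧ φ p ≠ 0 := by
  obtain ⟨ev, hev⟩ := exists_hom_of_max (k := k) n
  by_cases hn0 : n = ⊥
  · refine ⟨(Algebra.ofId k (PowerSeries k)).comp ev, ?_, ?_⟩
    · intro v hv
      rw [hn0] at hv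
      have : v = 0 := hv
      simp [this]
    · have : ev p ≠ 0 := by
        intro h
        have : p ∈ RingHom.ker ev := h
        rw [hev, hn0] at this
        exact hp this
      simp only [AlgHom.comp_apply]
      intro h
      exact this ((map_eq_zero_iff _ (algebraMap k (PowerSeries k)).injective).1 h)
  -- reduce to `p ∈ n`
  obtain ⟨q, hqn, hq0⟩ := Submodule.exists_mem_ne_zero_of_ne_bot hn0
  suffices H : ∃ φ : B →ₐ[k] PowerSeries k, (∀ v ∈ n, PowerSeries.constantCoeff (φ v) = 0) ∧ φ (p * q) ≠ 0 by
    obtain ⟨φ, h1, h2⟩ := H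
    exact ⟨φ, h1, fun h => h2 (by rw [map_mul, h, zero_mul])⟩
  have hpq0 : p * q ≠ 0 := mul_ne_zero hp hq0
  have hpqn : p * q ∈ n := Ideal.mul_mem_left _ _ hqn
  generalize p * q = p at hpq0 hpqn
  obtain ⟨r, f, finj, ffin⟩ := exists_finite_inj_algHom_of_fg k B
  algebraize [f.toRingHom]
  let R := MvPolynomial (Fin r) k
  have hf : ∀ p, algebraMap R B p = f p := fun _ => rfl
  have : FaithfulSMul R B := (faithfulSMul_iff_algebraMap_injective _ _).2 finj
  have : IsScalarTower k R B := IsScalarTower.of_algHom f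
  have : Module.Finite R B := ffin
  have : Algebra.IsIntegral R B := inferInstance
  -- multiple of p in R
  obtain ⟨g, hg0, b, hgb⟩ : ∃ g : R, g ≠ 0 ∧ ∃ b, f g = p * b := by
    have h1 : (Ideal.span {p}).comap (algebraMap R B) ≠ ⊥ :=
      Ideal.comap_ne_bot_of_integral_mem hpq0 (Ideal.mem_span_singleton_self p) (Algebra.IsIntegral.isIntegral p)
    obtain ⟨g, hg, hg0⟩ := Submodule.exists_mem_ne_zero_of_ne_bot h1
    obtain ⟨b, hb⟩ := Ideal.mem_span_singleton.1 (Ideal.mem_comap.1 hg)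
    exact ⟨g, hg0, b, hb⟩
  let a : Fin r → k := fun i => ev (f (MvPolynomial.X i))
  have hev2 : ev.comp f = MvPolynomial.aeval a := by
    ext i; simp [a]
  have hga : MvPolynomial.aeval a g = 0 := by
    rw [← hev2, AlgHom.comp_apply, hgb, map_mul]
    have : p ∈ RingHom.ker ev := hev ▸ hpqn
    have h2 : ev p = 0 := this
    rw [h2, zero_mul]
  obtain ⟨c, hc⟩ : ∃ c : Fin r → k, MvPolynomial.aeval c g ≠ 0 := by
    by_contra! H
    exact hg0 (MvPolynomial.funext fun c => by
      have := H c
      rw [MvPolynomial.aeval_eq_eval] at this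
      rw [map_zero]; exact this)
  obtain ⟨i0, hi0⟩ : ∃ i, c i ≠ a i := by
    by_contra! H
    have : c = a := funext H
    exact hc (this ▸ hga)
  let l : R →ₐ[k] k[X] := MvPolynomial.aeval fun i => Polynomial.C (a i) + Polynomial.C (c i - a i) * X
  have lX : ∀ i, l (MvPolynomial.X i) = Polynomial.C (a i) + Polynomial.C (c i - a i) * X := fun i =>
    MvPolynomial.aeval_X _ _
  have lsurj : Function.Surjective l := by
    rw [← AlgHom.range_eq_top, eq_top_iff, ← Polynomial.adjoin_X, Algebra.adjoin_le_iff]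
    rintro _ rfl
    refine ⟨MvPolynomial.C (c i0 - a i0)⁻¹ * (MvPolynomial.X i0 - MvPolynomial.C (a i0)), ?_⟩
    have h1 : c i0 - a i0 ≠ 0 := sub_ne_zero.2 hi0
    change l _ = _
    rw [map_mul, map_sub, lX]
    have : ∀ t : k, l (MvPolynomial.C t) = Polynomial.C t := fun t =>
      (MvPolynomial.aeval_C _ _).trans rfl
    rw [this, this, add_sub_cancel_left, ← mul_assoc, ← map_mul, inv_mul_cancel₀ h1]; simp
  have l0 : (Polynomial.aeval (0 : k)).comp l = MvPolynomial.aeval a := by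
    ext i; simp [lX]
  have l1 : (Polynomial.aeval (1 : k)).comp l = MvPolynomial.aeval c := by
    ext i; simp [lX]
  have hlg : l g ≠ 0 := fun h => hc (by rw [← l1, AlgHom.comp_apply, h, map_zero])
  let Q : Ideal R := RingHom.ker l
  have : Q.IsPrime := RingHom.ker_isPrime _
  have hQn : Q ≤ n.under R := by
    intro x hx
    have hx' : l x = 0 := hx
    change f x ∈ n
    rw [← hev, RingHom.mem_ker, ← AlgHom.comp_apply, hev2, ← l0, AlgHom.comp_apply, hx', map_zero]
  obtain ⟨P, hPn, hP, hPQ⟩ := Ideal.exists_ideal_le_liesOver_of_le (p := Q) (q := n.under R) n hQn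
  have hPQ' : ∀ x, f x ∈ P ↔ l x = 0 := fun x => by
    have := hPQ.over
    rw [← RingHom.mem_ker (f := l)]
    change _ ↔ x ∈ Q
    rw [this]; rfl
  -- k[X] → B / P
  let fP : R →ₐ[k] (B ⧸ P) := (Ideal.Quotient.mkₐ k P).comp f
  have hker : ∀ x, l x = 0 → fP x = 0 := fun x hx =>
    Ideal.Quotient.eq_zero_iff_mem.2 ((hPQ' x).2 hx)
  let F : k[X] →ₐ[k] (B ⧸ P) := AlgHom.liftOfSurjective l lsurj fP hker
  have hF : ∀ x, F (l x) = fP x := fun x => AlgHom.liftOfSurjective_apply l lsurj fP hker x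
  have Finj : Function.Injective F := by
    rw [injective_iff_map_eq_zero]
    intro y hy
    obtain ⟨x, rfl⟩ := lsurj y
    rw [hF] at hy
    exact (hPQ' x).1 (Ideal.Quotient.eq_zero_iff_mem.1 hy)
  have Ffin : F.Finite := by
    have h1 : fP.Finite := AlgHom.Finite.comp (AlgHom.Finite.of_surjective _ (Ideal.Quotient.mkₐ_surjective k P)) ffin
    have h2 : F.comp l = fP := AlgHom.ext hF
    rw [← h2] at h1
    exact AlgHom.Finite.of_comp_finite h1
  let n' : Ideal (B ⧸ P) := n.map (Ideal.Quotient.mk P)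
  have hn' : n'.IsPrime := Ideal.map_isPrime_of_surjective Ideal.Quotient.mk_surjective (by simpa using hPn)
  have hn'm : ∀ b, b ∈ n ↔ Ideal.Quotient.mk P b ∈ n' := by
    intro b
    refine ⟨Ideal.mem_map_of_mem _, fun h => ?_⟩
    have h3 : b ∈ n'.comap (Ideal.Quotient.mk P) := h
    rw [Ideal.comap_map_of_surjective _ Ideal.Quotient.mk_surjective] at h3
    have : (⊥ : Ideal (B ⧸ P)).comap (Ideal.Quotient.mk P) ≤ n := by
      rw [← RingHom.ker_eq_comap_bot, Ideal.mk_ker]; exact hPn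
    exact (sup_le le_rfl this) h3
  have hFX : F X ∈ n' := by
    obtain ⟨x, hx⟩ := lsurj X
    rw [← hx, hF]
    refine (hn'm _).1 ?_
    change f x ∈ n
    rw [← hev, RingHom.mem_ker, ← AlgHom.comp_apply, hev2, ← l0, AlgHom.comp_apply, hx]
    simp
  obtain ⟨φ, hφ1, hφ2⟩ := curve_case F Finj Ffin n' hFX
  refine ⟨φ.comp (Ideal.Quotient.mkₐ k P), fun v hv => hφ2 _ ((hn'm v).1 hv), fun h => ?_⟩
  have h1 : Ideal.Quotient.mk P p = 0 := hφ1 (by rw [map_zero]; exact h)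
  rw [Ideal.Quotient.eq_zero_iff_mem] at h1
  exact hlg ((hPQ' g).1 (hgb ▸ Ideal.mul_mem_right _ _ h1))

end CurveSel
end

end

section
open CategoryTheory AlgebraicGeometry Limits
noncomputable section

namespace Newton

/-- the linear form of slope `ρ`. -/
def Lf (ρ : ℝ) (x : ℕ × ℕ) : ℝ := x.1 + ρ * x.2

def LLt (ρ : ℝ) (Q P : Set (ℕ × ℕ)) : Prop := ∃ x ∈ Q, ∀ y ∈ P, Lf ρ x < Lf ρ y

def ini (ρ : ℝ) (S : Set (ℕ × ℕ)) : Set (ℕ × ℕ) := {x | x ∈ S ∧ ∀ y ∈ S, Lf ρ x ≤ Lf ρ y}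

lemma Lf_mono {ρ : ℝ} (hρ : 0 ≤ ρ) {x y : ℕ × ℕ} (h : x ≤ y) : Lf ρ x ≤ Lf ρ y := by
  unfold Lf
  have h1 : (x.1 : ℝ) ≤ y.1 := by exact_mod_cast h.1
  have h2 : (x.2 : ℝ) ≤ y.2 := by exact_mod_cast h.2
  gcongr

lemma exists_fin (S : Set (ℕ × ℕ)) : ∃ F : Finset (ℕ × ℕ), (F : Set (ℕ × ℕ)) ⊆ S ∧
    ∀ x ∈ S, ∃ y ∈ F, y ≤ x := by
  have hfin : {x | Minimal (· ∈ S) x}.Finite := by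
    have hpwo : (Set.univ : Set (ℕ × ℕ)).IsPWO := Set.isPWO_of_wellQuasiOrderedLE _
    exact (setOfPred_minimal_antichain _).finite_of_partiallyWellOrderedOn (hpwo.mono (Set.subset_univ _))
  refine ⟨hfin.toFinset, fun x hx => ?_, fun x hx => ?_⟩
  · simp at hx; exact hx.1
  · obtain ⟨y, hy, hy2⟩ := exists_minimal_le_of_wellFoundedLT (· ∈ S) x hx
    exact ⟨y, by simpa using hy2, hy⟩

lemma ini_nonempty {ρ : ℝ} (hρ : 0 ≤ ρ) {S : Set (ℕ × ℕ)} (hS : S.Nonempty) : (ini ρ S).Nonempty := by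
  obtain ⟨F, hF1, hF2⟩ := exists_fin S
  obtain ⟨x, hx⟩ := hS
  obtain ⟨y, hy, -⟩ := hF2 x hx
  obtain ⟨z, hz, hz2⟩ := F.exists_min_image (Lf ρ) ⟨y, hy⟩
  refine ⟨z, hF1 hz, fun w hw => ?_⟩
  obtain ⟨u, hu, huw⟩ := hF2 w hw
  exact (hz2 u hu).trans (Lf_mono hρ huw)

lemma continuous_Lf (x : ℕ × ℕ) : Continuous fun ρ => Lf ρ x := by unfold Lf; fun_prop

lemma isOpen_LLt (Q P : Set (ℕ × ℕ)) : IsOpen {ρ : ℝ | 0 < ρ ∧ LLt ρ Q P} := by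
  obtain ⟨F, hF1, hF2⟩ := exists_fin P
  have : {ρ : ℝ | 0 < ρ ∧ LLt ρ Q P} =
      Set.Ioi 0 ∩ ⋃ x ∈ Q, ⋂ y ∈ F, {ρ | Lf ρ x < Lf ρ y} := by
    ext ρ
    simp only [Set.mem_ofPred_eq, Set.mem_inter_iff, Set.mem_Ioi, Set.mem_iUnion, Set.mem_iInter, LLt]
    refine and_congr_right fun hρ => ⟨?_, ?_⟩
    · rintro ⟨x, hx, h⟩; exact ⟨x, hx, fun y hy => h y (hF1 hy)⟩
    · rintro ⟨x, hx, h⟩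
      refine ⟨x, hx, fun y hy => ?_⟩
      obtain ⟨z, hz, hzy⟩ := hF2 y hy
      exact (h z hz).trans_le (Lf_mono hρ.le hzy)
  rw [this]
  refine isOpen_Ioi.inter (isOpen_biUnion fun x _ => ?_)
  exact isOpen_biInter_finset fun y _ => isOpen_lt (continuous_Lf _) (continuous_Lf _)

/-- near `ρ0`, the minimum is attained on the initial set at `ρ0`. -/
lemma eventually_ini {ρ0 : ℝ} (h0 : 0 < ρ0) (S : Set (ℕ × ℕ)) :
    ∀ᶠ ρ in nhds ρ0, ∀ y ∈ S, ∃ x ∈ ini ρ0 S, Lf ρ x ≤ Lf ρ y := by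
  obtain ⟨F, hF1, hF2⟩ := exists_fin S
  rcases S.eq_empty_or_nonempty with rfl | hS
  · simp
  obtain ⟨x0, hx0⟩ := ini_nonempty h0.le hS
  have h1 : ∀ᶠ ρ in nhds ρ0, ∀ y ∈ F, y ∉ ini ρ0 S → Lf ρ x0 < Lf ρ y := by
    rw [Filter.eventually_all_finset]
    intro y hy
    by_cases hyi : y ∈ ini ρ0 S
    · simp [hyi]
    · have : Lf ρ0 x0 < Lf ρ0 y := by
        by_contra! hlt
        exact hyi ⟨hF1 hy, fun z hz => hlt.trans (hx0.2 z hz)⟩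
      filter_upwards [(continuous_Lf x0).continuousAt.eventually_lt (continuous_Lf y).continuousAt this] with ρ hρ _
      exact hρ
  filter_upwards [h1, lt_mem_nhds h0] with ρ hρ hρ0 y hy
  obtain ⟨z, hz, hzy⟩ := hF2 y hy
  by_cases hzi : z ∈ ini ρ0 S
  · exact ⟨z, hzi, Lf_mono (le_of_lt hρ0) hzy⟩
  · exact ⟨x0, hx0, (hρ z hz hzi).le.trans (Lf_mono (le_of_lt hρ0) hzy)⟩

theorem core {J : Type} [Finite J] (P Q : J → Set (ℕ × ℕ))
    (hex : ∃ ρ : ℝ, 0 < ρ ∧ ∀ j, LLt ρ (Q j) (P j))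
    (H : ∀ ρ : ℝ, 0 < ρ → (∀ j, ¬ LLt ρ (P j) (Q j)) → ∀ j, ¬ LLt ρ (Q j) (P j) →
      ini ρ (P j) = ini ρ (Q j)) :
    ∀ ρ : ℝ, 0 < ρ → ∀ j, LLt ρ (Q j) (P j) := by
  let T : Set ℝ := {ρ | 0 < ρ ∧ ∀ j, LLt ρ (Q j) (P j)}
  have hTopen : IsOpen T := by
    have : T = Set.Ioi 0 ∩ ⋂ j, {ρ : ℝ | 0 < ρ ∧ LLt ρ (Q j) (P j)} := by
      ext ρ; simp only [T, Set.mem_ofPred_eq, Set.mem_inter_iff, Set.mem_Ioi, Set.mem_iInter]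
      constructor
      · rintro ⟨h, h'⟩; exact ⟨h, fun j => ⟨h, h' j⟩⟩
      · rintro ⟨h, h'⟩; exact ⟨h, fun j => (h' j).2⟩
    rw [this]
    exact isOpen_Ioi.inter (isOpen_iInter_of_finite fun j => isOpen_LLt _ _)
  have key : Set.Ioi (0 : ℝ) ⊆ T := by
    refine isPreconnected_Ioi.subset_of_closure_inter_subset hTopen ?_ ?_
    · obtain ⟨ρ, h1, h2⟩ := hex; exact ⟨ρ, h1, h1, h2⟩
    · rintro ρ0 ⟨hcl, hpos : 0 < ρ0⟩
      have hno : ∀ j, ¬ LLt ρ0 (P j) (Q j) := by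
        intro j hj
        have := (isOpen_LLt (P j) (Q j)).mem_nhds (show ρ0 ∈ _ from ⟨hpos, hj⟩)
        obtain ⟨ρ, ⟨-, x, hx, hρ1⟩, -, hρ2⟩ := mem_closure_iff_nhds.1 hcl _ this
        obtain ⟨y, hy, hρ3⟩ := hρ2 j
        exact lt_asymm (hρ1 y hy) (hρ3 x hx)
      refine ⟨hpos, fun j => ?_⟩
      by_contra hj
      have he := H ρ0 hpos hno j hj
      obtain ⟨ρ, hρ1, hρ⟩ := mem_closure_iff_nhds.1 hcl _ (eventually_ini hpos (P j))
      obtain ⟨x, hx, hρ3⟩ := hρ.2 j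
      have hPne : (P j).Nonempty := by
        by_contra hne
        rw [Set.not_nonempty_iff_eq_empty] at hne
        exact hj ⟨x, hx, by simp [hne]⟩
      obtain ⟨y, hy⟩ := ini_nonempty hρ.1.le hPne
      obtain ⟨z, hz, hzy⟩ := hρ1 y hy.1
      -- eventually for Q too
      obtain ⟨ρ', ⟨hP', hQ'⟩, hρ'⟩ := mem_closure_iff_nhds.1 hcl _
        (Filter.inter_mem (eventually_ini hpos (P j)) (eventually_ini hpos (Q j)))
      obtain ⟨x', hx', hx'2⟩ := hρ'.2 j
      obtain ⟨u, hu, hux⟩ := hQ' x' hx'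
      rw [← he] at hu
      exact absurd hux (not_le.2 (hx'2 u hu.1))
  exact fun ρ hρ => (key hρ).2

/-- for irrational slopes the initial sets agree automatically. -/
lemma ini_eq_of_irrational {ρ : ℝ} (hρ : 0 < ρ) (hirr : ∀ a b : ℕ, 0 < a → 0 < b → (a : ℝ) * ρ ≠ b)
    {P Q : Set (ℕ × ℕ)} (h1 : ¬ LLt ρ P Q) (h2 : ¬ LLt ρ Q P) : ini ρ P = ini ρ Q := by
  have inj : ∀ x y : ℕ × ℕ, Lf ρ x = Lf ρ y → x = y := by
    have main : ∀ x y : ℕ × ℕ, x.2 < y.2 → Lf ρ x ≠ Lf ρ y := by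
      intro x y hlt he
      unfold Lf at he
      have h3 : (x.2 : ℝ) < y.2 := by exact_mod_cast hlt
      have h4 : (y.1 : ℝ) < x.1 := by nlinarith
      have h5 : y.1 < x.1 := by exact_mod_cast h4
      refine hirr (y.2 - x.2) (x.1 - y.1) (by omega) (by omega) ?_
      rw [Nat.cast_sub hlt.le, Nat.cast_sub h5.le]
      linarith
    intro x y he
    rcases lt_trichotomy x.2 y.2 with h | h | h
    · exact absurd he (main x y h)
    · unfold Lf at he
      rw [h] at he
      have : (x.1 : ℝ) = y.1 := by linarith
      exact Prod.ext (by exact_mod_cast this) h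
    · exact absurd he.symm (main y x h)
  have main : ∀ P Q : Set (ℕ × ℕ), ¬ LLt ρ P Q → ¬ LLt ρ Q P → ini ρ P ⊆ ini ρ Q := by
    intro P Q h1 h2 x hx
    unfold LLt at h1 h2
    push Not at h1 h2
    obtain ⟨y, hy, hyx⟩ := h1 x hx.1
    obtain ⟨z, hz⟩ := ini_nonempty hρ.le (S := Q) ⟨y, hy⟩
    obtain ⟨w, hw, hwz⟩ := h2 z hz.1
    have e : Lf ρ x = Lf ρ z := le_antisymm ((hx.2 w hw).trans hwz) ((hz.2 y hy).trans hyx)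
    rw [inj x z e]; exact hz
  exact Set.Subset.antisymm (main _ _ h1 h2) (main _ _ h2 h1)

end Newton
end

end

section
open CategoryTheory AlgebraicGeometry Limits
noncomputable section
namespace Newton

variable {k : Type} [Field k]

/-- power series in two variables -/
abbrev GG (k : Type) [Field k] := MvPowerSeries (Fin 2) k

/-- exponent vector -/
def ex (i j : ℕ) : Fin 2 →₀ ℕ := Finsupp.single 0 i + Finsupp.single 1 j

lemma ex_inj {i j i' j' : ℕ} (h : ex i j = ex i' j') : i = i' ∧ j = j' := by
  have h0 := DFunLike.congr_fun h 0
  have h1 := DFunLike.congr_fun h 1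
  simp [ex] at h0 h1
  exact ⟨h0, h1⟩

lemma ex_surj (d : Fin 2 →₀ ℕ) : d = ex (d 0) (d 1) := by
  ext i; fin_cases i <;> simp [ex]

def cf (i j : ℕ) (g : GG k) : k := MvPowerSeries.coeff (ex i j) g

def supp (g : GG k) : Set (ℕ × ℕ) := {x | cf x.1 x.2 g ≠ 0}

lemma supp_nonempty {g : GG k} (hg : g ≠ 0) : (supp g).Nonempty := by
  obtain ⟨d, hd⟩ := MvPowerSeries.ne_zero_iff_exists_coeff_ne_zero g |>.mp hg
  refine ⟨(d 0, d 1), ?_⟩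
  show MvPowerSeries.coeff (ex (d 0) (d 1)) g ≠ 0
  rwa [← ex_surj]

variable {K : Type} [Field K] [Algebra k K]

def pv (K : Type) [Field K] (a b : ℕ) (e0 e1 : K) : Fin 2 → MvPowerSeries Unit K :=
  ![PowerSeries.monomial a e0, PowerSeries.monomial b e1]

lemma hasSubst_pv {a b : ℕ} (ha : 0 < a) (hb : 0 < b) (e0 e1 : K) :
    MvPowerSeries.HasSubst (pv K a b e0 e1) := by
  apply MvPowerSeries.hasSubst_of_constantCoeff_zero
  have key : ∀ n, 0 < n → ∀ e : K, PowerSeries.constantCoeff (PowerSeries.monomial n e) = 0 := by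
    intro n hn e
    rw [← PowerSeries.coeff_zero_eq_constantCoeff_apply, PowerSeries.coeff_monomial, if_neg (by omega)]
  intro s
  fin_cases s
  · exact key a ha e0
  · exact key b hb e1

def psi {a b : ℕ} (ha : 0 < a) (hb : 0 < b) (e0 e1 : K) : GG k →ₐ[k] PowerSeries K :=
  MvPowerSeries.substAlgHom (hasSubst_pv ha hb e0 e1)

lemma coeff_psi {a b : ℕ} (ha : 0 < a) (hb : 0 < b) (e0 e1 : K) (g : GG k) (n : ℕ) :
    PowerSeries.coeff n (psi ha hb e0 e1 g) =
      ∑ x ∈ (Finset.range (n+1) ×ˢ Finset.range (n+1)).filter (fun x => a * x.1 + b * x.2 = n),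
        algebraMap k K (cf x.1 x.2 g) * (e0 ^ x.1 * e1 ^ x.2) := by
  unfold psi
  rw [MvPowerSeries.coe_substAlgHom]
  unfold PowerSeries.coeff
  rw [MvPowerSeries.coeff_subst (hasSubst_pv ha hb e0 e1)]
  have hterm : ∀ d : Fin 2 →₀ ℕ, (MvPowerSeries.coeff (Finsupp.single () n))
      (d.prod fun s e => pv K a b e0 e1 s ^ e) =
      if a * d 0 + b * d 1 = n then e0 ^ d 0 * e1 ^ d 1 else 0 := by
    intro d
    have h1 : (d.prod fun s e => pv K a b e0 e1 s ^ e) =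
       ((PowerSeries.monomial (a * d 0 + b * d 1) (e0 ^ d 0 * e1 ^ d 1) : PowerSeries K)) := by
      rw [Finsupp.prod_fintype _ _ (by simp), Fin.prod_univ_two]
      show (PowerSeries.monomial a e0 : PowerSeries K) ^ d 0 * (PowerSeries.monomial b e1) ^ d 1 = _
      rw [PowerSeries.monomial_pow, PowerSeries.monomial_pow, PowerSeries.monomial_mul_monomial, mul_comm a, mul_comm b]
    rw [h1]
    have := PowerSeries.coeff_monomial (R := K) n (a * d 0 + b * d 1) (e0 ^ d 0 * e1 ^ d 1)
    simp only [eq_comm (a := n)] at this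
    exact this
  simp only [hterm]
  rw [finsum_eq_sum_of_support_subset (s := ((Finset.range (n+1) ×ˢ Finset.range (n+1)).filter (fun x => a * x.1 + b * x.2 = n)).image (fun x => ex x.1 x.2))]
  · rw [Finset.sum_image]
    · apply Finset.sum_congr rfl
      intro x hx
      have := (Finset.mem_filter.mp hx).2
      have h0 : ex x.1 x.2 0 = x.1 := by simp [ex]
      have h1 : ex x.1 x.2 1 = x.2 := by simp [ex]
      rw [h0, h1, if_pos this, Algebra.smul_def]; rfl
    · intro x _ y _ h
      have := ex_inj h
      exact Prod.ext this.1 this.2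
  · intro d hd
    have hd' : a * d 0 + b * d 1 = n := by
      by_contra hne
      simp [hne] at hd
    have l0 : d 0 ≤ n := by nlinarith [Nat.zero_le (b * d 1), Nat.le_mul_of_pos_left (d 0) ha]
    have l1 : d 1 ≤ n := by nlinarith [Nat.zero_le (a * d 0), Nat.le_mul_of_pos_left (d 1) hb]
    simp only [Finset.coe_image, Set.mem_image, Finset.mem_coe, Finset.mem_filter, Finset.mem_product, Finset.mem_range]
    exact ⟨(d 0, d 1), ⟨⟨by omega, by omega⟩, hd'⟩, (ex_surj d).symm⟩

lemma Lf_eq {a b : ℕ} (ha : 0 < a) (x : ℕ × ℕ) :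
    (a : ℝ) * Lf ((b : ℝ) / a) x = ((a * x.1 + b * x.2 : ℕ) : ℝ) := by
  have : (a : ℝ) ≠ 0 := by positivity
  unfold Lf; push_cast; field_simp

lemma Lf_le {a b : ℕ} (ha : 0 < a) (x y : ℕ × ℕ) :
    Lf ((b : ℝ) / a) x ≤ Lf ((b : ℝ) / a) y ↔ a * x.1 + b * x.2 ≤ a * y.1 + b * y.2 := by
  have : (0 : ℝ) < a := by positivity
  rw [← mul_le_mul_iff_right₀ this, Lf_eq ha, Lf_eq ha]
  exact_mod_cast Iff.rfl

lemma Lf_lt {a b : ℕ} (ha : 0 < a) (x y : ℕ × ℕ) :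
    Lf ((b : ℝ) / a) x < Lf ((b : ℝ) / a) y ↔ a * x.1 + b * x.2 < a * y.1 + b * y.2 := by
  rw [← not_le, Lf_le ha, not_le]

/-- vanishing below the order -/
lemma coeff_psi_zero {a b : ℕ} (ha : 0 < a) (hb : 0 < b) (e0 e1 : K) (g : GG k) (n : ℕ)
    (h : ∀ x ∈ supp g, n < a * x.1 + b * x.2) : PowerSeries.coeff n (psi ha hb e0 e1 g) = 0 := by
  rw [coeff_psi]
  apply Finset.sum_eq_zero
  intro x hx
  have hx2 := (Finset.mem_filter.mp hx).2
  have : cf x.1 x.2 g = 0 := by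
    by_contra hne
    have := h x hne
    omega
  rw [this]; simp

/-- transcendental: coefficients determine -/
lemma coeff_psi_ext {a b : ℕ} (ha : 0 < a) (hb : 0 < b) (e : K) (he : Transcendental k e) (g : GG k) (n : ℕ)
    (h : PowerSeries.coeff n (psi ha hb 1 e g) = 0) (x : ℕ × ℕ) (hx : a * x.1 + b * x.2 = n) : cf x.1 x.2 g = 0 := by
  rw [coeff_psi] at h
  set S := (Finset.range (n+1) ×ˢ Finset.range (n+1)).filter (fun x => a * x.1 + b * x.2 = n)
  let p : Polynomial k := ∑ x ∈ S, Polynomial.monomial x.2 (cf x.1 x.2 g)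
  have hp : Polynomial.aeval e p = 0 := by
    rw [← h]
    simp only [p, map_sum, Polynomial.aeval_monomial]
    simp
  have hp0 : p = 0 := by
    by_contra hne
    exact he ⟨p, hne, hp⟩
  have : p.coeff x.2 = cf x.1 x.2 g := by
    simp only [p, Polynomial.finsetSum_coeff, Polynomial.coeff_monomial]
    rw [Finset.sum_eq_single x]
    · simp
    · intro y hy hyx
      rw [if_neg]
      intro h2
      apply hyx
      have := (Finset.mem_filter.mp hy).2
      have h3 : a * y.1 = a * x.1 := by rw [h2] at this; omega
      exact Prod.ext (Nat.eq_of_mul_eq_mul_left ha h3) h2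
    · intro hxS
      exfalso; apply hxS
      have l0 : x.1 ≤ n := by nlinarith [Nat.zero_le (b * x.2), Nat.le_mul_of_pos_left x.1 ha]
      have l1 : x.2 ≤ n := by nlinarith [Nat.zero_le (a * x.1), Nat.le_mul_of_pos_left x.2 hb]
      simp only [S, Finset.mem_filter, Finset.mem_product, Finset.mem_range]
      exact ⟨⟨by omega, by omega⟩, hx⟩
  rw [← this, hp0]; simp

lemma psi_injective {a b : ℕ} (ha : 0 < a) (hb : 0 < b) (e : K) (he : Transcendental k e) :
    Function.Injective (psi (k := k) ha hb 1 e) := by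
  rw [injective_iff_map_eq_zero]
  intro g hg
  by_contra hne
  obtain ⟨x, hx⟩ := supp_nonempty hne
  exact hx (coeff_psi_ext ha hb e he g _ (by rw [hg]; simp) x rfl)

end Newton
end

end

section
open CategoryTheory AlgebraicGeometry Limits
noncomputable section
namespace Newton

variable {k : Type} [Field k] {K : Type} [Field K] [Algebra k K]

lemma exists_unit_psi {a b : ℕ} (ha : 0 < a) (hb : 0 < b) (e : K) (he : Transcendental k e) (g : GG k)
    (hg : g ≠ 0) : ∃ x ∈ ini ((b : ℝ) / a) (supp g), ∃ w : PowerSeries K, IsUnit w ∧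
      psi ha hb 1 e g = PowerSeries.X ^ (a * x.1 + b * x.2) * w := by
  have hρ : (0:ℝ) ≤ (b : ℝ) / a := by positivity
  obtain ⟨x, hx⟩ := ini_nonempty hρ (supp_nonempty hg)
  refine ⟨x, hx, ?_⟩
  have hdvd : PowerSeries.X ^ (a * x.1 + b * x.2) ∣ psi ha hb 1 e g := by
    rw [PowerSeries.X_pow_dvd_iff]
    intro m hm
    apply coeff_psi_zero
    intro y hy
    have := (Lf_le ha x y).mp (hx.2 y hy)
    omega
  obtain ⟨w, hw⟩ := hdvd
  refine ⟨w, ?_, hw⟩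
  rw [PowerSeries.isUnit_iff_constantCoeff, isUnit_iff_ne_zero]
  intro h0
  have : PowerSeries.coeff (a * x.1 + b * x.2) (psi ha hb 1 e g) = 0 := by
    rw [hw, PowerSeries.coeff_X_pow_mul', if_pos le_rfl]; simpa using h0
  exact hx.1 (coeff_psi_ext ha hb e he g _ this x rfl)

lemma dvd_of_LLt {a b : ℕ} (ha : 0 < a) (hb : 0 < b) (e : K) (he : Transcendental k e) (p q : GG k)
    (hq : q ≠ 0) (h : LLt ((b : ℝ) / a) (supp q) (supp p)) :
    ∃ u, psi ha hb 1 e p = psi ha hb 1 e q * (PowerSeries.X * u) := by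
  obtain ⟨x, hx, w, hw, hqe⟩ := exists_unit_psi ha hb e he q hq
  obtain ⟨z, hz, hzl⟩ := h
  have hdvd : PowerSeries.X ^ (a * x.1 + b * x.2 + 1) ∣ psi ha hb 1 e p := by
    rw [PowerSeries.X_pow_dvd_iff]
    intro m hm
    apply coeff_psi_zero
    intro y hy
    have h1 := (Lf_le ha x z).mp (hx.2 z hz)
    have h2 := (Lf_lt ha z y).mp (hzl y hy)
    omega
  obtain ⟨v, hv⟩ := hdvd
  obtain ⟨w, rfl⟩ := hw
  refine ⟨↑w⁻¹ * v, ?_⟩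
  rw [hqe, hv, pow_succ]
  calc _ = PowerSeries.X ^ (a * x.1 + b * x.2) * (↑w * ↑w⁻¹) * PowerSeries.X * v := by simp
    _ = _ := by ring

lemma dvd_of_not_LLt {a b : ℕ} (ha : 0 < a) (hb : 0 < b) (e : K) (he : Transcendental k e) (p q : GG k)
    (hq : q ≠ 0) (h : ¬ LLt ((b : ℝ) / a) (supp p) (supp q)) :
    psi ha hb 1 e q ∣ psi ha hb 1 e p := by
  obtain ⟨x, hx, w, hw, hqe⟩ := exists_unit_psi ha hb e he q hq
  have hdvd : PowerSeries.X ^ (a * x.1 + b * x.2) ∣ psi ha hb 1 e p := by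
    rw [PowerSeries.X_pow_dvd_iff]
    intro m hm
    apply coeff_psi_zero
    intro y hy
    by_contra hlt
    apply h
    refine ⟨y, hy, fun z hz => ?_⟩
    rw [Lf_lt ha]
    have h1 := (Lf_le ha x z).mp (hx.2 z hz)
    omega
  rw [hqe]
  obtain ⟨w, rfl⟩ := hw
  exact (Units.mul_right_dvd).mpr hdvd

lemma ini_eq_of_const {a b : ℕ} (ha : 0 < a) (hb : 0 < b) (e : K) (he : Transcendental k e) (p q : GG k)
    (hq : q ≠ 0) (h : ¬ LLt ((b : ℝ) / a) (supp q) (supp p)) (l : k) (u : PowerSeries K)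
    (hu : psi ha hb 1 e p = psi ha hb 1 e q * (PowerSeries.C (algebraMap k K l) + PowerSeries.X * u)) :
    ini ((b : ℝ) / a) (supp p) = ini ((b : ℝ) / a) (supp q) := by
  obtain ⟨x, hx, w, hw, hqe⟩ := exists_unit_psi ha hb e he q hq
  have hd : psi ha hb 1 e (p - l • q) = PowerSeries.X ^ (a * x.1 + b * x.2 + 1) * (w * u) := by
    rw [map_sub, map_smul, hu, Algebra.smul_def,
      show algebraMap k (PowerSeries K) l = PowerSeries.C (algebraMap k K l) from by rw [PowerSeries.algebraMap_apply], hqe]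
    ring
  have key : ∀ y : ℕ × ℕ, a * y.1 + b * y.2 ≤ a * x.1 + b * x.2 → cf y.1 y.2 p = l * cf y.1 y.2 q := by
    intro y hy
    have h1 := coeff_psi_ext ha hb e he (p - l • q) (a * y.1 + b * y.2) (by
      rw [hd, PowerSeries.coeff_X_pow_mul', if_neg (by omega)]) y rfl
    have h2 : cf y.1 y.2 (p - l • q) = cf y.1 y.2 p - l * cf y.1 y.2 q := by simp [cf]
    rw [h2] at h1
    exact sub_eq_zero.mp h1
  have hqmin : ∀ z ∈ supp q, a * x.1 + b * x.2 ≤ a * z.1 + b * z.2 := fun z hz => (Lf_le ha x z).mp (hx.2 z hz)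
  have hl : l ≠ 0 := by
    rintro rfl
    apply h
    refine ⟨x, hx.1, fun y hy => ?_⟩
    rw [Lf_lt ha]
    by_contra hle
    have := key y (by omega)
    exact hy (by simpa using this)
  have hpmin : ∀ z ∈ supp p, a * x.1 + b * x.2 ≤ a * z.1 + b * z.2 := by
    intro z hz
    by_contra hlt
    have := key z (by omega)
    have hz' : cf z.1 z.2 q ≠ 0 := by
      intro h0; apply hz; show cf z.1 z.2 p = 0; rw [this, h0, mul_zero]
    have := hqmin z hz'
    omega
  have hxp : x ∈ supp p := by
    show cf x.1 x.2 p ≠ 0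
    rw [key x le_rfl]
    exact mul_ne_zero hl hx.1
  ext y
  constructor
  · rintro ⟨hy, hy2⟩
    have h1 := (Lf_le ha y x).mp (hy2 x hxp)
    refine ⟨?_, fun z hz => (Lf_le ha y z).mpr (h1.trans (hqmin z hz))⟩
    intro h0
    exact hy (by rw [key y h1, h0, mul_zero])
  · rintro ⟨hy, hy2⟩
    have h1 := (Lf_le ha y x).mp (hy2 x hx.1)
    refine ⟨?_, fun z hz => (Lf_le ha y z).mpr (h1.trans (hpmin z hz))⟩
    show cf y.1 y.2 p ≠ 0
    rw [key y h1]
    exact mul_ne_zero hl hy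

theorem newton {J : Type} [Finite J] (p q : J → GG k) (hq : ∀ j, q j ≠ 0)
    (hex : ∃ ρ > 0, ∀ j, LLt ρ (supp (q j)) (supp (p j)))
    (e : K) (he : Transcendental k e)
    (hconst : ∀ (a b : ℕ) (ha : 0 < a) (hb : 0 < b), (∀ j, psi ha hb 1 e (q j) ∣ psi ha hb 1 e (p j)) →
      ∀ j, ∃ (l : k) (u : PowerSeries K), psi ha hb 1 e (p j) =
        psi ha hb 1 e (q j) * (PowerSeries.C (algebraMap k K l) + PowerSeries.X * u))
    (a b : ℕ) (ha : 0 < a) (hb : 0 < b) (j : J) :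
    ∃ u, psi ha hb 1 e (p j) = psi ha hb 1 e (q j) * (PowerSeries.X * u) := by
  apply dvd_of_LLt ha hb e he _ _ (hq j)
  refine core (fun j => supp (p j)) (fun j => supp (q j)) hex ?_ _ (by positivity) j
  intro ρ hρ h1 j h2
  by_cases hr : ∃ a b : ℕ, 0 < a ∧ 0 < b ∧ (a : ℝ) * ρ = b
  · obtain ⟨a, b, ha, hb, hab⟩ := hr
    have ha0 : (a : ℝ) ≠ 0 := by positivity
    obtain rfl : ρ = (b : ℝ) / a := by field_simp; linarith
    obtain ⟨l, u, hu⟩ := hconst a b ha hb (fun j => dvd_of_not_LLt ha hb e he _ _ (hq j) (h1 j)) j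
    exact ini_eq_of_const ha hb e he _ _ (hq j) h2 l u hu
  · push Not at hr
    exact ini_eq_of_irrational hρ hr (h1 j) h2

/-- initial weight from restriction to the first axis -/
lemma exists_weight_one {J : Type} [Finite J] (p q : J → GG k) (h : ∀ j, ∃ m, cf m 0 (q j) ≠ 0 ∧ ∀ i ≤ m, cf i 0 (p j) = 0) :
    ∃ ρ > 0, ∀ j, LLt ρ (supp (q j)) (supp (p j)) := by
  choose m hm hm2 using h
  obtain ⟨M, hM⟩ := (Set.finite_range m).bddAbove
  refine ⟨M + 1, by positivity, fun j => ⟨(m j, 0), hm j, ?_⟩⟩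
  intro y hy
  have hMj : m j ≤ M := hM ⟨j, rfl⟩
  simp only [Lf]
  rcases Nat.eq_zero_or_pos y.2 with h0 | h0
  · have : m j < y.1 := by
      by_contra hle
      apply hy
      rw [h0]; exact hm2 j _ (by omega)
    rw [h0]; simpa using this
  · have h1 : (1:ℝ) ≤ y.2 := by exact_mod_cast h0
    have h2 : (m j : ℝ) ≤ M := by exact_mod_cast hMj
    have h3 : (0:ℝ) ≤ y.1 := by positivity
    have h4 : (0:ℝ) ≤ M := by positivity
    push_cast
    nlinarith

lemma exists_weight_two {J : Type} [Finite J] (p q : J → GG k) (h : ∀ j, ∃ m, cf 0 m (q j) ≠ 0 ∧ ∀ i ≤ m, cf 0 i (p j) = 0) :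
    ∃ ρ > 0, ∀ j, LLt ρ (supp (q j)) (supp (p j)) := by
  choose m hm hm2 using h
  obtain ⟨M, hM⟩ := (Set.finite_range m).bddAbove
  refine ⟨1 / (M + 1), by positivity, fun j => ⟨(0, m j), hm j, ?_⟩⟩
  intro y hy
  have hMj : m j ≤ M := hM ⟨j, rfl⟩
  have hpos : (0:ℝ) < M + 1 := by positivity
  simp only [Lf]
  rw [← mul_lt_mul_iff_right₀ hpos]
  have e1 : ((M:ℝ)+1) * (((0:ℕ):ℝ) + 1 / (M+1) * (m j)) = m j := by field_simp; simp
  have e2 : ((M:ℝ)+1) * ((y.1:ℝ) + 1 / (M+1) * y.2) = (M+1) * y.1 + y.2 := by field_simp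
  rw [e1, e2]
  norm_cast
  rcases Nat.eq_zero_or_pos y.1 with h0 | h0
  · have : m j < y.2 := by
      by_contra hle
      apply hy
      rw [h0]; exact hm2 j _ (by omega)
    rw [h0]; simpa using this
  · nlinarith

/-- restriction to the axes -/
def kap1 : GG k →ₐ[k] PowerSeries k := psi (K := k) one_pos one_pos 1 0
def kap2 : GG k →ₐ[k] PowerSeries k := psi (K := k) one_pos one_pos 0 1

lemma coeff_kap1 (g : GG k) (n : ℕ) : PowerSeries.coeff n (kap1 g) = cf n 0 g := by
  unfold kap1
  rw [coeff_psi, Finset.sum_eq_single (n, 0)]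
  · simp
  · intro y hy hne
    have := (Finset.mem_filter.mp hy).2
    have : y.2 ≠ 0 := by
      intro h0; apply hne; ext <;> simp <;> omega
    simp [this]
  · intro h; exfalso; apply h; simp

lemma coeff_kap2 (g : GG k) (n : ℕ) : PowerSeries.coeff n (kap2 g) = cf 0 n g := by
  unfold kap2
  rw [coeff_psi, Finset.sum_eq_single (0, n)]
  · simp
  · intro y hy hne
    have := (Finset.mem_filter.mp hy).2
    have : y.1 ≠ 0 := by
      intro h0; apply hne; ext <;> simp <;> omega
    simp [this]
  · intro h; exfalso; apply h; simp

def inc (s : Fin 2) : PowerSeries k →ₐ[k] GG k :=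
  PowerSeries.substAlgHom (PowerSeries.HasSubst.of_constantCoeff_zero (a := MvPowerSeries.X s) (by simp))

lemma cf_inc0 (f : PowerSeries k) (i j : ℕ) : cf i j (inc 0 f) = if j = 0 then PowerSeries.coeff i f else 0 := by
  unfold cf inc
  rw [PowerSeries.coe_substAlgHom, PowerSeries.coeff_subst_single]
  by_cases h : j = 0
  · subst h; simp [ex]
  · rw [if_neg h, if_neg]
    intro h2
    have := DFunLike.congr_fun h2 1
    simp [ex] at this
    exact h this

lemma cf_inc1 (f : PowerSeries k) (i j : ℕ) : cf i j (inc 1 f) = if i = 0 then PowerSeries.coeff j f else 0 := by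
  unfold cf inc
  rw [PowerSeries.coe_substAlgHom, PowerSeries.coeff_subst_single]
  by_cases h : i = 0
  · subst h; simp [ex]
  · rw [if_neg h, if_neg]
    intro h2
    have := DFunLike.congr_fun h2 0
    simp [ex] at this
    exact h this

lemma kap1_inc0 (f : PowerSeries k) : kap1 (inc 0 f) = f := by
  ext n; rw [coeff_kap1, cf_inc0]; simp
lemma kap2_inc1 (f : PowerSeries k) : kap2 (inc 1 f) = f := by
  ext n; rw [coeff_kap2, cf_inc1]; simp
lemma kap1_inc1 (f : PowerSeries k) : kap1 (inc 1 f) = PowerSeries.C (PowerSeries.constantCoeff f) := by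
  ext n; rw [coeff_kap1, cf_inc1, PowerSeries.coeff_C]; simp
lemma kap2_inc0 (f : PowerSeries k) : kap2 (inc 0 f) = PowerSeries.C (PowerSeries.constantCoeff f) := by
  ext n; rw [coeff_kap2, cf_inc0, PowerSeries.coeff_C]; simp

end Newton
end

end

section
open CategoryTheory AlgebraicGeometry Limits
noncomputable section
namespace PtF
open Newton
variable {k : Type} [Field k]

section
variable {G S T : Type} [CommRing G] [CommRing S] [CommRing T] [Algebra k G] [Algebra k S] [Algebra k T]

def liftA {g : G} (φ : G →ₐ[k] S) (h : IsUnit (φ g)) : Localization.Away g →ₐ[k] S :=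
  IsLocalization.liftAlgHom (M := Submonoid.powers g) (f := φ) (by
    rintro ⟨_, n, rfl⟩
    rw [map_pow]; exact h.pow n)

lemma liftA_algebraMap {g : G} (φ : G →ₐ[k] S) (h : IsUnit (φ g)) (x : G) :
    liftA φ h (algebraMap G (Localization.Away g) x) = φ x := by
  unfold liftA
  rw [IsLocalization.liftAlgHom_apply, IsLocalization.lift_eq]; rfl

lemma away_ext {g : G} {φ ψ : Localization.Away g →ₐ[k] S}
    (h : ∀ x, φ (algebraMap G _ x) = ψ (algebraMap G _ x)) : φ = ψ := by
  apply IsLocalization.algHom_ext (Submonoid.powers g) (A := G)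
  ext x; exact h x

abbrev loc (k : Type) [Field k] (G : Type) [CommRing G] [Algebra k G] (g : G) : G →ₐ[k] Localization.Away g :=
  IsScalarTower.toAlgHom k G (Localization.Away g)

/-- further localization -/
def beta (g h : G) : Localization.Away g →ₐ[k] Localization.Away (g * h) :=
  liftA (loc k G (g * h)) (isUnit_of_mul_isUnit_left (y := algebraMap G _ h) (by
    have := IsLocalization.Away.algebraMap_isUnit (S := Localization.Away (g * h)) (g * h)
    rwa [map_mul] at this))

lemma beta_algebraMap (g h : G) (x : G) : beta (k := k) g h (algebraMap G _ x) = algebraMap G _ x := by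
  unfold beta; rw [liftA_algebraMap]; rfl

lemma liftA_beta (g h : G) (φ : G →ₐ[k] S) (h1 : IsUnit (φ g)) (h2 : IsUnit (φ (g * h))) :
    (liftA φ h2).comp (beta g h) = liftA φ h1 := by
  apply away_ext
  intro x
  rw [AlgHom.comp_apply, beta_algebraMap, liftA_algebraMap, liftA_algebraMap]

lemma refine_chart {X : OverR k} {C : Type} [CommRing C] [Algebra k C] (ι : SpO k C ⟶ X)
    (hι : IsOpenImmersion ι.left) {F : Type} [Field F] [Algebra k F] (κ : G →ₐ[k] F) (g : G) (hg : IsUnit (κ g))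
    (Z : SpO k (Localization.Away g) ⟶ X) (ψ : C →ₐ[k] F) (hψ : sm (liftA κ hg) ≫ Z = sm ψ ≫ ι) :
    ∃ h : G, κ h ≠ 0 ∧ ∃ θ : C →ₐ[k] Localization.Away (g * h), sm θ ≫ ι = sm (beta g h) ≫ Z := by
  let P : (SpO k (Localization.Away g)).left := (sm (liftA κ hg)).left (IsLocalRing.closedPoint F)
  have hP : P ∈ Z.left ⁻¹' (Set.range ι.left) := by
    have h1 := congrArg CommaMorphism.left hψ
    have h2 := congrArg (fun f => f (IsLocalRing.closedPoint F)) h1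
    have h3 : Z.left ((sm (liftA κ hg)).left (IsLocalRing.closedPoint F)) =
      ι.left ((sm ψ).left (IsLocalRing.closedPoint F)) := h2
    exact ⟨_, h3.symm⟩
  have hop : IsOpen (Z.left ⁻¹' (Set.range ι.left)) := hι.base_open.isOpen_range.preimage Z.left.continuous
  obtain ⟨_, ⟨r, rfl⟩, hr1, hr2⟩ :=
    (PrimeSpectrum.isTopologicalBasis_basic_opens (R := Localization.Away g)).exists_subset_of_mem_open hP hop
  obtain ⟨n, h, hh⟩ := IsLocalization.Away.surj (S := Localization.Away g) g r
  have hr : liftA κ hg r ≠ 0 := by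
    intro h0
    apply hr1
    show liftA κ hg r ∈ (IsLocalRing.closedPoint F).asIdeal
    rw [h0]; exact Ideal.zero_mem _
  refine ⟨h, ?_, ?_⟩
  · rw [← liftA_algebraMap κ hg, ← hh, map_mul, map_pow, liftA_algebraMap]
    exact mul_ne_zero hr (pow_ne_zero _ hg.ne_zero)
  · obtain ⟨f, hf⟩ := lift_chart ι hι (sm (beta g h) ≫ Z) (by
      rintro _ ⟨y, rfl⟩
      have : (sm (beta (k := k) g h)).left y ∈ ((PrimeSpectrum.basicOpen r : TopologicalSpace.Opens (PrimeSpectrum (Localization.Away g))) : Set (PrimeSpectrum (Localization.Away g))) := by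
        show ¬ (beta (k := k) g h) r ∈ PrimeSpectrum.asIdeal (R := Localization.Away (g*h)) y
        intro hmem
        have hu : IsUnit (beta (k := k) g h r) := by
          have h1 := congrArg (beta (k := k) g h) hh
          rw [map_mul, beta_algebraMap] at h1
          have hu := IsLocalization.Away.algebraMap_isUnit (S := Localization.Away (g * h)) (g * h)
          rw [map_mul, ← h1] at hu
          exact isUnit_of_mul_isUnit_left (isUnit_of_mul_isUnit_right hu)
        exact (PrimeSpectrum.isPrime (R := Localization.Away (g*h)) y).ne_top (Ideal.eq_top_of_isUnit_mem _ hmem hu)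
      exact hr2 this)
    obtain ⟨θ, rfl⟩ := sm_surj f
    exact ⟨θ, hf⟩

lemma exists_restrict {C V L : Type} [CommRing C] [CommRing V] [CommRing L] [Algebra k C] [Algebra k V] [Algebra k L]
    (i : V →ₐ[k] L) (hi : Function.Injective i) (Θ : C →ₐ[k] L) (s : Set C) (hs : Algebra.adjoin k s = ⊤)
    (h : ∀ c ∈ s, Θ c ∈ i.range) : ∃ χ : C →ₐ[k] V, i.comp χ = Θ := by
  have h1 : ∀ c, Θ c ∈ i.range := by
    intro c
    have : Algebra.adjoin k s ≤ i.range.comap Θ := Algebra.adjoin_le h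
    rw [hs] at this
    exact this (Algebra.mem_top)
  refine ⟨((AlgEquiv.ofInjective i hi).symm : i.range →ₐ[k] V).comp (Θ.codRestrict _ h1), ?_⟩
  ext c
  have := (AlgEquiv.ofInjective i hi).apply_symm_apply (Θ.codRestrict _ h1 c)
  exact congrArg Subtype.val this

end

section
variable {K : Type} [Field K] [Algebra k K]

abbrev frac (k : Type) [Field k] (V : Type) [CommRing V] [Algebra k V] : V →ₐ[k] FractionRing V :=
  IsScalarTower.toAlgHom k V (FractionRing V)

lemma frac_inj (V : Type) [CommRing V] [IsDomain V] [Algebra k V] : Function.Injective (frac k V) :=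
  IsFractionRing.injective V (FractionRing V)

def cc (k K : Type) [Field k] [Field K] [Algebra k K] : PowerSeries K →ₐ[k] K :=
  { PowerSeries.constantCoeff (R := K) with
    commutes' := fun r => by
      show PowerSeries.constantCoeff (algebraMap k (PowerSeries K) r) = _
      rw [PowerSeries.algebraMap_apply]; simp }

lemma cc_apply (f : PowerSeries K) : cc k K f = PowerSeries.constantCoeff f := rfl

instance cc_local : IsLocalHom (cc k K).toRingHom := by
  refine ⟨fun f hf => ?_⟩
  exact PowerSeries.isUnit_iff_constantCoeff.mpr hf

lemma eq_C_add (f : PowerSeries K) : ∃ u, f = PowerSeries.C (cc k K f) + PowerSeries.X * u := by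
  have : PowerSeries.X ∣ f - PowerSeries.C (cc k K f) := by
    rw [PowerSeries.X_dvd_iff]; simp [cc_apply]
  obtain ⟨u, hu⟩ := this
  exact ⟨u, by rw [← hu]; ring⟩

lemma unit_frac {G V : Type} [CommRing G] [CommRing V] [IsDomain V] [Algebra k G] [Algebra k V] (κ : G →ₐ[k] V) (g : G)
   (h : κ g ≠ 0) : IsUnit ((frac k V).comp κ g) := by
  rw [isUnit_iff_ne_zero]
  intro h0
  exact h (frac_inj (k := k) V (by rw [map_zero]; exact h0))

/-- extension of a map to a domain not killing `g` to the localization -/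
def gen {G V : Type} [CommRing G] [CommRing V] [IsDomain V] [Algebra k G] [Algebra k V] (κ : G →ₐ[k] V) (g : G)
    (h : κ g ≠ 0) : Localization.Away g →ₐ[k] FractionRing V :=
  liftA ((frac k V).comp κ) (unit_frac κ g h)

theorem half {X : OverR k} (hft : LocallyOfFiniteType X.hom) (e : K) (he : Transcendental k e)
    (hF : ∀ ξ : SpO k K ⟶ X, ∃ y : SpO k k ⟶ X, ξ = sm (Algebra.ofId k K) ≫ y)
    (κ : GG k →ₐ[k] PowerSeries k)
    (hκ : ∀ (J : Type) (_ : Finite J) (p q : J → GG k), (∀ j, κ (q j) ≠ 0) →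
      (∀ j, ∃ w, κ (p j) = κ (q j) * (PowerSeries.X * w)) → ∃ ρ > 0, ∀ j, LLt ρ (supp (q j)) (supp (p j)))
    (g : GG k) (hg : κ g ≠ 0) (Z : SpO k (Localization.Away g) ⟶ X) (γ : SpO k (PowerSeries k) ⟶ X)
    (hγ : sm (gen κ g hg) ≫ Z = sm (frac k _) ≫ γ)
    (hg' : psi (K := K) one_pos one_pos 1 e g ≠ 0) :
    ∃ η : SpO k (PowerSeries K) ⟶ X,
      sm (frac k _) ≫ η = sm (gen (psi one_pos one_pos 1 e) g hg') ≫ Z ∧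
      sm (cc k K) ≫ η = sm (Algebra.ofId k K) ≫ sm (cc k k) ≫ γ := by
  unfold gen at hγ ⊢
  obtain ⟨C, _, _, ι, hC, hι, hxι⟩ := exists_chart hft ((sm (cc k k) ≫ γ).left (IsLocalRing.closedPoint k))
  obtain ⟨ψ0, hψ0⟩ := lift_local ι hι (sm (cc k k) ≫ γ) hxι
  obtain ⟨φ, hφ, hφ0⟩ := lift_field ι hι (cc k k) cc_local γ ψ0 hψ0.symm
  obtain ⟨h, hh, θ, hθ⟩ := refine_chart ι hι ((frac k _).comp κ) g (unit_frac κ g hg) Z ((frac k _).comp φ)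
    (by rw [hγ, ← hφ, sm_comp, Category.assoc])
  have hh' : κ h ≠ 0 := by
    intro h0; apply hh; rw [AlgHom.comp_apply, h0, map_zero]
  have hgh : κ (g * h) ≠ 0 := by rw [map_mul]; exact mul_ne_zero hg hh'
  have hgh0 : g * h ≠ 0 := by intro h0; rw [h0, map_zero] at hgh; exact hgh rfl
  -- the arc
  have harc : (liftA ((frac k _).comp κ) (unit_frac κ (g * h) hgh)).comp θ = (frac k _).comp φ := by
    apply sm_inj; apply chart_mono ι hι
    rw [sm_comp, Category.assoc, hθ, ← Category.assoc, ← sm_comp, liftA_beta _ _ _ (unit_frac κ g hg), hγ, sm_comp, Category.assoc, hφ]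
  obtain ⟨s, hs⟩ := hC.out
  let f : s → C := fun j => j.1 - algebraMap k C (ψ0 j.1)
  have hsurj : ∀ j : s, ∃ (n : ℕ) (p : GG k), θ (f j) * algebraMap _ _ ((g * h) ^ n) = algebraMap _ _ p := by
    intro j
    obtain ⟨n, p, hp⟩ := IsLocalization.Away.surj (S := Localization.Away (g * h)) (g * h) (θ (f j))
    exact ⟨n, p, by rw [map_pow]; exact hp⟩
  choose n p hp using hsurj
  let q : s → GG k := fun j => (g * h) ^ n j
  have hκq : ∀ j, κ (q j) ≠ 0 := fun j => by simp only [q, map_pow]; exact pow_ne_zero _ hgh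
  have hq : ∀ j, q j ≠ 0 := fun j h0 => hκq j (by rw [h0, map_zero])
  have hex : ∃ ρ > 0, ∀ j, LLt ρ (supp (q j)) (supp (p j)) := by
    apply hκ s inferInstance p q hκq
    intro j
    have h1 := congrArg (liftA ((frac k _).comp κ) (unit_frac κ (g * h) hgh)) (hp j)
    rw [map_mul, liftA_algebraMap, liftA_algebraMap, ← AlgHom.comp_apply, harc] at h1
    have h2 : κ (p j) = κ (q j) * φ (f j) := by
      apply frac_inj (k := k) (PowerSeries k)
      rw [map_mul, mul_comm]
      exact h1.symm
    have h3 : cc k k (φ (f j)) = 0 := by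
      rw [← AlgHom.comp_apply, hφ0]
      simp [f]
    obtain ⟨u, hu⟩ := eq_C_add (k := k) (φ (f j))
    rw [h3, map_zero, zero_add] at hu
    exact ⟨u, by rw [← hu]; exact h2⟩
  -- restriction
  have hres : ∀ (a b : ℕ) (ha : 0 < a) (hb : 0 < b) (w : s → PowerSeries K),
      (∀ j, psi ha hb 1 e (p j) = psi ha hb 1 e (q j) * w j) →
      ∃ χ : C →ₐ[k] PowerSeries K, (∀ j, χ (f j) = w j) ∧
        ∀ hne : psi (k := k) ha hb 1 e (g * h) ≠ 0, (frac k _).comp χ = (liftA ((frac k _).comp (psi ha hb 1 e)) (unit_frac _ _ hne)).comp θ := by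
    intro a b ha hb w hw
    have hne : psi (k := k) ha hb 1 e (g * h) ≠ 0 := by
      intro h0; exact hgh0 (psi_injective ha hb e he (by rw [h0, map_zero]))
    let Θ := (liftA ((frac k _).comp (psi ha hb 1 e)) (unit_frac _ _ hne)).comp θ
    have hΘ : ∀ j, Θ (f j) = frac k _ (w j) := by
      intro j
      have h1 := congrArg (liftA ((frac k _).comp (psi ha hb 1 e)) (unit_frac _ _ hne)) (hp j)
      rw [map_mul, liftA_algebraMap, liftA_algebraMap, ← AlgHom.comp_apply] at h1
      have h2 : Θ (f j) * frac k _ (psi ha hb 1 e (q j)) = frac k _ (psi ha hb 1 e (p j)) := h1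
      rw [hw, map_mul, mul_comm] at h2
      refine mul_left_cancel₀ ?_ h2
      intro h0
      apply hq j
      apply psi_injective ha hb e he
      apply frac_inj (k := k)
      rw [h0, map_zero, map_zero]
    obtain ⟨χ, hχ⟩ := exists_restrict (frac k (PowerSeries K)) (frac_inj _) Θ s hs (by
      intro c hc
      have : c = f ⟨c, hc⟩ + algebraMap k C (ψ0 c) := by simp [f]
      rw [this, map_add, hΘ, AlgHom.commutes]
      exact add_mem ⟨_, rfl⟩ (Subalgebra.algebraMap_mem _ _))
    refine ⟨χ, fun j => ?_, fun _ => hχ⟩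
    apply frac_inj (k := k)
    rw [← hΘ, ← hχ]; rfl
  have hnewton := newton p q hq hex e he (by
    intro a b ha hb hdvd j
    choose w hw using hdvd
    obtain ⟨χ, hχ, -⟩ := hres a b ha hb w hw
    obtain ⟨y, hy⟩ := hF (sm ((cc k K).comp χ) ≫ ι)
    obtain ⟨ψ', hψ'⟩ := lift_field ι hι (Algebra.ofId k K) (by
      refine ⟨fun c hc => ?_⟩
      rw [isUnit_iff_ne_zero] at hc ⊢
      rintro rfl
      exact hc (by simp)) y _ hy.symm
    refine ⟨ψ' (f j), ?_⟩
    obtain ⟨u, hu⟩ := eq_C_add (k := k) (w j)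
    refine ⟨u, ?_⟩
    rw [hw]
    congr 1
    rw [hu]
    congr 2
    rw [← hχ, ← AlgHom.comp_apply, ← hψ'.2]
    rfl)
  choose u hu using hnewton 1 1 one_pos one_pos
  obtain ⟨χ, hχ, hχ2⟩ := hres 1 1 one_pos one_pos _ hu
  have hne : psi (k := k) (K := K) one_pos one_pos 1 e (g * h) ≠ 0 := by
    intro h0; exact hgh0 (psi_injective one_pos one_pos e he (by rw [h0, map_zero]))
  refine ⟨sm χ ≫ ι, ?_, ?_⟩
  · rw [← Category.assoc, ← sm_comp, hχ2 hne, sm_comp, Category.assoc, hθ, ← Category.assoc, ← sm_comp, liftA_beta]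
  · rw [← Category.assoc, ← sm_comp, ← hψ0, ← Category.assoc, ← sm_comp]
    congr 2
    have : Set.EqOn ((cc k K).comp χ) ((Algebra.ofId k K).comp ψ0) s := by
      intro c hc
      have h1 : c = f ⟨c, hc⟩ + algebraMap k C (ψ0 c) := by simp [f]
      have h2 : (cc k K).comp χ (f ⟨c, hc⟩) = 0 := by
        rw [AlgHom.comp_apply, hχ, cc_apply]; simp
      have h3 : (cc k K).comp χ c = algebraMap k K (ψ0 c) := by
        conv_lhs => rw [h1]
        rw [map_add, h2, zero_add, AlgHom.commutes]
      exact h3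
    exact AlgHom.ext_of_adjoin_eq_top hs this

lemma cond_kap1 (J : Type) (_ : Finite J) (p q : J → GG k) (h : ∀ j, kap1 (q j) ≠ 0)
      (h2 : ∀ j, ∃ w, kap1 (p j) = kap1 (q j) * (PowerSeries.X * w)) : ∃ ρ > 0, ∀ j, LLt ρ (supp (q j)) (supp (p j)) := by
  apply exists_weight_one
  intro j
  obtain ⟨w, hw⟩ := h2 j
  obtain ⟨m, hm, hm2⟩ : ∃ m, PowerSeries.coeff m (kap1 (q j)) ≠ 0 ∧ PowerSeries.X ^ m ∣ kap1 (q j) := by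
    refine ⟨(kap1 (q j)).order.toNat, PowerSeries.coeff_order (h j), PowerSeries.X_pow_order_dvd⟩
  refine ⟨m, by rwa [← coeff_kap1], fun i hi => ?_⟩
  rw [← coeff_kap1]
  have : PowerSeries.X ^ (m+1) ∣ kap1 (p j) := by
    rw [hw, pow_succ]
    exact mul_dvd_mul hm2 (dvd_mul_right _ _)
  exact PowerSeries.X_pow_dvd_iff.mp this i (by omega)

lemma cond_kap2 (J : Type) (_ : Finite J) (p q : J → GG k) (h : ∀ j, kap2 (q j) ≠ 0)
      (h2 : ∀ j, ∃ w, kap2 (p j) = kap2 (q j) * (PowerSeries.X * w)) : ∃ ρ > 0, ∀ j, LLt ρ (supp (q j)) (supp (p j)) := by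
  apply exists_weight_two
  intro j
  obtain ⟨w, hw⟩ := h2 j
  obtain ⟨m, hm, hm2⟩ : ∃ m, PowerSeries.coeff m (kap2 (q j)) ≠ 0 ∧ PowerSeries.X ^ m ∣ kap2 (q j) := by
    refine ⟨(kap2 (q j)).order.toNat, PowerSeries.coeff_order (h j), PowerSeries.X_pow_order_dvd⟩
  refine ⟨m, by rwa [← coeff_kap2], fun i hi => ?_⟩
  rw [← coeff_kap2]
  have : PowerSeries.X ^ (m+1) ∣ kap2 (p j) := by
    rw [hw, pow_succ]
    exact mul_dvd_mul hm2 (dvd_mul_right _ _)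
  exact PowerSeries.X_pow_dvd_iff.mp this i (by omega)

theorem surface {X : OverR k} (hft : LocallyOfFiniteType X.hom) (hsep : IsSeparated X.hom) (e : K) (he : Transcendental k e)
    (hF : ∀ ξ : SpO k K ⟶ X, ∃ y : SpO k k ⟶ X, ξ = sm (Algebra.ofId k K) ≫ y)
    (g : GG k) (hg1 : kap1 g ≠ 0) (hg2 : kap2 g ≠ 0) (Z : SpO k (Localization.Away g) ⟶ X)
    (γ1 γ2 : SpO k (PowerSeries k) ⟶ X)
    (h1 : sm (gen kap1 g hg1) ≫ Z = sm (frac k (PowerSeries k)) ≫ γ1)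
    (h2 : sm (gen kap2 g hg2) ≫ Z = sm (frac k (PowerSeries k)) ≫ γ2) :
    sm (cc k k) ≫ γ1 = sm (cc k k) ≫ γ2 := by
  have hg' : psi (K := K) one_pos one_pos 1 e g ≠ 0 := by
    intro h0
    have : g = 0 := psi_injective one_pos one_pos e he (by rw [h0, map_zero])
    rw [this, map_zero] at hg1; exact hg1 rfl
  obtain ⟨η1, a1, b1⟩ := half hft e he hF kap1 cond_kap1 g hg1 Z γ1 h1 hg'
  obtain ⟨η2, a2, b2⟩ := half hft e he hF kap2 cond_kap2 g hg2 Z γ2 h2 hg'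
  have : η1 = η2 := pt_ext hsep (frac k _) (frac_inj _) (by rw [a1, a2])
  subst this
  apply pt_ext hsep (Algebra.ofId k K) (algebraMap k K).injective
  rw [← b1, ← b2]
end

end PtF
end

end

section
open CategoryTheory AlgebraicGeometry Limits
noncomputable section
namespace GrpF
open PtF
variable {k : Type} [Field k]

section grp
variable (Γ : GroupScheme k) {T T' : OverR k}

lemma mul_inv (a : T ⟶ Γ.G) : Γ.mul a (Γ.inv a) = Γ.one T := by
  let _ : Mul (T ⟶ Γ.G) := ⟨Γ.mul⟩
  let _ : One (T ⟶ Γ.G) := ⟨Γ.one T⟩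
  let _ : Inv (T ⟶ Γ.G) := ⟨Γ.inv⟩
  let _ : Group (T ⟶ Γ.G) := Group.ofLeftAxioms Γ.mul_assoc Γ.one_mul Γ.inv_mul
  exact mul_inv_cancel a

lemma mul_one (a : T ⟶ Γ.G) : Γ.mul a (Γ.one T) = a := by
  rw [← Γ.inv_mul a, ← Γ.mul_assoc, mul_inv, Γ.one_mul]

lemma inv_natural (f : T ⟶ T') (a : T' ⟶ Γ.G) : f ≫ Γ.inv a = Γ.inv (f ≫ a) := by
  have h : Γ.mul (f ≫ Γ.inv a) (f ≫ a) = Γ.one T := by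
    rw [← Γ.mul_natural, Γ.inv_mul, Γ.one_natural]
  rw [← mul_one Γ (f ≫ Γ.inv a), ← mul_inv Γ (f ≫ a), ← Γ.mul_assoc, h, Γ.one_mul]

end grp

section dn
variable {R S : Type} [CommRing R] [CommRing S] [Algebra k R] [Algebra k S]

def dn (f : R →ₐ[k] S) : DualNumber R →ₐ[k] DualNumber S :=
  AlgHom.ofLinearMap
   { toFun := fun x => TrivSqZeroExt.inl (f x.fst) + TrivSqZeroExt.inr (f x.snd)
     map_add' := fun x y => by ext <;> simp
     map_smul' := fun c x => by ext <;> simp }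
   (by ext <;> simp) (fun x y => by ext <;> simp [mul_comm])

lemma dn_fst (f : R →ₐ[k] S) (x) : (dn f x).fst = f x.fst := by simp [dn]
lemma dn_snd (f : R →ₐ[k] S) (x) : (dn f x).snd = f x.snd := by simp [dn]

def mkdn (χ : R →ₐ[k] S) (l : R →ₗ[k] S) (h : ∀ x y, l (x * y) = χ x * l y + χ y * l x) : R →ₐ[k] DualNumber S :=
  AlgHom.ofLinearMap
   { toFun := fun x => TrivSqZeroExt.inl (χ x) + TrivSqZeroExt.inr (l x)
     map_add' := fun x y => by ext <;> simp
     map_smul' := fun c x => by ext <;> simp }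
   (by
     have h1 := h 1 1
     simp at h1
     ext <;> simp [h1]) (fun x y => by ext <;> simp [mul_comm, h])

lemma mkdn_fst (χ : R →ₐ[k] S) (l : R →ₗ[k] S) (h) (x) : (mkdn χ l h x).fst = χ x := by simp [mkdn]
lemma mkdn_snd (χ : R →ₐ[k] S) (l : R →ₗ[k] S) (h) (x) : (mkdn χ l h x).snd = l x := by simp [mkdn]

instance fst_local : IsLocalHom (TrivSqZeroExt.fstHom k R R).toRingHom :=
  ⟨fun _ h => TrivSqZeroExt.isUnit_iff_isUnit_fst.mpr h⟩

instance dn_isLocal [IsLocalRing R] : IsLocalRing (DualNumber R) :=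
  have : IsLocalHom (TrivSqZeroExt.fstHom R R R).toRingHom :=
    ⟨fun _ h => TrivSqZeroExt.isUnit_iff_isUnit_fst.mpr h⟩
  RingHom.domain_isLocalRing (TrivSqZeroExt.fstHom R R R).toRingHom
end dn

lemma lift_loc {X : OverR k} {C : Type} [CommRing C] [Algebra k C] (ι : SpO k C ⟶ X)
    (hι : IsOpenImmersion ι.left) {R L : Type} [CommRing R] [IsLocalRing R] [Algebra k R] [CommRing L] [IsLocalRing L]
    [Algebra k L]
    (π : R →ₐ[k] L) (hπ : IsLocalHom π.toRingHom) (z : SpO k R ⟶ X) (ψ : C →ₐ[k] L)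
    (h : sm π ≫ z = sm ψ ≫ ι) :
    ∃ φ : C →ₐ[k] R, sm φ ≫ ι = z ∧ π.comp φ = ψ := by
  have hcl : (sm π).left (IsLocalRing.closedPoint L) = IsLocalRing.closedPoint R :=
    IsLocalRing.comap_closedPoint π.toRingHom
  obtain ⟨φ, hφ⟩ := lift_local ι hι z (by
    have h1 := congrArg CommaMorphism.left h
    have h2 := congrArg (fun f => f (IsLocalRing.closedPoint L)) h1
    have h3 : z.left ((sm π).left (IsLocalRing.closedPoint L)) =
      ι.left ((sm ψ).left (IsLocalRing.closedPoint L)) := h2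
    rw [hcl] at h3
    exact ⟨_, h3.symm⟩)
  refine ⟨φ, hφ, sm_inj (chart_mono ι hι ?_)⟩
  rw [← h, sm_comp, Category.assoc, hφ]

lemma exists_coords {B : Type} [CommRing B] [Algebra k B] (χ : B →ₐ[k] k) (n : Ideal B) (hn : RingHom.ker χ = n)
    (hfg : n.FG) : ∃ (d : ℕ) (x : Fin d → B) (l : Fin d → (B →ₗ[k] k)), (∀ i, x i ∈ n) ∧
      (∀ i g h, l i (g * h) = χ g * l i h + χ h * l i g) ∧ (∀ i j, l i (x j) = if i = j then 1 else 0) ∧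
      n ≤ Ideal.span (Set.range x) ⊔ n ^ 2 := by
  classical
  have hmem : ∀ b, b - algebraMap k B (χ b) ∈ n := by
    intro b; rw [← hn, RingHom.mem_ker]; simp
  have hχ : ∀ b ∈ n, χ b = 0 := by intro b hb; rw [← hn] at hb; exact hb
  have hsm : ∀ (b : B) (v : n.Cotangent), b • v = χ b • v := by
    intro b v
    obtain ⟨v, rfl⟩ := n.toCotangent_surjective v
    rw [← algebraMap_smul B (χ b), ← sub_eq_zero, ← sub_smul, ← map_smul, Ideal.toCotangent_eq_zero, pow_two]
    exact Ideal.mul_mem_mul (hmem b) v.2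
  have hfin : Module.Finite k n.Cotangent := by
    have : Module.Finite B n := Module.Finite.iff_fg.mpr hfg
    have hB : Module.Finite B n.Cotangent := Module.Finite.of_surjective _ n.toCotangent_surjective
    obtain ⟨s, hs⟩ := hB.fg_top
    refine ⟨⟨s, ?_⟩⟩
    rw [eq_top_iff]
    intro v _
    have hv : v ∈ Submodule.span B (s : Set n.Cotangent) := by rw [hs]; trivial
    refine Submodule.span_induction (fun x hx => Submodule.subset_span hx) (zero_mem _)
      (fun _ _ _ _ => add_mem) (fun b x _ hx => ?_) hv
    rw [hsm]; exact Submodule.smul_mem _ _ hx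
  let bs := Module.finBasis k n.Cotangent
  choose x hx using fun i => n.toCotangent_surjective (bs i)
  let π : B → n := fun b => ⟨b - algebraMap k B (χ b), hmem b⟩
  let q : B →ₗ[k] n.Cotangent :=
    { toFun := fun b => n.toCotangent (π b)
      map_add' := fun a b => by
        rw [← map_add]; congr 1; ext; simp [π]; ring
      map_smul' := fun c b => by
        rw [RingHom.id_apply, ← algebraMap_smul B c (n.toCotangent (π b)), ← map_smul]; congr 1; ext
        simp [π, Algebra.smul_def, mul_sub] }
  have hq : ∀ b (hb : b ∈ n), q b = n.toCotangent ⟨b, hb⟩ := by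
    intro b hb
    show n.toCotangent (π b) = _
    congr 1; ext; simp [π, hχ b hb]
  refine ⟨_, fun i => (x i : B), fun i => bs.coord i ∘ₗ q, fun i => (x i).2, ?_, ?_, ?_⟩
  · intro i g h
    have : q (g * h) = χ g • q h + χ h • q g := by
      rw [← hsm, ← hsm]
      show n.toCotangent (π (g * h)) = g • n.toCotangent (π h) + h • n.toCotangent (π g)
      rw [← map_smul, ← map_smul, ← map_add, Ideal.toCotangent_eq]
      have : ((π (g * h) : n) : B) - ((g • π h + h • π g : n) : B) = - ((π g : B) * (π h : B)) := by
        simp [π]; ring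
      rw [this, pow_two]
      exact neg_mem (Ideal.mul_mem_mul (π g).2 (π h).2)
    simp [this]
  · intro i j
    have : q (x j) = bs j := by rw [hq _ (x j).2]; exact hx j
    simp [this, Finsupp.single_apply, eq_comm]
  · intro b hb
    have h1 := bs.sum_repr (n.toCotangent ⟨b, hb⟩)
    simp only [← hx] at h1
    have h2 : n.toCotangent (∑ i, algebraMap k B (bs.repr (n.toCotangent ⟨b, hb⟩) i) • x i) = n.toCotangent ⟨b, hb⟩ := by
      rw [map_sum]; conv_rhs => rw [← h1]
      refine Finset.sum_congr rfl fun i _ => ?_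
      rw [map_smul, algebraMap_smul]
    rw [Ideal.toCotangent_eq] at h2
    have h3 : ((∑ i, algebraMap k B (bs.repr (n.toCotangent ⟨b, hb⟩) i) • x i : n) : B) ∈ Ideal.span (Set.range fun i => (x i : B)) := by
      rw [AddSubmonoidClass.coe_finsetSum]
      refine Ideal.sum_mem _ fun i _ => ?_
      exact Ideal.mul_mem_left _ _ (Ideal.subset_span ⟨i, rfl⟩)
    rw [← sub_sub_self ((∑ i, algebraMap k B (bs.repr (n.toCotangent ⟨b, hb⟩) i) • x i : n) : B) b]
    exact sub_mem (Ideal.mem_sup_left h3) (Ideal.mem_sup_right h2)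

end GrpF
end

end

section
open CategoryTheory AlgebraicGeometry Limits
noncomputable section
namespace GrpF
open PtF
variable {k : Type} [Field k] 

section
variable {B S : Type} [CommRing B] [CommRing S] [Algebra k B] [Algebra k S]

/-- extension to the localization at a prime -/
def liftP (n : Ideal B) [n.IsPrime] (φ : B →ₐ[k] S) (h : ∀ b, b ∉ n → IsUnit (φ b)) : Localization.AtPrime n →ₐ[k] S :=
  IsLocalization.liftAlgHom (M := n.primeCompl) (f := φ) (fun b => h b b.2)

lemma liftP_algebraMap (n : Ideal B) [n.IsPrime] (φ : B →ₐ[k] S) (h) (x : B) :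
    liftP n φ h (algebraMap B (Localization.AtPrime n) x) = φ x := by
  unfold liftP
  rw [IsLocalization.liftAlgHom_apply, IsLocalization.lift_eq]; rfl

lemma atPrime_ext (n : Ideal B) [n.IsPrime] {φ ψ : Localization.AtPrime n →ₐ[k] S}
    (h : ∀ x, φ (algebraMap B _ x) = ψ (algebraMap B _ x)) : φ = ψ := by
  apply IsLocalization.algHom_ext n.primeCompl (A := B)
  ext x; exact h x

abbrev locP (k : Type) [Field k] {B : Type} [CommRing B] [Algebra k B] (n : Ideal B) [n.IsPrime] :
    B →ₐ[k] Localization.AtPrime n :=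
  IsScalarTower.toAlgHom k B (Localization.AtPrime n)
end

/-- a derivation from a dual number map -/
def derOf {R : Type} [CommRing R] [Algebra k R] (Φ : R →ₐ[k] DualNumber R) (h : ∀ r, (Φ r).fst = r) : Derivation k R R :=
  Derivation.mk' { toFun := fun r => (Φ r).snd
                   map_add' := fun x y => by simp
                   map_smul' := fun c x => by simp } (fun a b => by
    simp [h, mul_comm])

lemma smc {X : OverR k} {R S T : Type} [CommRing R] [CommRing S] [CommRing T] [Algebra k R] [Algebra k S] [Algebra k T]
    (φ : R →ₐ[k] S) (ψ : S →ₐ[k] T) (z : SpO k R ⟶ X) : sm ψ ≫ sm φ ≫ z = sm (ψ.comp φ) ≫ z := by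
  rw [sm_comp, Category.assoc]

theorem exists_der (Γ : GroupScheme k) {B : Type} [CommRing B] [Algebra k B]
    (ι : SpO k B ⟶ Γ.G) (hι : IsOpenImmersion ι.left) (n : Ideal B) [n.IsMaximal] (χ : B →ₐ[k] k)
    (hχ : RingHom.ker χ = n) (l : B →ₗ[k] k) (hl : ∀ g h, l (g * h) = χ g * l h + χ h * l g)
    (res : Localization.AtPrime n →ₐ[k] k) (hres : res.comp (locP k n) = χ) :
    ∃ D : Derivation k (Localization.AtPrime n) (Localization.AtPrime n), ∀ b : B, res (D (algebraMap B _ b)) = l b := by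
  obtain ⟨θ, hθ⟩ : ∃ θ : SpO k (Localization.AtPrime n) ⟶ Γ.G, θ = sm (locP k n) ≫ ι := ⟨_, rfl⟩
  obtain ⟨a, ha⟩ : ∃ a : SpO k k ⟶ Γ.G, a = sm χ ≫ ι := ⟨_, rfl⟩
  obtain ⟨t, ht⟩ : ∃ t : SpO k (DualNumber k) ⟶ Γ.G, t = sm (mkdn χ l hl) ≫ ι := ⟨_, rfl⟩
  let R := Localization.AtPrime n
  let p : SpO k (DualNumber R) ⟶ Γ.G := Γ.mul (Γ.mul (sm (TrivSqZeroExt.inlAlgHom k R R) ≫ θ)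
    (Γ.inv (sm (Algebra.ofId k (DualNumber R)) ≫ a))) (sm (dn (Algebra.ofId k R)) ≫ t)
  have hta : sm (TrivSqZeroExt.fstHom k k k) ≫ t = a := by
    rw [ha, ht, smc]
    congr 2
    ext x; exact mkdn_fst _ _ hl _
  have e1 : (TrivSqZeroExt.fstHom k R R).comp (dn (Algebra.ofId k R)) = (Algebra.ofId k R).comp (TrivSqZeroExt.fstHom k k k) := by
    apply AlgHom.ext
    intro x; exact dn_fst _ _
  have h1 : sm (TrivSqZeroExt.fstHom k R R) ≫ p = θ := by
    show _ ≫ Γ.mul _ _ = θ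
    rw [Γ.mul_natural, Γ.mul_natural, inv_natural, smc, smc, smc, e1, ← smc (TrivSqZeroExt.fstHom k k k), hta]
    have e2 : (TrivSqZeroExt.fstHom k R R).comp (TrivSqZeroExt.inlAlgHom k R R) = AlgHom.id k R := by
      apply AlgHom.ext; intro x; rfl
    have e3 : (TrivSqZeroExt.fstHom k R R).comp (Algebra.ofId k (DualNumber R)) = Algebra.ofId k R := Subsingleton.elim _ _
    rw [e2, e3, Γ.mul_assoc, Γ.inv_mul, mul_one, sm_id, Category.id_comp]
  have h2 : sm (dn res) ≫ p = t := by
    show _ ≫ Γ.mul _ _ = t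
    rw [Γ.mul_natural, Γ.mul_natural, inv_natural, smc, smc, smc]
    have e2 : (dn res).comp (TrivSqZeroExt.inlAlgHom k R R) = (Algebra.ofId k (DualNumber k)).comp res := by
      apply AlgHom.ext; intro x
      ext
      · show (dn res _).fst = _
        rw [dn_fst]; rfl
      · show (dn res _).snd = _
        rw [dn_snd]; exact map_zero res
    have e3 : (dn res).comp (Algebra.ofId k (DualNumber R)) = Algebra.ofId k (DualNumber k) := Subsingleton.elim _ _
    have e4 : (dn res).comp (dn (Algebra.ofId k R)) = AlgHom.id k (DualNumber k) := by
      apply AlgHom.ext; intro x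
      ext
      · show (dn res _).fst = _
        rw [dn_fst]
        refine Eq.trans (congrArg res (dn_fst _ _)) (res.commutes _)
      · show (dn res _).snd = _
        rw [dn_snd]
        refine Eq.trans (congrArg res (dn_snd _ _)) (res.commutes _)
    have e5 : sm res ≫ θ = a := by
      rw [hθ, ha, smc, hres]
    rw [e2, e3, e4, ← smc, e5, mul_inv, Γ.one_mul, sm_id, Category.id_comp]
  obtain ⟨φ, hφ1, hφ2⟩ := lift_loc ι hι (TrivSqZeroExt.fstHom k R R) inferInstance p (locP k n) (h1.trans hθ)
  have hφ3 : (dn res).comp φ = mkdn χ l hl := by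
    refine sm_inj (chart_mono ι hι ?_)
    rw [sm_comp, Category.assoc, hφ1, h2, ht]
  let Φ : R →ₐ[k] DualNumber R := liftP n φ (fun b hb => by
    rw [TrivSqZeroExt.isUnit_iff_isUnit_fst]
    have : (φ b).fst = algebraMap B R b := DFunLike.congr_fun hφ2 b
    rw [this]
    exact IsLocalization.map_units R (⟨b, hb⟩ : n.primeCompl))
  have hΦ : (TrivSqZeroExt.fstHom k R R).comp Φ = AlgHom.id k R := by
    apply atPrime_ext
    intro x
    show (Φ (algebraMap B R x)).fst = algebraMap B R x
    rw [show Φ (algebraMap B R x) = φ x from liftP_algebraMap _ _ _ _]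
    exact DFunLike.congr_fun hφ2 x
  refine ⟨derOf Φ (fun r => DFunLike.congr_fun hΦ r), fun b => ?_⟩
  show res ((Φ (algebraMap B R b)).snd) = l b
  rw [show Φ (algebraMap B R b) = φ b from liftP_algebraMap _ _ _ _, ← dn_snd]
  have := DFunLike.congr_fun hφ3 b
  have h4 := congrArg TrivSqZeroExt.snd this
  rw [mkdn_snd] at h4
  exact h4

theorem group_local [IsAlgClosed k] [CharZero k] (Γ : GroupScheme k) {B : Type} [CommRing B] [Algebra k B]
    [Algebra.FiniteType k B]
    (ι : SpO k B ⟶ Γ.G) (hι : IsOpenImmersion ι.left) (n : Ideal B) [n.IsMaximal] :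
    IsDomain (Localization.AtPrime n) ∧ IsIntegrallyClosed (Localization.AtPrime n) := by
  classical
  have hN : IsNoetherianRing B := Algebra.FiniteType.isNoetherianRing k B
  obtain ⟨χ, hχ⟩ := CurveSel.exists_hom_of_max (k := k) n
  obtain ⟨d, x, l, hx, hl, hlx, hspan⟩ := exists_coords χ n hχ (IsNoetherian.noetherian n)
  let R := Localization.AtPrime n
  have hun : ∀ b, b ∉ n → IsUnit (χ b) := fun b hb => by
    rw [isUnit_iff_ne_zero]
    intro h0
    exact hb (hχ ▸ h0)
  let res : R →ₐ[k] k := liftP n χ hun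
  have hres : res.comp (locP k n) = χ := by
    apply AlgHom.ext
    intro b; exact liftP_algebraMap n χ hun b
  have hker : ∀ r : R, res r = 0 → r ∈ IsLocalRing.maximalIdeal R := by
    intro r hr
    rw [IsLocalRing.mem_maximalIdeal]
    intro hu
    exact (hu.map res).ne_zero hr
  choose D hD using fun i => exists_der Γ ι hι n χ hχ (l i) (hl i) res hres
  have hNR : IsNoetherianRing R := IsLocalization.isNoetherianRing n.primeCompl R hN
  have hmap : n.map (algebraMap B R) = IsLocalRing.maximalIdeal R := Localization.AtPrime.map_eq_maximalIdeal
  refine Cartier.normal_of_derivations (k := k) (x := fun i => algebraMap B R (x i)) ?_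
    (fun g => ⟨res g, hker _ (by rw [map_sub, sub_eq_zero]; exact (res.commutes _).symm)⟩) D ?_
  · apply le_antisymm
    · rw [Ideal.span_le]
      rintro _ ⟨i, rfl⟩
      rw [← hmap]
      exact Ideal.mem_map_of_mem _ (hx i)
    · have h1 : IsLocalRing.maximalIdeal R ≤ Ideal.span (Set.range fun i => algebraMap B R (x i)) ⊔
          IsLocalRing.maximalIdeal R • IsLocalRing.maximalIdeal R := by
        have h2 := Ideal.map_mono (f := algebraMap B R) hspan
        rw [Ideal.map_sup, Ideal.map_pow, hmap, Ideal.map_span, pow_two, ← Set.range_comp] at h2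
        exact h2
      exact Submodule.le_of_le_smul_of_le_jacobson_bot (IsNoetherian.noetherian _)
        (by rw [IsLocalRing.jacobson_eq_maximalIdeal _ bot_ne_top]) h1
  · intro i j
    apply hker
    rw [map_sub, hD, hlx]
    split_ifs <;> simp

end GrpF
end

end

section
open CategoryTheory AlgebraicGeometry Limits
noncomputable section
namespace GrpF
open PtF
variable {k : Type} [Field k] 

lemma max_of_closed {S : OverR k} {B : Type} [CommRing B] [Algebra k B] (ι : SpO k B ⟶ S)
    (hι : IsOpenImmersion ι.left) (s : S.left) (hs : IsClosed {s}) (hm : s ∈ Set.range ι.left) :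
    ∃ n : PrimeSpectrum B, n.asIdeal.IsMaximal ∧ ι.left n = s := by
  obtain ⟨n, hn⟩ := hm
  refine ⟨n, ?_, hn⟩
  refine (PrimeSpectrum.isClosed_singleton_iff_isMaximal (R := B) n).mp ?_
  have : ({n} : Set (SpO k B).left) = ι.left ⁻¹' {s} := by
    ext y
    simp only [Set.mem_singleton_iff, Set.mem_preimage]
    constructor
    · rintro rfl; exact hn
    · intro h; exact hι.base_open.injective (h.trans hn.symm)
  have h2 : IsClosed ({n} : Set (SpO k B).left) := by
    rw [this]; exact hs.preimage ι.left.continuous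
  exact h2

lemma sm_loc_open {B : Type} [CommRing B] [Algebra k B] (b : B) : IsOpenImmersion (sm (loc k B b)).left := by
  have : IsOpenImmersion (Spec.map (CommRingCat.ofHom (algebraMap B (Localization.Away b)))) := inferInstance
  exact this

lemma mem_range_loc {B : Type} [CommRing B] [Algebra k B] (b : B) (p : PrimeSpectrum B) :
    (p : (SpO k B).left) ∈ Set.range (sm (loc k B b)).left ↔ b ∉ p.asIdeal := by
  have := PrimeSpectrum.localization_away_comap_range (Localization.Away b) b
  have h2 : Set.range (sm (loc k B b)).left = (PrimeSpectrum.basicOpen b : Set (PrimeSpectrum B)) := this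
  rw [h2]; rfl

lemma comp_open {X Y Z : OverR k} (f : X ⟶ Y) (g : Y ⟶ Z) (hf : IsOpenImmersion f.left) (hg : IsOpenImmersion g.left) :
    IsOpenImmersion (f ≫ g).left := by
  rw [Over.comp_left]; infer_instance

lemma exists_away_domain {B : Type} [CommRing B] [IsNoetherianRing B] (n : Ideal B) [n.IsPrime]
    (h : IsDomain (Localization.AtPrime n)) : ∃ b, b ∉ n ∧ IsDomain (Localization.Away b) := by
  let I := RingHom.ker (algebraMap B (Localization.AtPrime n))
  obtain ⟨s, hs⟩ := (IsNoetherian.noetherian I : I.FG)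
  have h1 : ∀ x ∈ I, ∃ b : n.primeCompl, b * x = 0 := by
    intro x hx
    exact (IsLocalization.map_eq_zero_iff n.primeCompl (Localization.AtPrime n) x).mp hx
  have h1' : ∀ x : B, ∃ b : n.primeCompl, x ∈ I → b * x = 0 := by
    intro x
    by_cases hx : x ∈ I
    · obtain ⟨b, hb⟩ := h1 x hx; exact ⟨b, fun _ => hb⟩
    · exact ⟨1, fun h => absurd h hx⟩
  choose c hc using h1'
  let b : B := ∏ x ∈ s, (c x : B)
  have hb : b ∈ n.primeCompl := Submonoid.prod_mem _ fun x _ => (c x).2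
  have hbI : ∀ x ∈ I, b * x = 0 := by
    intro x hx
    rw [← hs] at hx
    refine Submodule.span_induction (fun x hx => ?_) (mul_zero _) (fun x y _ _ h1 h2 => by rw [mul_add, h1, h2, add_zero])
      (fun a x _ h => by rw [smul_eq_mul, mul_left_comm, h, mul_zero]) hx
    have hxs : x ∈ s := hx
    have hxI : x ∈ I := by rw [← hs]; exact Ideal.subset_span hx
    obtain ⟨d, hd⟩ := Finset.dvd_prod_of_mem (fun x => (c x : B)) hxs
    show b * x = 0
    have : b = (c x : B) * d := hd
    rw [this, mul_right_comm, hc x hxI, zero_mul]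
  refine ⟨b, hb, ?_⟩
  let f : Localization.Away b →+* Localization.AtPrime n :=
    IsLocalization.Away.lift (g := algebraMap B (Localization.AtPrime n)) b (IsLocalization.map_units _ (⟨b, hb⟩ : n.primeCompl))
  have hf : Function.Injective f := by
    rw [injective_iff_map_eq_zero]
    intro x hx
    obtain ⟨m, y, hy⟩ := IsLocalization.Away.surj (S := Localization.Away b) b x
    have hu : IsUnit (algebraMap B (Localization.Away b) b) := IsLocalization.Away.algebraMap_isUnit b
    have hyI : y ∈ I := by
      show algebraMap B (Localization.AtPrime n) y = 0
      have := congrArg f hy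
      rw [map_mul, hx, zero_mul, IsLocalization.Away.lift_eq] at this
      exact this.symm
    have h3 : algebraMap B (Localization.Away b) y = 0 := by
      have := congrArg (algebraMap B (Localization.Away b)) (hbI y hyI)
      rw [map_mul, map_zero] at this
      exact (hu.mul_right_eq_zero).mp this
    rw [h3] at hy
    exact ((hu.pow m).mul_left_eq_zero).mp hy
  exact hf.isDomain f

/-- domain charts on a group scheme -/
lemma group_chart [IsAlgClosed k] [CharZero k] (Γ : GroupScheme k) (hft : LocallyOfFiniteType Γ.G.hom) (s : Γ.G.left)
    (hs : IsClosed {s}) : ∃ (B : Type) (_ : CommRing B) (_ : Algebra k B) (ι : SpO k B ⟶ Γ.G),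
      Algebra.FiniteType k B ∧ IsDomain B ∧ IsOpenImmersion ι.left ∧ s ∈ Set.range ι.left := by
  obtain ⟨B, _, _, ι, hB, hι, hm⟩ := exists_chart hft s
  obtain ⟨n, hn, hns⟩ := max_of_closed ι hι s hs hm
  have hN : IsNoetherianRing B := Algebra.FiniteType.isNoetherianRing k B
  obtain ⟨b, hb, hd⟩ := exists_away_domain n.asIdeal (group_local Γ ι hι n.asIdeal).1
  obtain ⟨p, hp⟩ := (mem_range_loc (k := k) b n).mpr hb
  refine ⟨Localization.Away b, inferInstance, inferInstance, sm (loc k B b) ≫ ι, ?_, hd, ?_, ⟨p, ?_⟩⟩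
  · exact Algebra.FiniteType.trans (S := B) inferInstance (IsLocalization.finiteType_of_monoid_fg (Submonoid.powers b) _)
  · exact comp_open _ _ (sm_loc_open b) hι
  · rw [← hns, ← hp]; rfl

/-- gluing irreducibility -/
lemma irreducible_of_cover {T : Type} [TopologicalSpace T] [ConnectedSpace T] (h : ∀ x : T, ∃ V : Set T, IsOpen V ∧ x ∈ V ∧ IsPreirreducible V) :
    IrreducibleSpace T := by
  have h3 : ∀ V V' W : Set T, IsOpen V → IsOpen V' → IsOpen W → IsPreirreducible V' → (V ∩ V').Nonempty → (V' ∩ W).Nonempty →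
      (V ∩ W).Nonempty := by
    intro V V' W hV hV' hW hi h1 h2
    obtain ⟨x, hx⟩ := hi V W hV hW (by rwa [Set.inter_comm]) h2
    exact ⟨x, hx.2⟩
  have key : ∀ U : Set T, IsOpen U → U.Nonempty → ∀ x, ∃ V, IsOpen V ∧ x ∈ V ∧ IsPreirreducible V ∧ (U ∩ V).Nonempty := by
    intro U hU hne
    obtain ⟨u, hu⟩ := hne
    let P : Set T := {x | ∃ V, IsOpen V ∧ x ∈ V ∧ IsPreirreducible V ∧ (U ∩ V).Nonempty}
    have hop : IsOpen P := by
      rw [isOpen_iff_forall_mem_open]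
      rintro x ⟨V, h1, h2, h3, h4⟩
      exact ⟨V, fun y hy => ⟨V, h1, hy, h3, h4⟩, h1, h2⟩
    have hcl : IsClosed P := by
      rw [← isOpen_compl_iff, isOpen_iff_forall_mem_open]
      intro x hx
      obtain ⟨V, h1, h2, h3'⟩ := h x
      refine ⟨V, ?_, h1, h2⟩
      rintro y hy ⟨W, w1, w2, w3, w4⟩
      exact hx ⟨V, h1, h2, h3', h3 U W V hU w1 h1 w3 w4 ⟨y, w2, hy⟩⟩
    have hne : P.Nonempty := by
      obtain ⟨V, h1, h2, h3⟩ := h u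
      exact ⟨u, V, h1, h2, h3, u, hu, h2⟩
    have := IsClopen.eq_univ ⟨hcl, hop⟩ hne
    intro x
    have hx : x ∈ P := by rw [this]; trivial
    exact hx
  have : PreirreducibleSpace T := by
    refine ⟨?_⟩
    rintro U W hU hW ⟨u, -, hu⟩ ⟨w, -, hw⟩
    obtain ⟨V, h1, h2, h3', h4⟩ := key U hU ⟨u, hu⟩ w
    obtain ⟨y, hy⟩ := h3 U V W hU h1 hW h3' h4 ⟨w, h2, hw⟩
    exact ⟨y, trivial, hy⟩
  exact { toNonempty := inferInstance }

theorem group_integral [IsAlgClosed k] [CharZero k] (Γ : GroupScheme k) (hft : LocallyOfFiniteType Γ.G.hom)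
    (hc : ConnectedSpace Γ.G.left) : IsIntegral Γ.G.left := by
  have hJ : JacobsonSpace Γ.G.left := LocallyOfFiniteType.jacobsonSpace Γ.G.hom
  let W : Set Γ.G.left := {x | ∃ (B : Type) (_ : CommRing B) (_ : Algebra k B) (ι : SpO k B ⟶ Γ.G),
      IsDomain B ∧ IsOpenImmersion ι.left ∧ x ∈ Set.range ι.left}
  have hW : IsOpen W := by
    rw [isOpen_iff_forall_mem_open]
    rintro x ⟨B, _, _, ι, h1, h2, h3⟩
    exact ⟨_, fun y hy => ⟨B, _, _, ι, h1, h2, hy⟩, h2.base_open.isOpen_range, h3⟩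
  have hWtop : ∀ x, x ∈ W := by
    by_contra! hcon
    obtain ⟨x, hx⟩ := hcon
    obtain ⟨y, hy1, hy2⟩ := nonempty_inter_closedPoints (Z := Wᶜ) ⟨x, hx⟩ hW.isClosed_compl.isLocallyClosed
    obtain ⟨B, _, _, ι, -, h1, h2, h3⟩ := group_chart Γ hft y hy2
    exact hy1 ⟨B, _, _, ι, h1, h2, h3⟩
  have hred : IsReduced Γ.G.left := by
    have : ∀ x : Γ.G.left, _root_.IsReduced (Γ.G.left.presheaf.stalk x) := by
      intro x
      obtain ⟨B, _, _, ι, h1, h2, ⟨y, rfl⟩⟩ := hWtop x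
      have : IsDomain (CommRingCat.of B) := h1
      have hr : IsReduced (SpO k B).left := by dsimp; infer_instance
      exact isReduced_of_injective (ι.left.stalkMap y).hom (ConcreteCategory.bijective_of_isIso (ι.left.stalkMap y)).injective
    exact isReduced_of_isReduced_stalk _
  have hirr : IrreducibleSpace Γ.G.left := by
    apply irreducible_of_cover
    intro x
    obtain ⟨B, _, _, ι, h1, h2, h3⟩ := hWtop x
    refine ⟨Set.range ι.left, h2.base_open.isOpen_range, h3, ?_⟩
    have : IrreducibleSpace (PrimeSpectrum B) := inferInstance
    have hi : IsPreirreducible (Set.univ : Set (SpO k B).left) := this.toPreirreducibleSpace.isPreirreducible_univ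
    rw [← Set.image_univ]
    exact hi.image _ ι.left.continuous.continuousOn
  exact isIntegral_of_irreducibleSpace_of_isReduced _

end GrpF
end

end

section
open CategoryTheory AlgebraicGeometry Limits
noncomputable section
namespace Glue
open PtF
variable {k : Type} [Field k]

lemma mem_of_closed {S : OverR k} (hS : LocallyOfFiniteType S.hom) (U : Set S.left) (hU : IsOpen U)
    (h : ∀ s : S.left, IsClosed {s} → s ∈ U) (s : S.left) : s ∈ U := by
  have : JacobsonSpace S.left := LocallyOfFiniteType.jacobsonSpace S.hom
  by_contra hs
  obtain ⟨t, ht, ht'⟩ := nonempty_inter_closedPoints (Z := Uᶜ) ⟨s, hs⟩ hU.isClosed_compl.isLocallyClosed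
  exact ht (h t ht')

/-- gluing of morphisms -/
lemma glue {S X : OverR k} (hS : LocallyOfFiniteType S.hom) {I : Type} (T : I → OverR k)
    (j : ∀ i, T i ⟶ S) (F : ∀ i, T i ⟶ X)
    (hj : ∀ i, IsOpenImmersion (j i).left)
    (hc : ∀ s : S.left, IsClosed {s} → ∃ i, s ∈ Set.range (j i).left)
    (hcompat : ∀ a b (W : OverR k) (p : W ⟶ T a) (q : W ⟶ T b), p ≫ j a = q ≫ j b →
      IsOpenImmersion (p ≫ j a).left → p ≫ F a = q ≫ F b) :
    ∃ G : S ⟶ X, ∀ i, j i ≫ G = F i := by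
  have hc' : ∀ s : S.left, s ∈ ⋃ i, Set.range (j i).left :=
    mem_of_closed hS _ (isOpen_iUnion fun i => (hj i).base_open.isOpen_range)
      (fun s hs => Set.mem_iUnion.mpr (hc s hs))
  have hf : ∀ x y : I, pullback.fst (j x).left (j y).left ≫ (F x).left =
      pullback.snd (j x).left (j y).left ≫ (F y).left := by
    intro x y
    have e1 : pullback.fst (j x).left (j y).left ≫ (j x).left =
      pullback.snd (j x).left (j y).left ≫ (j y).left := pullback.condition
    let W : OverR k := Over.mk (pullback.fst (j x).left (j y).left ≫ (T x).hom)
    let p : W ⟶ T x := Over.homMk (pullback.fst (j x).left (j y).left) rfl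
    let q : W ⟶ T y := Over.homMk (pullback.snd (j x).left (j y).left) (by
      show pullback.snd (j x).left (j y).left ≫ (T y).hom = pullback.fst (j x).left (j y).left ≫ (T x).hom
      rw [← Over.w (j y), ← Over.w (j x), ← Category.assoc, ← e1, Category.assoc])
    have h1 : p ≫ j x = q ≫ j y := by ext1; exact e1
    have := hj x
    have := hj y
    have h2 : IsOpenImmersion (p ≫ j x).left :=
      (inferInstance : IsOpenImmersion (pullback.fst (j x).left (j y).left ≫ (j x).left))
    exact congrArg CommaMorphism.left (hcompat x y W p q h1 h2)
  obtain ⟨𝒰, h0, h1⟩ : ∃ G : S.left ⟶ X.left, (∀ i, (j i).left ≫ G = (F i).left) ∧ G ≫ X.hom = S.hom := by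
    let 𝒰 : S.left.OpenCover := Scheme.Cover.mkOfCovers I (fun i => (T i).left) (fun i => (j i).left)
      (fun s => by
        obtain ⟨i, y, hy⟩ := Set.mem_iUnion.mp (hc' s)
        exact ⟨i, y, hy⟩) hj
    obtain ⟨G, hG⟩ : ∃ G : S.left ⟶ X.left, (∀ i, (j i).left ≫ G = (F i).left) :=
      ⟨𝒰.glueMorphisms (fun i => (F i).left) hf, fun i => 𝒰.ι_glueMorphisms (fun i => (F i).left) hf i⟩
    refine ⟨G, hG, Scheme.Cover.hom_ext 𝒰 _ _ fun (i : I) => ?_⟩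
    have : (j i).left ≫ G ≫ X.hom = (j i).left ≫ S.hom := by
      rw [← Category.assoc, hG, Over.w, Over.w]
    exact this
  exact ⟨Over.homMk 𝒰 h1, fun i => by ext1; exact h0 i⟩

lemma over_lift {T S W : OverR k} (j : T ⟶ S) (hj : IsOpenImmersion j.left) (f : W ⟶ S)
    (hf : Set.range f.left ⊆ Set.range j.left) : ∃ g : W ⟶ T, g ≫ j = f := by
  refine ⟨Over.homMk (IsOpenImmersion.lift j.left f.left hf) ?_, ?_⟩
  · rw [← Over.w j, IsOpenImmersion.lift_fac_assoc, Over.w]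
  · ext1
    exact IsOpenImmersion.lift_fac _ _ _

lemma over_mono {T S W : OverR k} (j : T ⟶ S) (hj : IsOpenImmersion j.left) {f g : W ⟶ T}
    (h : f ≫ j = g ≫ j) : f = g := by
  ext1
  rw [← cancel_mono j.left]
  exact congrArg CommaMorphism.left h

lemma over_empty {W X : OverR k} (h : IsEmpty W.left) (f g : W ⟶ X) : f = g := by
  ext1
  exact isInitialOfIsEmpty.hom_ext _ _

/-- the image of a dominant field-valued point is in every nonempty open -/
lemma generic_mem {S : OverR k} {L : Type} [Field L] [Algebra k L] (η : SpO k L ⟶ S)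
    (hη : IsDominant η.left) (U : Set S.left) (hU : IsOpen U) (hne : U.Nonempty) :
    Set.range η.left ⊆ U := by
  obtain ⟨y, hy⟩ := hη.denseRange.exists_mem_open hU hne
  rintro _ ⟨x, rfl⟩
  have : x = y := (inferInstance : Subsingleton (PrimeSpectrum L)).elim x y
  rw [this]; exact hy

lemma dominant_lift {S W : OverR k} {L : Type} [Field L] [Algebra k L] (η : SpO k L ⟶ S)
    (hη : IsDominant η.left) (w : W ⟶ S) (hw : IsOpenImmersion w.left) (hne : Nonempty W.left) :
    ∃ e : SpO k L ⟶ W, e ≫ w = η ∧ IsDominant e.left := by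
  obtain ⟨e, he⟩ := over_lift w hw η (generic_mem η hη _ hw.base_open.isOpen_range (Set.range_nonempty _))
  refine ⟨e, he, ⟨?_⟩⟩
  have h1 : DenseRange (w.left ∘ e.left) := by
    have := hη.denseRange
    rw [← he] at this
    exact this
  rw [DenseRange, dense_iff_inter_open]
  intro V hV hVn
  obtain ⟨y, hy⟩ := h1.exists_mem_open (hw.base_open.isOpenMap V hV) (hVn.image _)
  obtain ⟨v, hv, hvy⟩ := hy
  have : v = e.left y := hw.base_open.injective hvy
  exact ⟨_, this ▸ hv, y, rfl⟩

lemma over_ext {X W : OverR k} (hX : IsSeparated X.hom) (hW : IsReduced W.left) {E : OverR k} (e : E ⟶ W)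
    (he : IsDominant e.left) {f g : W ⟶ X} (h : e ≫ f = e ≫ g) : f = g := by
  ext1
  refine ext_of_isDominant_of_isSeparated X.hom ?_ e.left (congrArg CommaMorphism.left h)
  rw [Over.w, Over.w]

lemma reduced_open {W S : OverR k} (w : W ⟶ S) (hw : IsOpenImmersion w.left) (hS : IsReduced S.left) :
    IsReduced W.left := isReduced_of_isOpenImmersion w.left

/-- gluing rational extensions -/
lemma glue_generic {S X : OverR k} (hS : LocallyOfFiniteType S.hom) (hSr : IsReduced S.left)
    (hX : IsSeparated X.hom) {L : Type} [Field L] [Algebra k L]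
    (η : SpO k L ⟶ S) (hη : IsDominant η.left) (u : SpO k L ⟶ X)
    (hc : ∀ s : S.left, IsClosed {s} → ∃ (T : OverR k) (j : T ⟶ S) (F : T ⟶ X) (e : SpO k L ⟶ T),
      IsOpenImmersion j.left ∧ s ∈ Set.range j.left ∧ e ≫ j = η ∧ e ≫ F = u) :
    ∃ G : S ⟶ X, η ≫ G = u := by
  have hc' : ∀ s : {s : S.left // IsClosed {s}}, ∃ (T : OverR k) (j : T ⟶ S) (F : T ⟶ X) (e : SpO k L ⟶ T),
      IsOpenImmersion j.left ∧ s.1 ∈ Set.range j.left ∧ e ≫ j = η ∧ e ≫ F = u := fun s => hc s.1 s.2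
  choose T j F e hj hs hej heF using hc'
  obtain ⟨G, hG⟩ := glue hS T j F hj (fun s hs' => ⟨⟨s, hs'⟩, hs ⟨s, hs'⟩⟩) (by
    intro a b W p q hpq hW
    by_cases hne : Nonempty W.left
    · obtain ⟨w, hw, hwd⟩ := dominant_lift η hη (p ≫ j a) hW hne
      refine over_ext hX (reduced_open _ hW hSr) w hwd ?_
      have h1 : w ≫ p = e a := over_mono (j a) (hj a) (by rw [Category.assoc, hw, hej])
      have h2 : w ≫ q = e b := over_mono (j b) (hj b) (by rw [Category.assoc, ← hpq, hw, hej])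
      rw [← Category.assoc, h1, ← Category.assoc, h2, heF, heF]
    · exact over_empty (not_nonempty_iff.mp hne) _ _)
  refine ⟨G, ?_⟩
  have hne : Nonempty S.left := ⟨η.left (IsLocalRing.closedPoint L)⟩
  have : JacobsonSpace S.left := LocallyOfFiniteType.jacobsonSpace S.hom
  obtain ⟨t, ht, ht'⟩ := nonempty_inter_closedPoints (Z := (Set.univ : Set S.left)) Set.univ_nonempty
    isOpen_univ.isLocallyClosed
  rw [← hej ⟨t, ht'⟩, Category.assoc, hG, heF]

section pts
variable [IsAlgClosed k]

lemma pts_closed {S : OverR k} (hS : LocallyOfFiniteType S.hom) (s : S.left) (hs : IsClosed {s}) :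
    ∃ t : SpO k k ⟶ S, ∀ a, t.left a = s := by
  have e : Spec.map (CommRingCat.ofHom (algebraMap k k)) = 𝟙 _ := Spec.map_id _
  refine ⟨Over.homMk (pointOfClosedPoint S.hom s hs) ?_, fun a => pointOfClosedPoint_apply S.hom s hs a⟩
  rw [pointOfClosedPoint_comp]; exact e.symm

lemma pts_ext {X W : OverR k} (hXf : LocallyOfFiniteType X.hom) (hX : IsSeparated X.hom)
    (hWf : LocallyOfFiniteType W.hom) (hW : IsReduced W.left) {f g : W ⟶ X}
    (h : ∀ t : SpO k k ⟶ W, t ≫ f = t ≫ g) : f = g := by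
  ext1
  have : LocallyOfFiniteType (f.left ≫ X.hom) := by rw [Over.w]; exact hWf
  refine ext_of_apply_eq X.hom Set.univ isOpen_univ.isLocallyClosed dense_univ ?_ ?_
  · intro s _ hs
    obtain ⟨t, ht⟩ := pts_closed hWf s hs
    have h1 := congrArg (fun z => z.left (IsLocalRing.closedPoint k)) (h t)
    have h2 : f.left (t.left (IsLocalRing.closedPoint k)) = g.left (t.left (IsLocalRing.closedPoint k)) := h1
    have h3 : t.left (IsLocalRing.closedPoint k) = s := ht _
    rwa [h3] at h2
  · rw [Over.w, Over.w]

lemma lft_open {W S : OverR k} (w : W ⟶ S) (hw : IsOpenImmersion w.left) (hS : LocallyOfFiniteType S.hom) :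
    LocallyOfFiniteType W.hom := by
  rw [← Over.w w]
  have h1 : LocallyOfFiniteType w.left := inferInstance
  exact MorphismProperty.comp_mem _ _ _ h1 hS

/-- gluing by k-points -/
lemma glue_pts {S X : OverR k} (hS : LocallyOfFiniteType S.hom) (hSr : IsReduced S.left)
    (hXf : LocallyOfFiniteType X.hom) (hX : IsSeparated X.hom) (m : (SpO k k ⟶ S) → (SpO k k ⟶ X))
    (hc : ∀ t : SpO k k ⟶ S, ∃ (T : OverR k) (j : T ⟶ S) (F : T ⟶ X) (t' : SpO k k ⟶ T),
      IsOpenImmersion j.left ∧ t' ≫ j = t ∧ ∀ e : SpO k k ⟶ T, e ≫ F = m (e ≫ j)) :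
    ∃ G : S ⟶ X, ∀ t : SpO k k ⟶ S, t ≫ G = m t := by
  have hc' : ∀ s : {s : S.left // IsClosed {s}}, ∃ (T : OverR k) (j : T ⟶ S) (F : T ⟶ X),
      IsOpenImmersion j.left ∧ s.1 ∈ Set.range j.left ∧ ∀ e : SpO k k ⟶ T, e ≫ F = m (e ≫ j) := by
    intro s
    obtain ⟨t, ht⟩ := pts_closed hS s.1 s.2
    obtain ⟨T, j, F, t', hj, h1, h2⟩ := hc t
    refine ⟨T, j, F, hj, ⟨t'.left (IsLocalRing.closedPoint k), ?_⟩, h2⟩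
    rw [← ht (IsLocalRing.closedPoint k), ← h1]; rfl
  choose T j F hj hs hF using hc'
  obtain ⟨G, hG⟩ := glue hS T j F hj (fun s hs' => ⟨⟨s, hs'⟩, hs ⟨s, hs'⟩⟩) (by
    intro a b W p q hpq hW
    refine pts_ext hXf hX (lft_open _ hW hS) (reduced_open _ hW hSr) fun t => ?_
    rw [← Category.assoc, hF, ← Category.assoc, hF, Category.assoc, hpq, Category.assoc])
  refine ⟨G, fun t => ?_⟩
  have ht : IsClosed {t.left (IsLocalRing.closedPoint k)} := by
    have w := Over.w t
    have e : Spec.map (CommRingCat.ofHom (algebraMap k k)) = 𝟙 _ := Spec.map_id _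
    have w' : t.left ≫ S.hom = 𝟙 _ := w.trans e
    exact (pointEquivClosedPoint S.hom ⟨t.left, w'⟩).2
  obtain ⟨i, hi⟩ : ∃ i, i = (⟨_, ht⟩ : {s : S.left // IsClosed {s}}) := ⟨_, rfl⟩
  obtain ⟨t', ht'⟩ := over_lift (j i) (hj i) t (by
    rintro _ ⟨x, rfl⟩
    have h0 : x = IsLocalRing.closedPoint k := (inferInstance : Subsingleton (PrimeSpectrum k)).elim _ _
    rw [h0]
    have := hs i
    rw [hi] at this ⊢
    exact this)
  rw [← ht', Category.assoc, hG, hF]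
end pts
end Glue
end

end

section
open CategoryTheory AlgebraicGeometry Limits
noncomputable section
namespace Glue
open PtF GrpF
variable {k : Type} [Field k]

lemma inj_unit {B L : Type} [CommRing B] [Algebra k B] [Field L] [Algebra k L]
    (ψ : B →ₐ[k] L) (hψ : Function.Injective ψ) (n : Ideal B) (b : B) (hb : b ∉ n) : IsUnit (ψ b) := by
  rw [isUnit_iff_ne_zero]
  intro h
  rw [← map_zero ψ] at h
  exact hb (hψ h ▸ n.zero_mem)

lemma liftA_inj {B L : Type} [CommRing B] [IsDomain B] [Algebra k B] [Field L] [Algebra k L]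
    (ψ : B →ₐ[k] L) (hψ : Function.Injective ψ) (b : B) (hb : IsUnit (ψ b)) : Function.Injective (liftA ψ hb) := by
  rw [injective_iff_map_eq_zero]
  intro x hx
  obtain ⟨a, m, rfl⟩ := IsLocalization.exists_mk'_eq (Submonoid.powers b) x
  have h1 : liftA ψ hb (IsLocalization.mk' (Localization.Away b) a m * algebraMap B _ m) = 0 := by
    rw [map_mul, hx, zero_mul]
  rw [IsLocalization.mk'_spec, liftA_algebraMap, ← map_zero ψ] at h1
  rw [hψ h1, IsLocalization.mk'_zero]

/-- spreading out a map from a local ring -/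
lemma spread {S X : OverR k} (hXf : LocallyOfFiniteType X.hom) {B L : Type} [CommRing B] [IsDomain B]
    [Algebra k B] [Field L] [Algebra k L] (ι0 : SpO k B ⟶ S) (hι0 : IsOpenImmersion ι0.left)
    (ψ : B →ₐ[k] L) (hψ : Function.Injective ψ) (n : PrimeSpectrum B)
    (z : SpO k (Localization.AtPrime n.asIdeal) ⟶ X) :
    ∃ (T : OverR k) (j : T ⟶ S) (F : T ⟶ X) (e : SpO k L ⟶ T),
      IsOpenImmersion j.left ∧ ι0.left n ∈ Set.range j.left ∧ e ≫ j = sm ψ ≫ ι0 ∧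
      e ≫ F = sm (liftP n.asIdeal ψ (fun b hb => inj_unit ψ hψ n.asIdeal b hb)) ≫ z := by
  obtain ⟨C, _, _, ι, hC, hι, hmem⟩ := exists_chart hXf (z.left (IsLocalRing.closedPoint (Localization.AtPrime n.asIdeal)))
  obtain ⟨φ, hφ⟩ := lift_local ι hι z hmem
  obtain ⟨s, hs⟩ := hC.1
  classical
  obtain ⟨b, hb⟩ := IsLocalization.exist_integer_multiples_of_finset n.asIdeal.primeCompl (s.image φ)
  have hbu : IsUnit (ψ b) := inj_unit ψ hψ n.asIdeal b b.2
  let Θ := (liftP n.asIdeal ψ (fun b hb => inj_unit ψ hψ n.asIdeal b hb)).comp φ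
  obtain ⟨χ, hχ⟩ := exists_restrict (liftA ψ hbu) (liftA_inj ψ hψ b hbu) Θ s hs (by
    intro c hc
    obtain ⟨a, ha⟩ := hb (φ c) (Finset.mem_image_of_mem φ hc)
    have hu := IsLocalization.Away.algebraMap_isUnit (S := Localization.Away (b : B)) (b : B)
    obtain ⟨v, hv⟩ := hu
    refine ⟨algebraMap B _ a * ↑v⁻¹, ?_⟩
    have h3 := congrArg (liftP n.asIdeal ψ (fun b hb => inj_unit ψ hψ n.asIdeal b hb)) ha
    rw [liftP_algebraMap, Algebra.smul_def, map_mul, liftP_algebraMap] at h3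
    have h4 : liftA ψ hbu ((algebraMap B _ a * ↑v⁻¹) * ↑v) = ψ a := by
      rw [mul_assoc, Units.inv_mul, _root_.mul_one, liftA_algebraMap]
    rw [map_mul, hv, liftA_algebraMap, h3, mul_comm] at h4
    exact mul_left_cancel₀ hbu.ne_zero h4)
  refine ⟨SpO k (Localization.Away (b : B)), sm (loc k B b) ≫ ι0, sm χ ≫ ι, sm (liftA ψ hbu),
    comp_open _ _ (sm_loc_open _) hι0, ?_, ?_, ?_⟩
  · obtain ⟨y, hy⟩ := (mem_range_loc (k := k) (b : B) n).mpr b.2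
    refine ⟨y, ?_⟩
    exact congrArg ι0.left hy
  · rw [smc]
    congr 2
    apply AlgHom.ext; intro x
    exact liftA_algebraMap ψ hbu x
  · rw [smc, hχ, sm_comp, Category.assoc, hφ]

/-- constant maps in terms of rational points -/
lemma const_iff {W X : OverR k} (t : SpO k k ⟶ W) (f : W ⟶ X) (h : IsConstant f) :
    f = Over.homMk W.hom (by
      have e : Spec.map (CommRingCat.ofHom (algebraMap k k)) = 𝟙 _ := Spec.map_id _
      exact (congrArg (W.hom ≫ ·) e).trans (Category.comp_id _)) ≫ (t ≫ f) := by
  obtain ⟨y, hy⟩ := h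
  ext1
  rw [Over.comp_left, Over.comp_left, hy, ← Category.assoc t.left, Over.w]
  have e : Spec.map (CommRingCat.ofHom (algebraMap k k)) = 𝟙 _ := Spec.map_id _
  show W.hom ≫ y = W.hom ≫ Spec.map (CommRingCat.ofHom (algebraMap k k)) ≫ y
  rw [e, Category.id_comp]

lemma const_sp {R : Type} [CommRing R] [Algebra k R] {X : OverR k} (t : R →ₐ[k] k) (f : SpO k R ⟶ X) (h : IsConstant f) :
    f = sm (Algebra.ofId k R) ≫ (sm t ≫ f) := by
  refine (const_iff (sm t) f h).trans ?_
  congr 1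

section
variable (k)
abbrev LP := LaurentPolynomial k
abbrev KK := FractionRing (LP k)

instance lp_dom : IsDomain (LP k) :=
  IsLocalization.isDomain_of_le_nonZeroDivisors (M := Submonoid.powers (Polynomial.X : Polynomial k)) (R := Polynomial k) _ (by
    rintro _ ⟨n, rfl⟩
    exact mem_nonZeroDivisors_of_ne_zero (pow_ne_zero _ Polynomial.X_ne_zero))

instance lp_ded : IsDedekindDomain (LP k) :=
  IsLocalization.isDedekindDomain (Polynomial k) (M := Submonoid.powers (Polynomial.X : Polynomial k)) (by
    rintro _ ⟨n, rfl⟩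
    exact mem_nonZeroDivisors_of_ne_zero (pow_ne_zero _ Polynomial.X_ne_zero)) _

end

lemma ded_val (D : Type) [CommRing D] [IsDedekindDomain D] (n : Ideal D) [n.IsPrime] : ValuationRing (Localization.AtPrime n) := by
  have h1 : IsDedekindDomain (Localization.AtPrime n) :=
    IsLocalization.isDedekindDomain D (M := n.primeCompl) n.primeCompl_le_nonZeroDivisors _
  have h2 : IsPrincipalIdealRing (Localization.AtPrime n) := by
    apply IsPrincipalIdealRing.of_finite_primes
    have : {I : Ideal (Localization.AtPrime n) | I.IsPrime} ⊆ {⊥, IsLocalRing.maximalIdeal _} := by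
      intro I hI
      by_cases h0 : I = ⊥
      · exact Or.inl h0
      · have hI' : I.IsPrime := hI
        exact Or.inr (IsLocalRing.eq_maximalIdeal (hI'.isMaximal h0))
    exact Set.Finite.subset (by simp) this
  infer_instance

lemma dom_of_inj {R L : Type} [CommRing R] [IsDomain R] [Algebra k R] [Field L] [Algebra k L] (φ : R →ₐ[k] L)
    (hφ : Function.Injective φ) : IsDominant (sm φ).left := by
  refine ⟨?_⟩
  have : DenseRange (PrimeSpectrum.comap φ.toRingHom) := by
    rw [PrimeSpectrum.denseRange_comap_iff_ker_le_nilRadical]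
    have : RingHom.ker φ.toRingHom = ⊥ := (RingHom.injective_iff_ker_eq_bot _).mp hφ
    rw [this]; exact bot_le
  exact this

lemma inj_of_dom {R L : Type} [CommRing R] [IsDomain R] [Algebra k R] [Field L] [Algebra k L] (φ : R →ₐ[k] L)
    (hφ : IsDominant (sm φ).left) : Function.Injective φ := by
  have h1 : DenseRange (PrimeSpectrum.comap φ.toRingHom) := hφ.denseRange
  rw [PrimeSpectrum.denseRange_comap_iff_ker_le_nilRadical] at h1
  refine (RingHom.injective_iff_ker_eq_bot φ.toRingHom).mpr ?_
  have : nilradical R = ⊥ := nilradical_eq_zero R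
  rw [this] at h1
  exact le_bot_iff.mp h1

lemma sp_reduced (R : Type) [CommRing R] [IsDomain R] [Algebra k R] : IsReduced (SpO k R).left := by
  have : IsDomain (CommRingCat.of R) := ‹IsDomain R›
  dsimp; infer_instance

lemma sp_lft (R : Type) [CommRing R] [Algebra k R] (h : Algebra.FiniteType k R) : LocallyOfFiniteType (SpO k R).hom := by
  refine (HasRingHomProperty.Spec_iff (P := @LocallyOfFiniteType)).mpr ?_
  exact (RingHom.finiteType_algebraMap).mpr h

/-- extension of rational maps from Dedekind affine curves -/
theorem ded_extend {X : OverR k} (hXf : LocallyOfFiniteType X.hom) (hXp : IsProper X.hom) (D : Type) [CommRing D]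
    [IsDedekindDomain D] [Algebra k D] (hD : Algebra.FiniteType k D) (u : SpO k (FractionRing D) ⟶ X) :
    ∃ G : SpO k D ⟶ X, sm (frac k D) ≫ G = u := by
  refine glue_generic (sp_lft D hD) (sp_reduced D) inferInstance (sm (frac k D)) (dom_of_inj _ (frac_inj D)) u ?_
  intro s hs
  let n : PrimeSpectrum D := s
  have := ded_val D n.asIdeal
  let i := liftP n.asIdeal (frac k D) (fun b hb => inj_unit _ (frac_inj D) n.asIdeal b hb)
  let : Algebra (Localization.AtPrime n.asIdeal) (FractionRing D) := i.toRingHom.toAlgebra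
  have t1 : IsScalarTower D (Localization.AtPrime n.asIdeal) (FractionRing D) :=
    IsScalarTower.of_algebraMap_eq fun x => (liftP_algebraMap n.asIdeal (frac k D) _ x).symm
  have t2 : IsScalarTower k (Localization.AtPrime n.asIdeal) (FractionRing D) :=
    IsScalarTower.of_algebraMap_eq fun x => (i.commutes x).symm
  have t3 : IsFractionRing (Localization.AtPrime n.asIdeal) (FractionRing D) :=
    IsFractionRing.isFractionRing_of_isDomain_of_isLocalization n.asIdeal.primeCompl _ _
  obtain ⟨z, hz⟩ := pt_extend hXp (V := Localization.AtPrime n.asIdeal) (L := FractionRing D) u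
  obtain ⟨T, j, F, e, h1, h2, h3, h4⟩ := spread (S := SpO k D) hXf (𝟙 _) (inferInstanceAs (IsOpenImmersion (𝟙 (SpO k D).left))) (frac k D) (frac_inj D) n z
  refine ⟨T, j, F, e, h1, h2, h3.trans (Category.comp_id _), h4.trans ?_⟩
  rw [← hz]
  congr 2

lemma lp_ft : Algebra.FiniteType k (LP k) := by
  have : AddMonoid.FG ℤ := inferInstance
  exact inferInstance

/-- evaluation at a unit -/
def lpev (u : kˣ) : LP k →ₐ[k] k :=
  { LaurentPolynomial.eval₂ (RingHom.id k) u with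
    commutes' := fun r => LaurentPolynomial.eval₂_C (RingHom.id k) u r }

theorem field_const {X : OverR k} (hXf : LocallyOfFiniteType X.hom) (hXp : IsProper X.hom)
    (hG : ∀ f : GmO k ⟶ X, IsConstant f) (ξ : SpO k (KK k) ⟶ X) :
    ∃ y : SpO k k ⟶ X, ξ = sm (Algebra.ofId k (KK k)) ≫ y := by
  obtain ⟨G, hGe⟩ := ded_extend hXf hXp (LP k) lp_ft ξ
  obtain ⟨t, -⟩ : ∃ t, t = lpev (1 : kˣ) := ⟨_, rfl⟩
  have h := const_sp t G (hG G)
  refine ⟨sm t ≫ G, ?_⟩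
  rw [← hGe]
  conv_lhs => rw [h]
  rw [smc]
  congr 2

lemma kk_trans : Transcendental k (algebraMap (LP k) (KK k) (LaurentPolynomial.T 1)) := by
  rw [transcendental_algebraMap_iff (IsFractionRing.injective (LP k) (KK k)), transcendental_iff_injective]
  have : Polynomial.aeval (LaurentPolynomial.T 1 : LP k) = (Polynomial.toLaurentAlg : Polynomial k →ₐ[k] LP k) := by
    apply Polynomial.algHom_ext
    rw [Polynomial.aeval_X]
    exact Polynomial.toLaurent_X.symm
  rw [this]
  exact Polynomial.toLaurent_injective

end Glue
end

end

section
open CategoryTheory AlgebraicGeometry Limits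
noncomputable section
namespace Glue
open PtF GrpF Newton
variable {k : Type} [Field k]

lemma two_avoid {R : Type} [CommRing R] (I P Q : Ideal R) [P.IsPrime] [Q.IsPrime] (h1 : ¬ I ≤ P) (h2 : ¬ I ≤ Q) :
    ∃ g ∈ I, g ∉ P ∧ g ∉ Q := by
  obtain ⟨x, hx, hxP⟩ := Set.not_subset.mp h1
  obtain ⟨y, hy, hyQ⟩ := Set.not_subset.mp h2
  by_cases hxQ : x ∈ Q
  · by_cases hyP : y ∈ P
    · refine ⟨x + y, I.add_mem hx hy, fun h => hxP ?_, fun h => hyQ ?_⟩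
      · exact (Ideal.add_mem_iff_left P hyP).mp h
      · exact (Ideal.add_mem_iff_right Q hxQ).mp h
    · exact ⟨y, hy, hyP, hyQ⟩
  · exact ⟨x, hx, hxP, hxQ⟩

/-- basic open avoiding two primes -/
lemma two_basic {R : Type} [CommRing R] (O : Set (PrimeSpectrum R)) (hO : IsOpen O) (P Q : PrimeSpectrum R) (hP : P ∈ O) (hQ : Q ∈ O) :
    ∃ g : R, g ∉ P.asIdeal ∧ g ∉ Q.asIdeal ∧ ∀ p : PrimeSpectrum R, g ∉ p.asIdeal → p ∈ O := by
  obtain ⟨I, hI⟩ := (PrimeSpectrum.isClosed_iff_zeroLocus_ideal _).mp hO.isClosed_compl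
  have key : ∀ p : PrimeSpectrum R, p ∈ O ↔ ¬ I ≤ p.asIdeal := by
    intro p
    have : p ∈ Oᶜ ↔ p ∈ PrimeSpectrum.zeroLocus (I : Set R) := by rw [hI]
    rw [PrimeSpectrum.mem_zeroLocus, Set.mem_compl_iff] at this
    constructor
    · intro h h2; exact this.mpr h2 h
    · intro h; by_contra h2; exact h (this.mp h2)
  obtain ⟨g, hg, h1, h2⟩ := two_avoid I P.asIdeal Q.asIdeal ((key P).mp hP) ((key Q).mp hQ)
  exact ⟨g, h1, h2, fun p hp => (key p).mpr fun h => hp (h hg)⟩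

abbrev PS (k : Type) [Field k] := PowerSeries k

lemma ofId_cc (S : Type) [CommRing S] [Algebra k S] (f : PS k →ₐ[k] S) (h : ∀ x, f x = algebraMap k S (PowerSeries.constantCoeff x)) :
   f = (Algebra.ofId k S).comp (cc k k) := by
  apply AlgHom.ext; intro x; rw [h]; rfl

lemma arc_surface (Γ : GroupScheme k) (γ0 γ1 : SpO k (PS k) ⟶ Γ.G) (h : sm (cc k k) ≫ γ0 = sm (cc k k) ≫ γ1) :
    ∃ Φ : SpO k (GG k) ⟶ Γ.G, sm kap1 ≫ Φ = γ0 ∧ sm kap2 ≫ Φ = γ1 := by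
  obtain ⟨a, ha⟩ : ∃ a : SpO k k ⟶ Γ.G, a = sm (cc k k) ≫ γ0 := ⟨_, rfl⟩
  have e1 : kap1.comp (inc 0) = AlgHom.id k (PS k) := AlgHom.ext fun f => kap1_inc0 f
  have e2 : kap2.comp (inc 1) = AlgHom.id k (PS k) := AlgHom.ext fun f => kap2_inc1 f
  have e3 : kap1.comp (inc 1) = (Algebra.ofId k (PS k)).comp (cc k k) := ofId_cc _ _ fun f => kap1_inc1 f
  have e4 : kap2.comp (inc 0) = (Algebra.ofId k (PS k)).comp (cc k k) := ofId_cc _ _ fun f => kap2_inc0 f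
  have e5 : ∀ κ : GG k →ₐ[k] PS k, κ.comp (Algebra.ofId k (GG k)) = Algebra.ofId k (PS k) := fun κ => by
    apply AlgHom.ext; intro x; exact κ.commutes x
  refine ⟨Γ.mul (Γ.mul (sm (inc 0) ≫ γ0) (Γ.inv (sm (Algebra.ofId k (GG k)) ≫ a))) (sm (inc 1) ≫ γ1), ?_, ?_⟩
  · rw [Γ.mul_natural, Γ.mul_natural, inv_natural, smc, smc, smc, e1, e3, e5, sm_id, Category.id_comp, sm_comp, Category.assoc, ← h,
      ← ha, Γ.mul_assoc, Γ.inv_mul, GrpF.mul_one]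
  · rw [Γ.mul_natural, Γ.mul_natural, inv_natural, smc, smc, smc, e2, e4, e5, sm_id, Category.id_comp, sm_comp, Category.assoc,
      ← ha, GrpF.mul_inv, Γ.one_mul]

/-- all arcs through the same point have the same limit -/
theorem arcs [IsAlgClosed k] [CharZero k] (Γ : GroupScheme k) {X W : OverR k} (hXf : LocallyOfFiniteType X.hom) (hXs : IsSeparated X.hom)
    (hF : ∀ ξ : SpO k (KK k) ⟶ X, ∃ y : SpO k k ⟶ X, ξ = sm (Algebra.ofId k (KK k)) ≫ y)
    (w : W ⟶ Γ.G) (hw : IsOpenImmersion w.left) (F : W ⟶ X)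
    (γ0 γ1 : SpO k (PS k) ⟶ Γ.G) (h : sm (cc k k) ≫ γ0 = sm (cc k k) ≫ γ1)
    (l0 l1 : SpO k (FractionRing (PS k)) ⟶ W) (h0 : l0 ≫ w = sm (frac k (PS k)) ≫ γ0)
    (h1 : l1 ≫ w = sm (frac k (PS k)) ≫ γ1) (d0 d1 : SpO k (PS k) ⟶ X)
    (hd0 : sm (frac k (PS k)) ≫ d0 = l0 ≫ F) (hd1 : sm (frac k (PS k)) ≫ d1 = l1 ≫ F) :
    sm (cc k k) ≫ d0 = sm (cc k k) ≫ d1 := by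
  obtain ⟨Φ, hΦ0, hΦ1⟩ := arc_surface Γ γ0 γ1 h
  have mem : ∀ (κ : GG k →ₐ[k] PS k) (l : SpO k (FractionRing (PS k)) ⟶ W),
      l ≫ w = sm (frac k (PS k)) ≫ (sm κ ≫ Φ) →
      (sm ((frac k (PS k)).comp κ)).left (IsLocalRing.closedPoint (FractionRing (PS k))) ∈ Φ.left ⁻¹' (Set.range w.left) := by
    intro κ l hl
    rw [smc] at hl
    have h2 := congrArg (fun f => f.left (IsLocalRing.closedPoint (FractionRing (PS k)))) hl
    have h3 : w.left (l.left (IsLocalRing.closedPoint (FractionRing (PS k)))) =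
      Φ.left ((sm ((frac k (PS k)).comp κ)).left (IsLocalRing.closedPoint (FractionRing (PS k)))) := h2
    exact ⟨_, h3⟩
  have hO : IsOpen (Φ.left ⁻¹' (Set.range w.left)) := hw.base_open.isOpen_range.preimage Φ.left.continuous
  obtain ⟨g, hg1, hg2, hgO⟩ := two_basic (R := GG k) _ hO _ _ (mem kap1 l0 (by rw [hΦ0, h0])) (mem kap2 l1 (by rw [hΦ1, h1]))
  have ne : ∀ κ : GG k →ₐ[k] PS k, g ∉ ((sm ((frac k (PS k)).comp κ)).left
      (IsLocalRing.closedPoint (FractionRing (PS k))) : PrimeSpectrum (GG k)).asIdeal → κ g ≠ 0 := by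
    intro κ hκ h0
    apply hκ
    show (frac k (PS k)) (κ g) ∈ IsLocalRing.maximalIdeal (FractionRing (PS k))
    rw [h0, map_zero]; exact Ideal.zero_mem _
  have hg1 := ne kap1 hg1
  have hg2 := ne kap2 hg2
  obtain ⟨Z0, hZ0⟩ := over_lift w hw (sm (loc k (GG k) g) ≫ Φ) (by
    rintro _ ⟨y, rfl⟩
    exact hgO ((sm (loc k (GG k) g)).left y) ((mem_range_loc (k := k) g _).mp ⟨y, rfl⟩))
  have key : ∀ (κ : GG k →ₐ[k] PS k) (hκ : κ g ≠ 0) (l : SpO k (FractionRing (PS k)) ⟶ W) (γ : SpO k (PS k) ⟶ Γ.G),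
      l ≫ w = sm (frac k (PS k)) ≫ γ → sm κ ≫ Φ = γ → sm (gen κ g hκ) ≫ Z0 = l := by
    intro κ hκ l γ hl hγ
    refine over_mono w hw ?_
    rw [Category.assoc, hZ0, hl, ← hγ, smc, smc]
    congr 2
    apply AlgHom.ext; intro x
    exact liftA_algebraMap _ (unit_frac κ g hκ) x
  refine surface hXf hXs _ kk_trans hF g hg1 hg2 (Z0 ≫ F) d0 d1 ?_ ?_
  · rw [hd0, ← Category.assoc, key kap1 hg1 l0 γ0 h0 hΦ0]
  · rw [hd1, ← Category.assoc, key kap2 hg2 l1 γ1 h1 hΦ1]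
end Glue
end

end

section
open CategoryTheory AlgebraicGeometry Limits
noncomputable section
namespace Glue
open PtF GrpF Newton
variable {k : Type} [Field k]

lemma liftP_inj {B L : Type} [CommRing B] [IsDomain B] [Algebra k B] [Field L] [Algebra k L]
    (ψ : B →ₐ[k] L) (hψ : Function.Injective ψ) (n : Ideal B) [n.IsPrime] :
    Function.Injective (liftP n ψ (fun b hb => inj_unit ψ hψ n b hb)) := by
  obtain ⟨i, hi⟩ : ∃ i, i = liftP n ψ (fun b hb => inj_unit ψ hψ n b hb) := ⟨_, rfl⟩
  rw [← hi]
  have hi1 : ∀ b, i (algebraMap B _ b) = ψ b := fun b => by rw [hi, liftP_algebraMap]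
  rw [injective_iff_map_eq_zero]
  intro r hr
  obtain ⟨⟨b, s⟩, hs⟩ := IsLocalization.surj (M := n.primeCompl) r
  have h1 := congrArg i hs
  rw [map_mul, hr, zero_mul, hi1] at h1
  have h2 : b = 0 := hψ (by rw [map_zero]; exact h1.symm)
  simp only [h2, map_zero] at hs
  exact (IsUnit.mul_left_eq_zero (IsLocalization.map_units (Localization.AtPrime n) s)).mp hs

lemma int_mem {R L : Type} [CommRing R] [IsDomain R] [IsIntegrallyClosed R] [Field L] (i : R →+* L) (hi : Function.Injective i)
    (h : L) (a b : R) (hb : b ≠ 0) (hab : h * i b = i a) (Q : Polynomial R) (hQ : Q.eval₂ i h = 0) (hu : IsUnit Q.leadingCoeff) :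
    ∃ y, i y = h := by
  let _ : Algebra R L := i.toAlgebra
  have h4 := isIntegral_leadingCoeff_smul Q h hQ
  obtain ⟨u, hu⟩ := hu
  have h5 : IsIntegral R h := by
    have := h4.smul (((u⁻¹ : Rˣ)) : R)
    rwa [smul_smul, ← hu, Units.inv_mul, one_smul] at this
  let j : FractionRing R →ₐ[R] L := IsFractionRing.liftAlgHom (g := Algebra.ofId R L) hi
  let q : FractionRing R := algebraMap R _ a / algebraMap R _ b
  have hq : j q = h := by
    have hb1' : i b ≠ 0 := fun h => hb (hi (by rw [h, map_zero]))
    have e : ∀ b, algebraMap R L b = i b := fun _ => rfl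
    rw [map_div₀, AlgHom.commutes, AlgHom.commutes, e, e, ← hab]
    field_simp
  rw [← hq, isIntegral_algHom_iff j j.toRingHom.injective] at h5
  obtain ⟨y, hy⟩ := IsIntegrallyClosed.algebraMap_eq_of_integral h5
  refine ⟨y, ?_⟩
  have := congrArg j hy
  rw [AlgHom.commutes, hq] at this
  exact this

lemma alg_coeff {B L : Type} [CommRing B] [IsDomain B] [Algebra k B] [Field L] [Algebra k L]
    (ψ : B →ₐ[k] L) (hψ : Function.Injective ψ) (n : Ideal B) [n.IsPrime]
    [IsIntegrallyClosed (Localization.AtPrime n)] (h : L) (h0 : h ≠ 0) (b0 b1 : B) (hb1 : b1 ≠ 0) (hb : h * ψ b1 = ψ b0)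
    (hh : h ∉ (liftP n ψ (fun b hb => inj_unit ψ hψ n b hb)).range) (P : Polynomial B)
    (hP : P.eval₂ (ψ : B →+* L) h⁻¹ = 0) : P.coeff 0 ∈ n := by
  by_contra hn
  apply hh
  have hii := liftP_inj ψ hψ n
  obtain ⟨i, hi⟩ : ∃ i, i = liftP n ψ (fun b hb => inj_unit ψ hψ n b hb) := ⟨_, rfl⟩
  rw [← hi] at hii ⊢
  let R := Localization.AtPrime n
  have hi1 : ∀ b, i (algebraMap B R b) = ψ b := fun b => by rw [hi, liftP_algebraMap]
  have hc0 : P.coeff 0 ≠ 0 := fun h => hn (by rw [h]; exact n.zero_mem)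
  let Q : Polynomial B := P.reverse
  have hQ : Q.eval₂ (ψ : B →+* L) h = 0 := by
    have : Invertible h⁻¹ := invertibleOfNonzero (inv_ne_zero h0)
    have h3 := (Polynomial.eval₂_reverse_eq_zero_iff (ψ : B →+* L) h⁻¹ P).mpr hP
    rwa [invOf_eq_inv, inv_inv] at h3
  have hQl : Q.leadingCoeff = P.coeff 0 := by
    rw [Polynomial.reverse_leadingCoeff, Polynomial.trailingCoeff, Polynomial.natTrailingDegree_eq_zero.mpr (Or.inr hc0)]
  have : IsDomain R := IsLocalization.isDomain_localization (M := n.primeCompl) (n.primeCompl_le_nonZeroDivisors)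
  have hinjBR : Function.Injective (algebraMap B R) := fun x y hxy => hψ (by rw [← hi1, ← hi1, hxy])
  have hQ' : (Q.map (algebraMap B R)).eval₂ i.toRingHom h = 0 := by
    rw [Polynomial.eval₂_map]
    convert hQ using 2
    ext b; exact hi1 b
  refine int_mem (R := R) i.toRingHom hii h (algebraMap B R b0) (algebraMap B R b1) ?_ ?_ _ hQ' ?_
  · exact fun h => hb1 (hinjBR (by rw [h, map_zero]))
  · show h * i _ = i _
    rw [hi1, hi1, hb]
  · rw [Polynomial.leadingCoeff_map_of_injective hinjBR, hQl]
    exact IsLocalization.map_units R (⟨P.coeff 0, hn⟩ : n.primeCompl)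

lemma alg_blow {B L : Type} [CommRing B] [IsDomain B] [Algebra k B] [Algebra.FiniteType k B] [Field L] [Algebra k L]
    (ψ : B →ₐ[k] L) (hψ : Function.Injective ψ) (n : Ideal B) [n.IsMaximal]
    [IsIntegrallyClosed (Localization.AtPrime n)] (h : L) (h0 : h ≠ 0) (b0 b1 : B) (hb1 : b1 ≠ 0) (hb : h * ψ b1 = ψ b0)
    (hh : h ∉ (liftP n ψ (fun b hb => inj_unit ψ hψ n b hb)).range) :
    ∃ (B' : Type) (_ : CommRing B') (_ : IsDomain B') (_ : Algebra k B') (_ : Algebra.FiniteType k B')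
      (α : B →ₐ[k] B') (j : B' →ₐ[k] L) (v : B') (N : Ideal B'), Function.Injective j ∧ j.comp α = ψ ∧ j v = h⁻¹ ∧
        N.IsMaximal ∧ v ∈ N ∧ ∀ x ∈ n, α x ∈ N := by
  let _ : Algebra B L := ψ.toRingHom.toAlgebra
  have : IsScalarTower k B L := IsScalarTower.of_algebraMap_eq (fun x => (ψ.commutes x).symm)
  let Ev : Polynomial B →ₐ[k] L := (Polynomial.aeval (R := B) h⁻¹).restrictScalars k
  let J : Ideal (Polynomial B) := n.comap (Polynomial.constantCoeff (R := B))
  have hJ : J.IsMaximal := Ideal.comap_isMaximal_of_surjective _ Polynomial.constantCoeff_surjective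
  have hker : RingHom.ker Ev.rangeRestrict ≤ J := by
    intro P hP
    show P.coeff 0 ∈ n
    apply alg_coeff ψ hψ n h h0 b0 b1 hb1 hb hh P
    have := congrArg Subtype.val (RingHom.mem_ker.mp hP)
    exact this
  have hsurj : Function.Surjective Ev.rangeRestrict := Ev.rangeRestrict_surjective
  refine ⟨Ev.range, inferInstance, inferInstance, inferInstance, ?_, Ev.rangeRestrict.comp (Algebra.algHom k B (Polynomial B)), Ev.range.val, Ev.rangeRestrict Polynomial.X,
    J.map Ev.rangeRestrict.toRingHom, Subtype.val_injective, ?_, ?_, ?_, ?_, ?_⟩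
  · exact Algebra.FiniteType.of_surjective Ev.rangeRestrict hsurj
  · ext b
    show Ev (Polynomial.C b) = ψ b
    show Polynomial.aeval h⁻¹ (Polynomial.C b) = _
    rw [Polynomial.aeval_C]; rfl
  · show Polynomial.aeval h⁻¹ (Polynomial.X) = _
    rw [Polynomial.aeval_X]
  · exact Ideal.IsMaximal.map_of_surjective_of_ker_le hsurj hker
  · apply Ideal.mem_map_of_mem
    show Polynomial.coeff Polynomial.X 0 ∈ n
    simp
  · intro x hx
    apply Ideal.mem_map_of_mem
    show Polynomial.coeff (Polynomial.C x) 0 ∈ n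
    simpa using hx
end Glue
end

end

section
open CategoryTheory AlgebraicGeometry Limits
noncomputable section
namespace Glue
open PtF GrpF Newton
variable {k : Type} [Field k]

lemma cc_of_kill [IsAlgClosed k] {B : Type} [CommRing B] [Algebra k B] [Algebra.FiniteType k B] (n : Ideal B) [n.IsMaximal]
    (κ0 κ1 : B →ₐ[k] PS k) (h0 : ∀ v ∈ n, PowerSeries.constantCoeff (κ0 v) = 0)
    (h1 : ∀ v ∈ n, PowerSeries.constantCoeff (κ1 v) = 0) : (cc k k).comp κ0 = (cc k k).comp κ1 := by
  obtain ⟨χ, hχ⟩ := CurveSel.exists_hom_of_max (k := k) n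
  have key : ∀ κ : B →ₐ[k] PS k, (∀ v ∈ n, PowerSeries.constantCoeff (κ v) = 0) → (cc k k).comp κ = χ := by
    intro κ h
    ext x
    have hx : x - algebraMap k B (χ x) ∈ n := by
      rw [← hχ, RingHom.mem_ker, map_sub, AlgHom.commutes]; simp
    have h2 : (cc k k).comp κ (x - algebraMap k B (χ x)) = 0 := h _ hx
    rw [map_sub, AlgHom.commutes, sub_eq_zero] at h2
    exact h2
  rw [key κ0 h0, key κ1 h1]

theorem extend_at [IsAlgClosed k] [CharZero k] (Γ : GroupScheme k) {X W : OverR k} (hXf : LocallyOfFiniteType X.hom)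
    (hXp : IsProper X.hom)
    (hF : ∀ ξ : SpO k (KK k) ⟶ X, ∃ y : SpO k k ⟶ X, ξ = sm (Algebra.ofId k (KK k)) ≫ y)
    (w : W ⟶ Γ.G) (hw : IsOpenImmersion w.left) (F : W ⟶ X)
    {B L : Type} [CommRing B] [IsDomain B] [Algebra k B] [Algebra.FiniteType k B] [Field L] [Algebra k L]
    (ι0 : SpO k B ⟶ Γ.G) (hι0 : IsOpenImmersion ι0.left) (ψ : B →ₐ[k] L) (hψ : Function.Injective ψ)
    (e : SpO k L ⟶ W) (he : e ≫ w = sm ψ ≫ ι0) (n : Ideal B) [n.IsMaximal] :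
    ∃ z : SpO k (Localization.AtPrime n) ⟶ X, sm (liftP n ψ (fun b hb => inj_unit ψ hψ n b hb)) ≫ z = e ≫ F := by
  have hXs : IsSeparated X.hom := inferInstance
  -- a basic open set inside W
  have hO : IsOpen (ι0.left ⁻¹' (Set.range w.left)) := hw.base_open.isOpen_range.preimage ι0.left.continuous
  have hm : (sm ψ).left (IsLocalRing.closedPoint L) ∈ ι0.left ⁻¹' (Set.range w.left) := by
    have h2 := congrArg (fun f => f.left (IsLocalRing.closedPoint L)) he
    have h3 : w.left (e.left (IsLocalRing.closedPoint L)) = ι0.left ((sm ψ).left (IsLocalRing.closedPoint L)) := h2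
    exact ⟨_, h3⟩
  obtain ⟨b, hb, -, hbO⟩ := two_basic (R := B) _ hO _ _ hm hm
  have hb0 : b ≠ 0 := by
    rintro rfl
    exact hb (Ideal.zero_mem _)
  obtain ⟨m, hm⟩ := over_lift w hw (sm (loc k B b) ≫ ι0) (by
    rintro _ ⟨y, rfl⟩
    exact hbO ((sm (loc k B b)).left y) ((mem_range_loc (k := k) b _).mp ⟨y, rfl⟩))
  -- arcs
  have arc : ∀ (κ : B →ₐ[k] PS k) (hκ : κ b ≠ 0), (sm (gen κ b hκ) ≫ m) ≫ w = sm (frac k (PS k)) ≫ (sm κ ≫ ι0) := by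
    intro κ hκ
    rw [Category.assoc, hm, smc, smc]
    congr 2
    apply AlgHom.ext; intro x
    exact liftA_algebraMap _ (unit_frac κ b hκ) x
  have lim : ∀ (κ : B →ₐ[k] PS k) (hκ : κ b ≠ 0), ∃ d : SpO k (PS k) ⟶ X, sm (frac k (PS k)) ≫ d = (sm (gen κ b hκ) ≫ m) ≫ F :=
    fun κ hκ => pt_extend hXp (V := PS k) (L := FractionRing (PS k)) _
  obtain ⟨κ0, hκn, hκb⟩ := CurveSel.curve_selection (k := k) n b hb0
  obtain ⟨d0, hd0⟩ := lim κ0 hκb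
  obtain ⟨C, _, _, ι, hC, hι, hxι⟩ := exists_chart hXf ((sm (cc k k) ≫ d0).left (IsLocalRing.closedPoint k))
  obtain ⟨ψ0, hψ0⟩ := lift_local ι hι (sm (cc k k) ≫ d0) hxι
  obtain ⟨χ0, hχ0, -⟩ := lift_field ι hι (cc k k) cc_local d0 ψ0 hψ0.symm
  obtain ⟨h, hh, θ, hθ⟩ := refine_chart ι hι ((frac k (PS k)).comp κ0) b (unit_frac κ0 b hκb) (m ≫ F) ((frac k (PS k)).comp χ0)
    (by
      have := hd0
      rw [← hχ0, smc, Category.assoc] at this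
      exact this.symm)
  have hh0 : h ≠ 0 := by
    rintro rfl; exact hh (map_zero _)
  have hbh : b * h ≠ 0 := mul_ne_zero hb0 hh0
  have hu : IsUnit (ψ (b * h)) := inj_unit ψ hψ ⊥ _ hbh
  have hub : IsUnit (ψ b) := inj_unit ψ hψ ⊥ _ hb0
  obtain ⟨s, hs⟩ := hC.out
  have hgenF : sm ((liftA ψ hu).comp θ) ≫ ι = e ≫ F := by
    rw [← smc, hθ, smc, liftA_beta b h ψ hub hu, ← Category.assoc]
    congr 1
    refine over_mono w hw ?_
    rw [Category.assoc, hm, he, smc]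
    congr 2
    apply AlgHom.ext; intro x
    exact liftA_algebraMap _ hub x
  obtain ⟨χ, hχ⟩ := exists_restrict (liftP n ψ (fun b hb => inj_unit ψ hψ n b hb)) (liftP_inj ψ hψ n) ((liftA ψ hu).comp θ) s hs (by
    intro c hc
    by_contra hnot
    obtain ⟨N, a, ha⟩ := IsLocalization.Away.surj (S := Localization.Away (b * h)) (b * h) (θ c)
    have ha' : (liftA ψ hu).comp θ c * ψ ((b * h) ^ N) = ψ a := by
      have := congrArg (liftA ψ hu) ha
      rw [map_mul, ← map_pow, liftA_algebraMap, liftA_algebraMap] at this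
      exact this
    obtain ⟨q, hq⟩ : ∃ q, q = (liftA ψ hu).comp θ c := ⟨_, rfl⟩
    rw [← hq] at hnot ha'
    have hq0 : q ≠ 0 := by
      rintro rfl
      exact hnot (Subalgebra.zero_mem _)
    obtain ⟨-, hic⟩ := group_local Γ ι0 hι0 n
    obtain ⟨B', _, _, _, _, α, j, v, M, hj, hjα, hv, hM, hvM, hαM⟩ :=
      alg_blow ψ hψ n q hq0 a ((b * h) ^ N) (pow_ne_zero _ hbh) ha' hnot
    have hαinj : Function.Injective α := by
      intro x y hxy
      apply hψ
      rw [← hjα, AlgHom.comp_apply, AlgHom.comp_apply, hxy]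
    have hv0 : v ≠ 0 := by
      rintro rfl
      rw [map_zero] at hv
      exact inv_ne_zero hq0 hv.symm
    obtain ⟨φ, hφM, hφ0⟩ := CurveSel.curve_selection (k := k) M (α (b * h) * v) (mul_ne_zero (fun h => hbh (hαinj (by rw [h, map_zero]))) hv0)
    have hφbh : (φ.comp α) (b * h) ≠ 0 := by
      intro h0; apply hφ0; rw [map_mul]
      have h1 : φ (α (b * h)) = 0 := h0
      rw [h1, zero_mul]
    have hφb : (φ.comp α) b ≠ 0 := by
      intro h0; apply hφbh; rw [map_mul, h0, zero_mul]
    obtain ⟨d1, hd1⟩ := lim (φ.comp α) hφb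
    have hlim := arcs Γ hXf hXs hF w hw F (sm κ0 ≫ ι0) (sm (φ.comp α) ≫ ι0) (by
      rw [smc, smc, cc_of_kill n κ0 (φ.comp α) hκn (fun v hv => hφM _ (hαM v hv))]) _ _ (arc κ0 hκb) (arc (φ.comp α) hφb) d0 d1 hd0 hd1
    rw [← hψ0] at hlim
    obtain ⟨χ1, hχ1, -⟩ := lift_field ι hι (cc k k) cc_local d1 ψ0 hlim.symm
    have e1 : (gen (φ.comp α) (b * h) hφbh).comp θ = (frac k (PS k)).comp χ1 := by
      apply sm_inj; apply chart_mono ι hι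
      rw [← smc, hθ, ← smc χ1, hχ1, hd1, Category.assoc, smc]
      unfold gen
      rw [liftA_beta b h _ (unit_frac (φ.comp α) b hφb)]
    have e2 : χ1 c * φ (α ((b * h) ^ N)) = φ (α a) := by
      have := congrArg (gen (φ.comp α) (b * h) hφbh) ha
      rw [map_mul, ← map_pow] at this
      unfold gen at this
      rw [liftA_algebraMap, liftA_algebraMap] at this
      have e3 := congrArg (fun f => f c) e1
      apply frac_inj (k := k) (PS k)
      rw [map_mul]
      have e4 : liftA ((frac k (PS k)).comp (φ.comp α)) (unit_frac (φ.comp α) (b * h) hφbh) (θ c) = frac k (PS k) (χ1 c) := e3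
      rw [e4] at this
      exact this
    have e5 : α a * v = α ((b * h) ^ N) := by
      apply hj
      have e6 : ∀ x, j (α x) = ψ x := fun x => by rw [← hjα]; rfl
      rw [map_mul, hv, e6, e6, ← ha']
      field_simp
    have e7 : χ1 c * φ v = 1 := by
      have hne : φ (α ((b * h) ^ N)) ≠ 0 := by
        rw [map_pow, map_pow]
        exact pow_ne_zero _ hφbh
      apply mul_right_cancel₀ hne
      calc χ1 c * φ v * φ (α ((b * h) ^ N)) = (χ1 c * φ (α ((b * h) ^ N))) * φ v := by ring
        _ = φ (α a * v) := by rw [e2, map_mul]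
        _ = _ := by rw [e5, one_mul]
    have e8 := congrArg (PowerSeries.constantCoeff (R := k)) e7
    rw [map_mul, hφM v hvM, mul_zero, map_one] at e8
    exact zero_ne_one e8)
  refine ⟨sm χ ≫ ι, ?_⟩
  rw [smc, hχ, hgenF]
end Glue
end

end

section
open CategoryTheory AlgebraicGeometry Limits
noncomputable section
namespace Glue
open PtF GrpF Newton
variable {k : Type} [Field k]

lemma exists_closed {S : OverR k} (hS : LocallyOfFiniteType S.hom) (hne : Nonempty S.left) : ∃ s : S.left, IsClosed {s} := by
  have : JacobsonSpace S.left := LocallyOfFiniteType.jacobsonSpace S.hom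
  obtain ⟨t, ht, ht'⟩ := nonempty_inter_closedPoints (Z := (Set.univ : Set S.left)) Set.univ_nonempty
    isOpen_univ.isLocallyClosed
  exact ⟨t, ht'⟩

lemma dom_chart {S : OverR k} [IrreducibleSpace S.left] {B : Type} [CommRing B] [IsDomain B] [Algebra k B] (ι : SpO k B ⟶ S)
    (hι : IsOpenImmersion ι.left) : IsDominant (sm (frac k B) ≫ ι).left := by
  have h1 := dom_of_inj (k := k) (frac k B) (frac_inj B)
  have h2 : IsDominant ι.left := by
    refine ⟨?_⟩
    have hne : Nonempty (SpO k B).left := (inferInstance : Nonempty (PrimeSpectrum B))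
    exact hι.base_open.isOpen_range.dense (Set.range_nonempty _)
  rw [Over.comp_left]
  infer_instance

theorem forward [IsAlgClosed k] [CharZero k] {X : OverR k} (hXf : LocallyOfFiniteType X.hom) (hXp : IsProper X.hom)
    (hG : IsGroupless k X) (Γ : GroupScheme k) (hΓ : Γ.IsAbelianVariety) (f : Γ.G.left.PartialMap X.left)
    (hf : f.hom ≫ X.hom = f.domain.ι ≫ Γ.G.hom) : IsConstantHom (f.domain.ι ≫ Γ.G.hom) f.hom := by
  have hft := hΓ.1.1
  have hc := hΓ.1.2.2
  have hintg := group_integral Γ hft hc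
  have hXs : IsSeparated X.hom := inferInstance
  have hF := field_const hXf hXp hG.1
  obtain ⟨W, hW⟩ : ∃ W : OverR k, W = Over.mk (f.domain.ι ≫ Γ.G.hom) := ⟨_, rfl⟩
  obtain ⟨w, F, hwo, hne, hfin⟩ : ∃ (w : W ⟶ Γ.G) (F : W ⟶ X), IsOpenImmersion w.left ∧ Nonempty W.left ∧
      (IsConstant F → IsConstantHom (f.domain.ι ≫ Γ.G.hom) f.hom) := by
    subst hW
    refine ⟨Over.homMk f.domain.ι rfl, Over.homMk f.hom hf, ?_, ?_, ?_⟩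
    · show IsOpenImmersion f.domain.ι
      infer_instance
    · obtain ⟨x, hx⟩ := f.dense_domain.nonempty
      exact ⟨⟨x, hx⟩⟩
    · exact fun h => h
  apply hfin
  obtain ⟨s0, hs0⟩ := exists_closed hft ⟨w.left hne.some⟩
  obtain ⟨B, _, _, ι0, hB, hBd, hι0, -⟩ := group_chart Γ hft s0 hs0
  obtain ⟨η, hη⟩ : ∃ η, η = sm (frac k B) ≫ ι0 := ⟨_, rfl⟩
  have hηd : IsDominant η.left := by rw [hη]; exact dom_chart ι0 hι0
  obtain ⟨e, hew, hed⟩ := dominant_lift η hηd w hwo hne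
  obtain ⟨G, hGe⟩ := glue_generic hft inferInstance hXs η hηd (e ≫ F) (by
    intro s hs
    obtain ⟨B', _, _, ι', hB', hBd', hι', hmem⟩ := group_chart Γ hft s hs
    obtain ⟨n, hn, hns⟩ := max_of_closed ι' hι' s hs hmem
    have hne' : Nonempty (SpO k B').left := (inferInstance : Nonempty (PrimeSpectrum B'))
    obtain ⟨e', he', hed'⟩ := dominant_lift η hηd ι' hι' hne'
    obtain ⟨ψ, rfl⟩ := sm_surj e'
    have hψ := inj_of_dom ψ hed'
    obtain ⟨z, hz⟩ := extend_at Γ hXf hXp hF w hwo F ι' hι' ψ hψ e (by rw [hew, he']) n.asIdeal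
    obtain ⟨T, j, F', e'', h1, h2, h3, h4⟩ := spread hXf ι' hι' ψ hψ n z
    exact ⟨T, j, F', e'', h1, hns ▸ h2, by rw [h3, he'], by rw [h4, hz]⟩)
  obtain ⟨y, hy⟩ := hG.2 Γ hΓ G
  have hFG : F = w ≫ G := over_ext hXs (reduced_open w hwo inferInstance) e hed (by rw [← hGe, ← hew, Category.assoc])
  refine ⟨y, ?_⟩
  rw [hFG, Over.comp_left, hy, ← Category.assoc, Over.w]
end Glue
end

end

section
open CategoryTheory AlgebraicGeometry Limits
noncomputable section
namespace Prd
open PtF Glue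
open scoped TensorProduct
variable {k : Type} [Field k]

section red
variable [IsAlgClosed k]
lemma eq_zero_of_homs {A : Type} [CommRing A] [Algebra k A]
    [Algebra.FiniteType k A] [_root_.IsReduced A] (a : A) (h : ∀ φ : A →ₐ[k] k, φ a = 0) : a = 0 := by
  have hJ : IsJacobsonRing A := isJacobsonRing_of_finiteType (A := k)
  have h2 : (⊥ : Ideal A).jacobson = ⊥ := hJ.out (by
    have := Ideal.radical_isRadical (⊥ : Ideal A)
    have h3 : (⊥ : Ideal A).radical = ⊥ := nilradical_eq_zero A
    rwa [h3] at this)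
  have : a ∈ (⊥ : Ideal A).jacobson := by
    rw [Ideal.jacobson, Ideal.mem_sInf]
    rintro n ⟨-, hn⟩
    obtain ⟨φ, hφ⟩ := CurveSel.exists_hom_of_max (k := k) n
    rw [← hφ]
    exact h φ
  rw [h2] at this
  exact this

lemma tensor_reduced (A B : Type) [CommRing A] [CommRing B] [Algebra k A] [Algebra k B]
    [Algebra.FiniteType k A] [_root_.IsReduced A] [_root_.IsReduced B] : _root_.IsReduced (A ⊗[k] B) := by
  constructor
  intro z hz
  let b := Module.Basis.ofVectorSpace k B
  let bb := Algebra.TensorProduct.basis A b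
  have key : ∀ i, bb.repr z i = 0 := by
    intro i
    refine eq_zero_of_homs (k := k) _ fun φ => ?_
    let h : A ⊗[k] B →ₐ[k] B := Algebra.TensorProduct.lift ((Algebra.ofId k B).comp φ) (AlgHom.id k B) (fun _ _ => Commute.all _ _)
    have h0 : h z = 0 := (hz.map h).eq_zero
    have h1 : h z = (bb.repr z).sum (fun i a => φ a • b i) := by
      conv_lhs => rw [← bb.linearCombination_repr z]
      rw [Finsupp.linearCombination_apply, Finsupp.sum, map_sum]
      refine Finset.sum_congr rfl fun j _ => ?_
      simp [bb, Algebra.TensorProduct.basis_apply, h, Algebra.ofId_apply, Algebra.smul_def]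
    have hli := linearIndependent_iff'.mp b.linearIndependent (bb.repr z).support (fun i => φ (bb.repr z i))
      (by rw [← h0, h1]; rfl)
    by_cases hi : i ∈ (bb.repr z).support
    · exact hli i hi
    · rw [Finsupp.notMem_support_iff.mp hi, map_zero]
  have : bb.repr z = 0 := Finsupp.ext key
  simpa using this
end red

/-- the product over the base -/
def PR (X Y : OverR k) : OverR k := Over.mk (pullback.fst X.hom Y.hom ≫ X.hom)
def pr1 (X Y : OverR k) : PR X Y ⟶ X := Over.homMk (pullback.fst X.hom Y.hom) rfl
def pr2 (X Y : OverR k) : PR X Y ⟶ Y := Over.homMk (pullback.snd X.hom Y.hom) pullback.condition.symm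
def prl {X Y T : OverR k} (a : T ⟶ X) (b : T ⟶ Y) : T ⟶ PR X Y :=
  Over.homMk (pullback.lift a.left b.left (by rw [Over.w, Over.w]))
    (by
      show pullback.lift a.left b.left _ ≫ pullback.fst X.hom Y.hom ≫ X.hom = _
      rw [pullback.lift_fst_assoc, Over.w])

lemma prl_pr1 {X Y T : OverR k} (a : T ⟶ X) (b : T ⟶ Y) : prl a b ≫ pr1 X Y = a := by
  ext1; exact pullback.lift_fst _ _ _
lemma prl_pr2 {X Y T : OverR k} (a : T ⟶ X) (b : T ⟶ Y) : prl a b ≫ pr2 X Y = b := by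
  ext1; exact pullback.lift_snd _ _ _
lemma pr_ext {X Y T : OverR k} {f g : T ⟶ PR X Y} (h1 : f ≫ pr1 X Y = g ≫ pr1 X Y) (h2 : f ≫ pr2 X Y = g ≫ pr2 X Y) : f = g := by
  ext1
  exact pullback.hom_ext (congrArg CommaMorphism.left h1) (congrArg CommaMorphism.left h2)
lemma comp_prl {X Y T S : OverR k} (s : S ⟶ T) (a : T ⟶ X) (b : T ⟶ Y) : s ≫ prl a b = prl (s ≫ a) (s ≫ b) :=
  pr_ext (by rw [Category.assoc, prl_pr1, prl_pr1]) (by rw [Category.assoc, prl_pr2, prl_pr2])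

lemma pr_lft {X Y : OverR k} (hX : LocallyOfFiniteType X.hom) (hY : LocallyOfFiniteType Y.hom) :
    LocallyOfFiniteType (PR X Y).hom := by
  show LocallyOfFiniteType (pullback.fst X.hom Y.hom ≫ X.hom)
  infer_instance

section ch
variable {A B : Type} [CommRing A] [CommRing B] [Algebra k A] [Algebra k B]
/-- product chart -/
def pch {X Y : OverR k} (a : SpO k A ⟶ X) (b : SpO k B ⟶ Y) : SpO k (A ⊗[k] B) ⟶ PR X Y :=
  prl (sm Algebra.TensorProduct.includeLeft ≫ a) (sm Algebra.TensorProduct.includeRight ≫ b)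

lemma pch_eq {X Y : OverR k} (a : SpO k A ⟶ X) (b : SpO k B ⟶ Y) : (pch a b).left =
    (pullbackSpecIso k A B).inv ≫ pullback.map _ _ X.hom Y.hom a.left b.left (𝟙 _) 
      (by rw [Category.comp_id, Over.w a]; rfl) (by rw [Category.comp_id, Over.w b]; rfl) := by
  refine pullback.hom_ext ?_ ?_
  · rw [Category.assoc, pullback.map, pullback.lift_fst, pullbackSpecIso_inv_fst_assoc]
    exact congrArg CommaMorphism.left (prl_pr1 _ _)
  · rw [Category.assoc, pullback.map, pullback.lift_snd, pullbackSpecIso_inv_snd_assoc]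
    exact congrArg CommaMorphism.left (prl_pr2 _ _)

lemma pch_open {X Y : OverR k} (a : SpO k A ⟶ X) (b : SpO k B ⟶ Y) (ha : IsOpenImmersion a.left) (hb : IsOpenImmersion b.left) :
    IsOpenImmersion (pch a b).left := by
  rw [pch_eq]
  have h1 : IsOpenImmersion (pullback.map (Spec.map (CommRingCat.ofHom (algebraMap k A))) (Spec.map (CommRingCat.ofHom (algebraMap k B))) X.hom Y.hom a.left b.left (𝟙 _)
      (by rw [Category.comp_id, Over.w a]; rfl) (by rw [Category.comp_id, Over.w b]; rfl)) := by
    infer_instance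
  exact @IsOpenImmersion.comp _ _ _ (pullbackSpecIso k A B).inv _ inferInstance h1

lemma pch_range {X Y : OverR k} (a : SpO k A ⟶ X) (b : SpO k B ⟶ Y) (z : (PR X Y).left) (ha : (pr1 X Y).left z ∈ Set.range a.left)
    (hb : (pr2 X Y).left z ∈ Set.range b.left) : z ∈ Set.range (pch a b).left := by
  rw [pch_eq]
  have := Scheme.Pullback.range_map (Spec.map (CommRingCat.ofHom (algebraMap k A))) (Spec.map (CommRingCat.ofHom (algebraMap k B))) X.hom Y.hom a.left b.left (𝟙 _) 
      (by rw [Category.comp_id, Over.w a]; rfl) (by rw [Category.comp_id, Over.w b]; rfl)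
  have hz : z ∈ Set.range (pullback.map (Spec.map (CommRingCat.ofHom (algebraMap k A))) (Spec.map (CommRingCat.ofHom (algebraMap k B))) X.hom Y.hom a.left b.left (𝟙 _) 
      (by rw [Category.comp_id, Over.w a]; rfl) (by rw [Category.comp_id, Over.w b]; rfl)) := by
    rw [this]
    exact ⟨ha, hb⟩
  obtain ⟨w, hw⟩ := hz
  refine ⟨(pullbackSpecIso k A B).hom w, ?_⟩
  rw [← hw]
  have h4 : (pullbackSpecIso k A B).inv ((pullbackSpecIso k A B).hom w) = w := by
    rw [← Scheme.Hom.comp_apply, Iso.hom_inv_id]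
    rfl
  conv_rhs => rw [← h4]
  exact Scheme.Hom.comp_apply (pullbackSpecIso k A B).inv _ _
end ch

lemma pr_reduced [IsAlgClosed k] {X Y : OverR k} (hX : LocallyOfFiniteType X.hom) (hY : LocallyOfFiniteType Y.hom)
    (hXr : IsReduced X.left) (hYr : IsReduced Y.left) : IsReduced (PR X Y).left := by
  have key : ∀ z : (PR X Y).left, ∃ (S : Scheme.{0}) (j : S ⟶ (PR X Y).left), IsOpenImmersion j ∧ IsReduced S ∧ z ∈ Set.range j := by
    intro z
    obtain ⟨A, _, _, a, hA, ha, ha'⟩ := exists_chart hX ((pr1 X Y).left z)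
    obtain ⟨B, _, _, b, hB, hb, hb'⟩ := exists_chart hY ((pr2 X Y).left z)
    have h1 : _root_.IsReduced A := by
      have := reduced_open a ha hXr
      exact (affine_isReduced_iff (CommRingCat.of A)).mp this
    have h2 : _root_.IsReduced B := by
      have := reduced_open b hb hYr
      exact (affine_isReduced_iff (CommRingCat.of B)).mp this
    have h3 := tensor_reduced (k := k) A B
    exact ⟨_, (pch a b).left, pch_open a b ha hb, (affine_isReduced_iff (CommRingCat.of (A ⊗[k] B))).mpr h3,
      pch_range a b z ha' hb'⟩
  choose S j h1 h2 h3 using key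
  let 𝒰 : (PR X Y).left.OpenCover := Scheme.Cover.mkOfCovers _ S j (fun s => by
        obtain ⟨y, hy⟩ := h3 s
        exact ⟨s, y, hy⟩) h1
  have : ∀ i, IsReduced (𝒰.X i) := h2
  exact IsReduced.of_openCover _ 𝒰
end Prd
end

end

section
open CategoryTheory AlgebraicGeometry Limits
noncomputable section
set_option linter.unusedSectionVars false
namespace Ell
open PtF Glue Prd
open scoped TensorProduct
section basic
variable (k : Type) [Field k]

/-- the curve `y² = x³ + 1` -/
def WC : WeierstrassCurve.Affine k := ⟨0,0,0,0,1⟩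
/-- its affine coordinate ring -/
def BR : Type := (WC k).CoordinateRing
instance : CommRing (BR k) := inferInstanceAs (CommRing (WC k).CoordinateRing)
instance : IsDomain (BR k) := inferInstanceAs (IsDomain (WC k).CoordinateRing)
instance : Algebra k (BR k) := inferInstanceAs (Algebra k (WC k).CoordinateRing)
instance : Algebra.FiniteType k (BR k) := inferInstanceAs (Algebra.FiniteType k (WC k).CoordinateRing)

def bx : BR k := (AdjoinRoot.of (WC k).polynomial Polynomial.X : (WC k).CoordinateRing)
def yy : BR k := (AdjoinRoot.root (WC k).polynomial : (WC k).CoordinateRing)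
end basic
variable {k : Type} [Field k]

lemma poly_eq : (WC k).polynomial = Polynomial.X ^ 2 - Polynomial.C (Polynomial.X ^ 3 + 1) := by
  simp [WeierstrassCurve.Affine.polynomial, WC]

lemma eval_poly {R : Type} [CommRing R] (f : Polynomial k →+* R) (b : R) :
    (WC k).polynomial.eval₂ f b = b ^ 2 - (f Polynomial.X ^ 3 + 1) := by
  rw [poly_eq, Polynomial.eval₂_sub, Polynomial.eval₂_C, Polynomial.eval₂_X_pow, map_add, map_pow, map_one]

lemma eqB : yy k ^ 2 = bx k ^ 3 + 1 := by
  have h := AdjoinRoot.eval₂_root (WC k).polynomial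
  rw [eval_poly] at h
  exact sub_eq_zero.mp h

lemma eval_poly' {R : Type} [CommRing R] [Algebra k R] (a b : R) (h : b ^ 2 = a ^ 3 + 1) :
    (WC k).polynomial.eval₂ (Polynomial.aeval (R := k) a : Polynomial k →+* R) b = 0 := by
  rw [eval_poly]
  show b ^ 2 - (Polynomial.aeval a Polynomial.X ^ 3 + 1) = 0
  rw [Polynomial.aeval_X, h, sub_self]

section
variable {R : Type} [CommRing R] [Algebra k R]
def bhom (a b : R) (h : b ^ 2 = a ^ 3 + 1) : BR k →ₐ[k] R :=
  AdjoinRoot.liftAlgHom (WC k).polynomial (Polynomial.aeval a) b (eval_poly' a b h)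
lemma bhom_x (a b : R) (h : b ^ 2 = a ^ 3 + 1) : bhom (k := k) a b h (bx k) = a := by
  have := AdjoinRoot.liftAlgHom_of (WC k).polynomial (Polynomial.aeval (R := k) a) b (eval_poly' a b h) Polynomial.X
  rw [Polynomial.aeval_X] at this
  exact this
lemma bhom_y (a b : R) (h : b ^ 2 = a ^ 3 + 1) : bhom (k := k) a b h (yy k) = b := 
  AdjoinRoot.liftAlgHom_root (WC k).polynomial (Polynomial.aeval (R := k) a) b (eval_poly' a b h)
lemma bext {φ ψ : BR k →ₐ[k] R} (h1 : φ (bx k) = ψ (bx k)) (h2 : φ (yy k) = ψ (yy k)) : φ = ψ := by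
  refine AlgHom.ext fun z => ?_
  obtain ⟨p, rfl⟩ := AdjoinRoot.mk_surjective (g := (WC k).polynomial) z
  let φ' : (WC k).CoordinateRing →+* R := φ.toRingHom
  let ψ' : (WC k).CoordinateRing →+* R := ψ.toRingHom
  have : φ'.comp (AdjoinRoot.mk (WC k).polynomial) = ψ'.comp (AdjoinRoot.mk (WC k).polynomial) := by
    refine Polynomial.ringHom_ext' (Polynomial.ringHom_ext (fun a => ?_) ?_) ?_
    · exact (φ.commutes a).trans (ψ.commutes a).symm
    · exact h1
    · exact h2
  exact RingHom.congr_fun this p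
lemma beq (φ : BR k →ₐ[k] R) : φ (yy k) ^ 2 = φ (bx k) ^ 3 + 1 := by
  rw [← map_pow, eqB, map_add, map_pow, map_one]
lemma bhom_eta (φ : BR k →ₐ[k] R) : bhom (φ (bx k)) (φ (yy k)) (beq φ) = φ :=
  bext (bhom_x _ _ _) (bhom_y _ _ _)
end

/-- coordinate `x+1` -/
def tt (k : Type) [Field k] : BR k := bx k + 1
lemma map_tt {R : Type} [CommRing R] [Algebra k R] (φ : BR k →ₐ[k] R) : φ (tt k) = φ (bx k) + 1 := by
  rw [tt, map_add, map_one]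
abbrev BT (k : Type) [Field k] := Localization.Away (tt k)
def lc : BR k →ₐ[k] BT k := loc k (BR k) (tt k)

lemma unit_tt : IsUnit (lc (tt k)) := IsLocalization.Away.algebraMap_isUnit (S := BT k) (tt k)

def ti (k : Type) [Field k] : BT k := IsLocalization.Away.invSelf (tt k)
lemma lc_ti : lc (tt k) * ti k = 1 := IsLocalization.Away.mul_invSelf (S := BT k) (tt k)
lemma lc_ti' : (lc (bx k) + 1) * ti k = 1 := by
  have := lc_ti (k := k)
  rwa [map_tt] at this

/-- identity behind translation by the point (-1,0) -/
lemma trans_eq {R : Type} [CommRing R] {x y i : R} (h : y ^ 2 = x ^ 3 + 1) (hi : (x + 1) * i = 1) :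
    (-3 * y * i ^ 2) ^ 2 = (-1 + 3 * i) ^ 3 + 1 := by
  have h1 : x = x * ((x+1)*i) := by rw [hi, mul_one]
  have e : x * i = 1 - i := by linear_combination hi
  have e3 : x ^ 3 * i ^ 3 = (1 - i) ^ 3 := by rw [← mul_pow, e]
  calc (-3 * y * i ^ 2) ^ 2 = 9 * y ^ 2 * i ^ 4 := by ring
    _ = 9 * (x ^ 3 * i ^ 3 * i + i ^ 4) := by rw [h]; ring
    _ = 9 * ((1 - i) ^ 3 * i + i ^ 4) := by rw [e3]
    _ = _ := by ring

def sg0 : BR k →ₐ[k] BT k := bhom (-1 + 3 * ti k) (-3 * lc (yy k) * ti k ^ 2)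
  (trans_eq (beq lc) lc_ti')
lemma sg0_tt : sg0 (tt k) = 3 * ti k := by
  rw [map_tt, sg0, bhom_x]; ring

variable [CharZero k]
lemma three_unit (R : Type) [CommRing R] [Algebra k R] : IsUnit (3 : R) := by
  have : IsUnit (3 : k) := IsUnit.mk0 _ (by norm_num)
  have := this.map (algebraMap k R)
  rwa [map_ofNat] at this
lemma ti_unit : IsUnit (ti k) := IsUnit.of_mul_eq_one (lc (tt k)) (by rw [mul_comm]; exact lc_ti)

lemma sg0_unit : IsUnit (sg0 (tt k)) := by
  rw [sg0_tt]; exact (three_unit (k := k) _).mul ti_unit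

/-- the involution -/
def sg : BT k →ₐ[k] BT k := liftA sg0 sg0_unit
lemma sg_lc (z : BR k) : sg (lc z) = sg0 z := liftA_algebraMap sg0 sg0_unit z

lemma sg_ti : 3 * sg (ti k) = lc (tt k) := by
  have h := congrArg sg (lc_ti (k := k))
  rw [map_mul, sg_lc, sg0_tt, map_one] at h
  calc 3 * sg (ti k) = (lc (tt k) * ti k) * (3 * sg (ti k)) := by rw [lc_ti, one_mul]
    _ = lc (tt k) * (3 * ti k * sg (ti k)) := by ring
    _ = _ := by rw [h, mul_one]

lemma sg_sg : sg.comp sg = AlgHom.id k (BT k) := by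
  refine away_ext fun z => ?_
  have : ((sg.comp sg).comp lc) = lc (k := k) := by
    have h3 := (three_unit (k := k) (BT k))
    refine bext ?_ ?_
    · show sg (sg (lc (bx k))) = _
      rw [sg_lc, sg0, bhom_x, map_add, map_neg, map_one, map_mul, map_ofNat, sg_ti, map_tt]; ring
    · show sg (sg (lc (yy k))) = _
      rw [sg_lc, sg0, bhom_y, map_mul, map_mul, map_pow, map_neg, map_ofNat, sg_lc, sg0, bhom_y]
      refine h3.mul_left_cancel ?_
      have e : 3 * sg (ti k) = lc (tt k) := sg_ti
      have e1 : lc (tt k) * ti k = 1 := lc_ti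
      calc 3 * (-3 * (-3 * lc (yy k) * ti k ^ 2) * sg (ti k) ^ 2) = 3 * (lc (yy k) * ti k ^ 2 * (3 * sg (ti k)) ^ 2) := by ring
        _ = 3 * (lc (yy k) * (lc (tt k) * ti k)^2) := by rw [e]; ring
        _ = _ := by rw [e1]; ring
  exact AlgHom.congr_fun this z

lemma sg0_eq : sg0 = sg.comp (lc (k := k)) := AlgHom.ext fun z => (sg_lc z).symm

/-- the two open immersions of the overlap -/
lemma lc_open : IsOpenImmersion (sm (lc (k := k))).left := GrpF.sm_loc_open (tt k)
lemma sg_iso : IsIso (sm (sg (k := k))).left := by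
  have h : sm (sg (k := k)) ≫ sm sg = 𝟙 _ := by rw [← sm_comp, sg_sg, sm_id]
  have h' := congrArg CommaMorphism.left h
  exact ⟨⟨_, h', h'⟩⟩
lemma sg0_open : IsOpenImmersion (sm (sg0 (k := k))).left := by
  rw [sg0_eq, sm_comp]
  have := sg_iso (k := k)
  have := lc_open (k := k)
  show IsOpenImmersion ((sm sg).left ≫ (sm (lc (k := k))).left)
  infer_instance
lemma sg0_range (p : (SpO k (BT k)).left) : (sm (sg0 (k := k))).left p = (sm (lc (k := k))).left ((sm (sg (k := k))).left p) := by
  rw [sg0_eq, sm_comp]; rfl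
end Ell
end

end

section
open CategoryTheory AlgebraicGeometry Limits
noncomputable section
set_option linter.unusedSectionVars false
namespace Ell
open PtF Glue Prd GrpF

instance span_open {U V W : Scheme.{0}} (f : W ⟶ U) (g : W ⟶ V) [IsOpenImmersion f] [IsOpenImmersion g] :
   ∀ {i j : WidePushoutShape WalkingPair} (h : i ⟶ j), IsOpenImmersion ((span f g).map h) := by
  rintro i j (_ | (_ | _))
  · dsimp; infer_instance
  · show IsOpenImmersion f; infer_instance
  · show IsOpenImmersion g; infer_instance

lemma glue2 {U V W : Scheme.{0}} (f : W ⟶ U) (g : W ⟶ V) [IsOpenImmersion f] [IsOpenImmersion g] :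
    ∃ (E : Scheme.{0}) (i1 : U ⟶ E) (i2 : V ⟶ E), IsOpenImmersion i1 ∧ IsOpenImmersion i2 ∧ f ≫ i1 = g ≫ i2 ∧
      (∀ e : E, (∃ u, i1 u = e) ∨ (∃ v, i2 v = e)) ∧ (∀ u v, i1 u = i2 v → ∃ w, f w = u ∧ g w = v) ∧
      (∀ (S : Scheme.{0}) (a : U ⟶ S) (b : V ⟶ S), f ≫ a = g ≫ b → ∃ c : E ⟶ S, i1 ≫ c = a ∧ i2 ≫ c = b) := by
  let F := span f g
  refine ⟨colimit F, colimit.ι F WalkingSpan.left, colimit.ι F WalkingSpan.right, ?_, ?_, ?_, ?_, ?_, ?_⟩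
  · exact (Scheme.IsLocallyDirected.openCover F).map_prop WalkingSpan.left
  · exact (Scheme.IsLocallyDirected.openCover F).map_prop WalkingSpan.right
  · exact (colimit.w F WalkingSpan.Hom.fst).trans (colimit.w F WalkingSpan.Hom.snd).symm
  · intro e
    obtain ⟨i, x, hx⟩ := Scheme.IsLocallyDirected.ι_jointly_surjective F e
    match i, x, hx with
    | none, x, hx => 
      left
      refine ⟨f x, ?_⟩
      rw [← hx, ← colimit.w F WalkingSpan.Hom.fst]
      rfl
    | some .left, x, hx => exact Or.inl ⟨x, hx⟩
    | some .right, x, hx => exact Or.inr ⟨x, hx⟩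
  · intro u v h
    obtain ⟨i, a, b, x, hx⟩ := (Scheme.IsLocallyDirected.ι_eq_ι_iff F).mp h
    match i, a, b, x, hx with
    | none, a, b, x, hx =>
      obtain rfl : a = WalkingSpan.Hom.fst := Subsingleton.elim _ _
      obtain rfl : b = WalkingSpan.Hom.snd := Subsingleton.elim _ _
      exact ⟨x, hx.1, hx.2⟩
    | some .left, a, b, x, hx => exact nomatch b
    | some .right, a, b, x, hx => exact nomatch a
  · intro S a b h
    exact ⟨pushout.desc a b h, pushout.inl_desc _ _ _, pushout.inr_desc _ _ _⟩

/-- the properties of the glued curve -/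
def EDP {k : Type} [Field k] [CharZero k] (E : OverR k) (c : Bool → (SpO k (BR k) ⟶ E)) : Prop :=
  (∀ i, IsOpenImmersion (c i).left) ∧
  (∀ i, sm (lc (k := k)) ≫ c i = sm (sg0 (k := k)) ≫ c (!i)) ∧
  (∀ e : E.left, ∃ (i : Bool) (u : (SpO k (BR k)).left), (c i).left u = e) ∧
  (∀ (i : Bool) (u v : (SpO k (BR k)).left), (c i).left u = (c (!i)).left v →
    ∃ w : (SpO k (BT k)).left, (sm (lc (k := k))).left w = u)

/-- the glued curve -/
def ED (k : Type) [Field k] [CharZero k] :=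
  {D : Σ E : OverR k, Bool → (SpO k (BR k) ⟶ E) // EDP D.1 D.2}
def ED.E {k : Type} [Field k] [CharZero k] (D : ED k) : OverR k := D.1.1
def ED.c {k : Type} [Field k] [CharZero k] (D : ED k) : Bool → (SpO k (BR k) ⟶ D.E) := D.1.2
lemma ED.prop {k : Type} [Field k] [CharZero k] (D : ED k) : EDP D.E D.c := D.2

section proj
variable {k : Type} [Field k] [CharZero k] (D : ED k)
lemma ED.op : ∀ i, IsOpenImmersion (D.c i).left := D.prop.1
lemma ED.gl : ∀ i, sm (lc (k := k)) ≫ D.c i = sm (sg0 (k := k)) ≫ D.c (!i) := D.prop.2.1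
lemma ED.sur : ∀ e : D.E.left, ∃ (i : Bool) (u : (SpO k (BR k)).left), (D.c i).left u = e := D.prop.2.2.1
lemma ED.ov : ∀ (i : Bool) (u v : (SpO k (BR k)).left), (D.c i).left u = (D.c (!i)).left v →
    ∃ w : (SpO k (BT k)).left, (sm (lc (k := k))).left w = u := D.prop.2.2.2
end proj

variable {k : Type} [Field k] [CharZero k]
lemma exists_ED : Nonempty (ED k) := by
  have := lc_open (k := k)
  have := sg0_open (k := k)
  obtain ⟨E, i1, i2, h1, h2, h3, h4, h5, h6⟩ := glue2 (sm (lc (k := k))).left (sm (sg0 (k := k))).left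
  obtain ⟨s, hs1, hs2⟩ := h6 (SR k) (SpO k (BR k)).hom (SpO k (BR k)).hom (by rw [Over.w, Over.w])
  let EE : OverR k := Over.mk s
  let c : Bool → (SpO k (BR k) ⟶ EE) := fun b => if b then Over.homMk i1 hs1 else Over.homMk i2 hs2
  have e1 : sm lc ≫ c true = sm sg0 ≫ c false := by ext1; exact h3
  refine ⟨⟨⟨EE, c⟩, ?_, ?_, ?_, ?_⟩⟩
  · rintro (_ | _)
    exacts [h2, h1]
  · rintro (_ | _)
    · show sm lc ≫ c false = sm sg0 ≫ c true
      rw [sg0_eq, sm_comp, Category.assoc, e1, ← Category.assoc, ← sm_comp, sg0_eq, ← AlgHom.comp_assoc, sg_sg, AlgHom.id_comp]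
    · exact e1
  · intro e
    rcases h4 e with h | h
    exacts [⟨true, h⟩, ⟨false, h⟩]
  · rintro (_ | _) u v h
    · obtain ⟨w, hw1, hw2⟩ := h5 v u h.symm
      rw [sg0_range] at hw2
      exact ⟨_, hw2⟩
    · obtain ⟨w, hw1, hw2⟩ := h5 u v h
      exact ⟨w, hw1⟩

section mv
variable {R : Type} [CommRing R] [Algebra k R]
/-- change of chart -/
def mv (φ : BR k →ₐ[k] R) (h : IsUnit (φ (tt k))) : BR k →ₐ[k] R := (liftA φ h).comp sg0
lemma liftA_lc (φ : BR k →ₐ[k] R) (h : IsUnit (φ (tt k))) : (liftA φ h).comp lc = φ :=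
  AlgHom.ext fun z => liftA_algebraMap φ h z
lemma liftA_ti (φ : BR k →ₐ[k] R) (h : IsUnit (φ (tt k))) : φ (tt k) * liftA φ h (ti k) = 1 := by
  have := congrArg (liftA φ h) (lc_ti (k := k))
  rw [map_mul, map_one] at this
  rw [← this]
  congr 1
  exact (AlgHom.congr_fun (liftA_lc φ h) (tt k)).symm
lemma mv_tt (φ : BR k →ₐ[k] R) (h : IsUnit (φ (tt k))) : φ (tt k) * mv φ h (tt k) = 3 := by
  show φ (tt k) * liftA φ h (sg0 (tt k)) = 3
  rw [sg0_tt, map_mul, map_ofNat]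
  linear_combination 3 * liftA_ti φ h
lemma mv_x (φ : BR k →ₐ[k] R) (h : IsUnit (φ (tt k))) (i : R) (hi : φ (tt k) * i = 1) : mv φ h (bx k) = -1 + 3 * i := by
  have : mv φ h (bx k) = mv φ h (tt k) - 1 := by rw [map_tt]; ring
  rw [this]
  linear_combination i * mv_tt φ h - (mv φ h (tt k)) * hi
lemma mv_y (φ : BR k →ₐ[k] R) (h : IsUnit (φ (tt k))) (i : R) (hi : φ (tt k) * i = 1) :
    mv φ h (yy k) = -3 * φ (yy k) * i ^ 2 := by
  have e : liftA φ h (ti k) = i := by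
    refine h.mul_left_cancel ?_
    rw [liftA_ti, hi]
  show liftA φ h (sg0 (yy k)) = _
  rw [sg0, bhom_y, map_mul, map_mul, map_pow, map_neg, map_ofNat, e]
  congr 2
  exact (AlgHom.congr_fun (liftA_lc φ h) (yy k))
lemma ED.move (D : ED k) (i : Bool) (φ : BR k →ₐ[k] R) (h : IsUnit (φ (tt k))) : sm φ ≫ D.c i = sm (mv φ h) ≫ D.c (!i) := by
  conv_lhs => rw [← liftA_lc φ h]
  rw [sm_comp, Category.assoc, D.gl, mv, sm_comp, Category.assoc]
lemma ED.inj (D : ED k) (i : Bool) {φ ψ : BR k →ₐ[k] R} (h : sm φ ≫ D.c i = sm ψ ≫ D.c i) : φ = ψ :=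
  sm_inj (chart_mono _ (D.op i) h)
end mv

lemma ED.meet (D : ED k) (i : Bool) {L : Type} [Field L] [Algebra k L] {φ ψ : BR k →ₐ[k] L}
    (h : sm φ ≫ D.c i = sm ψ ≫ D.c (!i)) : ∃ h : IsUnit (φ (tt k)), ψ = mv φ h := by
  have h1 := congrArg (fun f => f (IsLocalRing.closedPoint L)) (congrArg CommaMorphism.left h)
  have h2 : (D.c i).left ((sm φ).left (IsLocalRing.closedPoint L)) = (D.c (!i)).left ((sm ψ).left (IsLocalRing.closedPoint L)) := h1
  have h3 := D.ov i _ _ h2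
  have h4 := (GrpF.mem_range_loc (k := k) (tt k) _).mp h3
  have h5 : IsUnit (φ (tt k)) := by
    refine IsUnit.mk0 _ fun h0 => h4 ?_
    show φ (tt k) ∈ (IsLocalRing.closedPoint L).asIdeal
    rw [h0]; exact Ideal.zero_mem _
  refine ⟨h5, ?_⟩
  rw [D.move i φ h5] at h
  exact (D.inj _ h).symm

lemma ED.atLocal (D : ED k) {R : Type} [CommRing R] [IsLocalRing R] [Algebra k R] (z : SpO k R ⟶ D.E) :
    ∃ i φ, sm φ ≫ D.c i = z := by
  obtain ⟨i, u, hu⟩ := D.sur (z.left (IsLocalRing.closedPoint R))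
  exact ⟨i, lift_local _ (D.op i) z ⟨u, hu⟩⟩

lemma ED.ex (D : ED k) {V L : Type} [CommRing V] [IsDomain V] [ValuationRing V]
    [Field L] [Algebra V L] [IsFractionRing V L] [Algebra k V] [Algebra k L] [IsScalarTower k V L]
    (ξ : SpO k L ⟶ D.E) : ∃ z : SpO k V ⟶ D.E, sm (IsScalarTower.toAlgHom k V L) ≫ z = ξ := by
  have key : ∀ i (φ : BR k →ₐ[k] L) (v : V), algebraMap V L v = φ (bx k) → ∃ z : SpO k V ⟶ D.E,
      sm (IsScalarTower.toAlgHom k V L) ≫ z = sm φ ≫ D.c i := by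
    intro i φ v hv
    have hintg : IsIntegral V (φ (yy k)) := by
      refine IsIntegral.of_pow (n := 2) (by norm_num) ?_
      rw [beq, ← hv, ← map_pow, ← map_one (algebraMap V L), ← map_add]
      exact isIntegral_algebraMap
    obtain ⟨w, hw⟩ := IsIntegrallyClosed.isIntegral_iff.mp hintg
    have hvw : w ^ 2 = v ^ 3 + 1 := by
      apply IsFractionRing.injective V L
      rw [map_add, map_pow, map_pow, map_one, hv, hw, beq]
    refine ⟨sm (bhom v w hvw) ≫ D.c i, ?_⟩
    rw [← Category.assoc, ← sm_comp]
    congr 2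
    refine bext ?_ ?_
    · rw [AlgHom.comp_apply, bhom_x, ← hv]; rfl
    · rw [AlgHom.comp_apply, bhom_y, ← hw]; rfl
  obtain ⟨i, φ, rfl⟩ := D.atLocal ξ
  rcases ValuationRing.isInteger_or_isInteger V (φ (tt k)) with ⟨v, hv⟩ | ⟨v, hv⟩
  · refine key i φ (v - 1) ?_
    rw [map_sub, map_one, hv, map_tt]; ring
  · by_cases h0 : φ (tt k) = 0
    · refine key i φ (-1) ?_
      rw [map_tt] at h0
      rw [map_neg, map_one]
      linear_combination -h0
    · rw [D.move i φ (IsUnit.mk0 _ h0)]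
      refine key (!i) _ (-1 + 3 * v) ?_
      rw [mv_x _ _ (φ (tt k))⁻¹ (mul_inv_cancel₀ h0), map_add, map_mul, map_neg, map_one, map_ofNat, hv]

lemma ED.uniq (D : ED k) {V L : Type} [CommRing V] [IsDomain V] [IsLocalRing V]
    [Field L] [Algebra k V] [Algebra k L] (f : V →ₐ[k] L) (hf : Function.Injective f)
    {z z' : SpO k V ⟶ D.E} (h : sm f ≫ z = sm f ≫ z') : z = z' := by
  have key : ∀ i (φ ψ : BR k →ₐ[k] V), sm f ≫ sm φ ≫ D.c i = sm f ≫ sm ψ ≫ D.c i →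
      sm φ ≫ D.c i = sm ψ ≫ D.c i := by
    intro i φ ψ h
    rw [smc, smc] at h
    have := D.inj i h
    congr 2
    refine AlgHom.ext fun z => hf (AlgHom.congr_fun this z)
  obtain ⟨i, φ, rfl⟩ := D.atLocal z
  obtain ⟨j, ψ, rfl⟩ := D.atLocal z'
  by_cases hij : j = i
  · subst hij; exact key _ _ _ h
  · have : j = !i := by cases i <;> cases j <;> simp_all
    subst this
    have h' := h
    rw [smc, smc] at h'
    obtain ⟨h1, h2⟩ := D.meet i h'
    have h3 : φ (tt k) * ψ (tt k) = 3 := by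
      apply hf
      rw [map_mul, map_ofNat, ← mv_tt (f.comp φ) h1, ← h2]; rfl
    have h4 : IsUnit (φ (tt k)) := isUnit_of_mul_isUnit_left (y := ψ (tt k)) (by
      rw [h3]; exact three_unit (k := k) V)
    rw [D.move i φ h4] at h ⊢
    exact key _ _ _ h
end Ell
end

end

section
open CategoryTheory AlgebraicGeometry Limits
noncomputable section
set_option linter.unusedSectionVars false
namespace Ell
open PtF Glue Prd GrpF
variable {k : Type} [Field k] [CharZero k] (D : ED k)

def ED.cov : D.E.left.OpenCover := Scheme.Cover.mkOfCovers Bool (fun _ => (SpO k (BR k)).left) (fun i => (D.c i).left) (fun s => by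
    obtain ⟨i, u, hu⟩ := D.sur s
    exact ⟨i, u, hu⟩) D.op

lemma ED.lft : LocallyOfFiniteType D.E.hom := by
  have hz : IsZariskiLocalAtSource (@LocallyOfFiniteType : MorphismProperty Scheme.{0}) := HasRingHomProperty.instIsZariskiLocalAtSource (Q := RingHom.FiniteType)
  refine (IsZariskiLocalAtSource.iff_of_openCover (P := (@LocallyOfFiniteType : MorphismProperty Scheme.{0})) D.cov).mpr ?_
  intro i
  show LocallyOfFiniteType ((D.c i).left ≫ D.E.hom)
  rw [Over.w]
  exact sp_lft (BR k) inferInstance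

lemma ED.cpt : CompactSpace D.E.left := by
  have : Finite D.cov.I₀ := inferInstanceAs (Finite Bool)
  have : ∀ i, CompactSpace (D.cov.X i) := fun i => inferInstanceAs (CompactSpace (PrimeSpectrum (BR k)))
  exact D.cov.compactSpace

lemma ED.qc : QuasiCompact D.E.hom := by
  have := D.cpt
  exact (quasiCompact_iff_compactSpace (f := D.E.hom)).mpr this

lemma ED.qs : QuasiSeparated D.E.hom := by
  have := D.lft
  have : IsLocallyNoetherian D.E.left := LocallyOfFiniteType.isLocallyNoetherian D.E.hom
  infer_instance

lemma ED.red : IsReduced D.E.left := by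
  have : ∀ i, IsReduced (D.cov.X i) := fun i => sp_reduced (k := k) (BR k)
  exact IsReduced.of_openCover _ D.cov

lemma ED.proper : IsProper D.E.hom := by
  have := D.lft
  have := D.qc
  have := D.qs
  apply IsProper.of_valuativeCriterion
  rw [ValuativeCriterion.iff]
  have tr : ∀ (V L : Type) [CommRing V] [Field L] [Algebra V L] (i₂ : Spec (.of V) ⟶ SR k), 
    ∃ (_ : Algebra k V) (_ : Algebra k L), IsScalarTower k V L ∧ i₂ = Spec.map (CommRingCat.ofHom (algebraMap k V)) := by
    intro V L _ _ _ i₂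
    obtain ⟨φ, rfl⟩ := Spec.map_surjective i₂
    let a1 : Algebra k V := φ.hom.toAlgebra
    let a2 : Algebra k L := ((algebraMap V L).comp φ.hom).toAlgebra
    exact ⟨a1, a2, IsScalarTower.of_algebraMap_eq' rfl, rfl⟩
  constructor
  · rintro ⟨V, L, i₁, i₂, h⟩
    obtain ⟨_, _, _, rfl⟩ := tr V L i₂
    obtain ⟨z, hz⟩ := D.ex (V := V) (L := L) (Over.homMk i₁ (by
      rw [h.w, ← Spec.map_comp, ← CommRingCat.ofHom_comp, ← IsScalarTower.algebraMap_eq]; rfl))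
    exact ⟨⟨⟨z.left, congrArg CommaMorphism.left hz, Over.w z⟩⟩⟩
  · rintro ⟨V, L, i₁, i₂, h⟩
    obtain ⟨_, _, _, rfl⟩ := tr V L i₂
    refine ⟨?_⟩
    rintro ⟨l, h1, h2⟩ ⟨l', h1', h2'⟩
    have : (Over.homMk l h2 : SpO k V ⟶ D.E) = Over.homMk l' h2' := by
      refine D.uniq (IsScalarTower.toAlgHom k V L) (IsFractionRing.injective V L) ?_
      ext1
      exact h1.trans h1'.symm
    have := congrArg CommaMorphism.left this
    ext1
    exact this

lemma ED.conn : ConnectedSpace D.E.left := by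
  have hr : ∀ i, _root_.IsPreconnected (Set.range (D.c i).left) := by
    intro i
    have : IrreducibleSpace (PrimeSpectrum (BR k)) := inferInstance
    have hi : IsPreirreducible (Set.univ : Set (SpO k (BR k)).left) := this.toPreirreducibleSpace.isPreirreducible_univ
    rw [← Set.image_univ]
    exact (hi.image _ (D.c i).left.continuous.continuousOn).isPreconnected
  obtain ⟨φ, hφ⟩ : ∃ φ : BR k →ₐ[k] k, IsUnit (φ (tt k)) :=
    ⟨bhom 0 1 (by norm_num), by rw [map_tt, bhom_x]; simp⟩
  have h := D.move true φ hφ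
  obtain ⟨a⟩ : Nonempty (SpO k k).left := inferInstanceAs (Nonempty (PrimeSpectrum k))
  have h2 : (D.c true).left ((sm φ).left a) = (D.c false).left ((sm (mv φ hφ)).left a) :=
    congrArg (fun z : SpO k k ⟶ D.E => z.left a) h
  have hu := _root_.IsPreconnected.union ((D.c true).left ((sm φ).left a)) (Set.mem_range_self _) (h2 ▸ Set.mem_range_self _) (hr true) (hr false)
  have e : Set.range (D.c true).left ∪ Set.range (D.c false).left = Set.univ := by
    rw [Set.eq_univ_iff_forall]
    intro x
    obtain ⟨i, u, hu⟩ := D.sur x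
    cases i
    · exact Or.inr ⟨u, hu⟩
    · exact Or.inl ⟨u, hu⟩
  rw [e] at hu
  have : PreconnectedSpace D.E.left := ⟨hu⟩
  exact ⟨⟨(D.c true).left ((sm φ).left a)⟩⟩
end Ell
end

end

section
open CategoryTheory AlgebraicGeometry Limits
noncomputable section
set_option linter.unusedSectionVars false
namespace Ell
open PtF Glue Prd GrpF
variable {k : Type} [Field k] [CharZero k]

instance decEqPt : DecidableEq k := Classical.decEq k

lemma wc_eq (x y : k) : (WC k).Equation x y ↔ y ^ 2 = x ^ 3 + 1 := by
  rw [WeierstrassCurve.Affine.equation_iff]; simp [WC]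

lemma wc_ns {x y : k} (h : y ^ 2 = x ^ 3 + 1) : (WC k).Nonsingular x y := by
  rw [WeierstrassCurve.Affine.nonsingular_iff']
  refine ⟨(wc_eq x y).mpr h, ?_⟩
  by_contra hc
  simp only [WC, not_or, not_not] at hc
  obtain ⟨h1, h2⟩ := hc
  have hx : x = 0 := by
    have : 3 * x ^ 2 = 0 := by linear_combination -h1
    simpa using this
  have hy : y = 0 := by
    have : 2 * y = 0 := by linear_combination h2
    simpa using this
  rw [hx, hy] at h
  norm_num at h

def pt (x y : k) (h : y ^ 2 = x ^ 3 + 1) : (WC k).Point := .some x y (wc_ns h)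

lemma pt_congr {x y x' y' : k} {h : y ^ 2 = x ^ 3 + 1} {h' : y' ^ 2 = x' ^ 3 + 1} (h1 : x = x') (h2 : y = y') :
    pt x y h = pt x' y' h' := by subst h1 h2; rfl

lemma wc_negY (x y : k) : (WC k).negY x y = -y := by simp [WeierstrassCurve.Affine.negY, WC]

lemma neg_pt {x y : k} {h : y ^ 2 = x ^ 3 + 1} : - pt x y h = pt x (-y) (by rw [neg_sq, h]) := by
  rw [pt, WeierstrassCurve.Affine.Point.neg_some]
  unfold pt
  congr 1
  exact wc_negY x y

lemma addp {x1 y1 x2 y2 l x3 y3 : k} {h1 : y1 ^ 2 = x1 ^ 3 + 1} {h2 : y2 ^ 2 = x2 ^ 3 + 1}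
    (hn : ¬ (x1 = x2 ∧ y1 = - y2)) (l1 : l * (x1 - x2) = y1 - y2) (l2 : l * (y1 + y2) = x1 ^ 2 + x1 * x2 + x2 ^ 2)
    (hx : x3 = l ^ 2 - x1 - x2) (hy : y3 = - (y1 + l * (x3 - x1))) :
    ∃ h3 : y3 ^ 2 = x3 ^ 3 + 1, pt x1 y1 h1 + pt x2 y2 h2 = pt x3 y3 h3 := by
  have hn' : ¬ (x1 = x2 ∧ y1 = (WC k).negY x2 y2) := by rwa [wc_negY]
  have hs : (WC k).slope x1 x2 y1 y2 = l := by
    by_cases hx : x1 = x2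
    · have hy : y1 ≠ (WC k).negY x2 y2 := fun h => hn' ⟨hx, h⟩
      rw [WeierstrassCurve.Affine.slope_of_Y_ne hx hy]
      rw [wc_negY] at hy ⊢
      subst hx
      have : y1 = y2 := by linear_combination -l1
      subst this
      rw [div_eq_iff (by intro h; apply hy; linear_combination h)]
      simp [WC]
      linear_combination -l2
    · rw [WeierstrassCurve.Affine.slope_of_X_ne hx, div_eq_iff (sub_ne_zero.mpr hx), l1]
  have h := WeierstrassCurve.Affine.Point.add_some hn' (h₁ := wc_ns h1) (h₂ := wc_ns h2)
  have ex : (WC k).addX x1 x2 ((WC k).slope x1 x2 y1 y2) = x3 := by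
    rw [hs, hx]; simp [WeierstrassCurve.Affine.addX, WC]
  have ey : (WC k).addY x1 x2 y1 ((WC k).slope x1 x2 y1 y2) = y3 := by
    rw [WeierstrassCurve.Affine.addY, WeierstrassCurve.Affine.negAddY, wc_negY, ex, hs, hy]; ring
  have hns := WeierstrassCurve.Affine.nonsingular_add (wc_ns h1) (wc_ns h2) hn'
  rw [ex, ey] at hns
  refine ⟨(wc_eq _ _).mp hns.1, ?_⟩
  unfold pt
  rw [h]
  congr 1

lemma addz {x1 y1 x2 y2 : k} {h1 : y1 ^ 2 = x1 ^ 3 + 1} {h2 : y2 ^ 2 = x2 ^ 3 + 1}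
    (hx : x1 = x2) (hy : y1 = - y2) : pt x1 y1 h1 + pt x2 y2 h2 = 0 :=
  WeierstrassCurve.Affine.Point.add_of_Y_eq hx (by rwa [wc_negY])

/-- the 2-torsion point -/
def TP (k : Type) [Field k] [CharZero k] : (WC k).Point := pt (-1) 0 (by norm_num)
lemma TP_add : TP k + TP k = 0 := addz rfl (by norm_num)

def cP (k : Type) [Field k] [CharZero k] (i : Bool) : (WC k).Point := if i then 0 else TP k
lemma cP_not (i : Bool) : cP k (!i) = cP k i + TP k := by
  cases i <;> simp [cP, TP_add]
lemma cP_neg (i : Bool) : - cP k i = cP k i := by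
  cases i
  · exact neg_eq_of_add_eq_zero_left TP_add
  · exact neg_zero
lemma cP_xor (i j : Bool) : cP k i + cP k j = cP k (i == j) := by
  cases i <;> cases j <;> simp [cP, TP_add]

def pp (φ : BR k →ₐ[k] k) : (WC k).Point := pt (φ (bx k)) (φ (yy k)) (beq φ)

lemma pp_bhom {x y : k} (h : y ^ 2 = x ^ 3 + 1) : pp (bhom x y h) = pt x y h := pt_congr (bhom_x _ _ _) (bhom_y _ _ _)

lemma mv_pp (φ : BR k →ₐ[k] k) (h : IsUnit (φ (tt k))) : pp (mv φ h) = pp φ + TP k := by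
  have hne : φ (bx k) + 1 ≠ 0 := by rw [← map_tt]; exact h.ne_zero
  have hi : φ (tt k) * (φ (bx k) + 1)⁻¹ = 1 := by rw [map_tt]; exact mul_inv_cancel₀ hne
  have e := beq φ
  obtain ⟨h3, e3⟩ := addp (x1 := φ (bx k)) (y1 := φ (yy k)) (x2 := -1) (y2 := 0) (l := φ (yy k) * (φ (bx k) + 1)⁻¹)
    (x3 := mv φ h (bx k)) (y3 := mv φ h (yy k)) (h1 := e) (h2 := by norm_num)
    (by rintro ⟨h1, h2⟩; apply hne; rw [h1]; ring) (by field_simp; ring) (by field_simp; rw [add_zero, ← sq, e]; ring)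
    (by rw [mv_x φ h _ hi]; field_simp; rw [e]; ring)
    (by rw [mv_x φ h _ hi, mv_y φ h _ hi]; field_simp; ring)
  exact e3.symm

variable (D : ED k)
def Ph : (WC k).Point → (SpO k k ⟶ D.E)
  | .zero => sm (bhom (k := k) (-1) 0 (by norm_num)) ≫ D.c false
  | .some x y h => sm (bhom x y ((wc_eq x y).mp h.1)) ≫ D.c true

lemma Ph_zero : Ph D 0 = sm (bhom (k := k) (-1) 0 (by norm_num)) ≫ D.c false := rfl
lemma Ph_pp (φ : BR k →ₐ[k] k) : Ph D (pp φ) = sm φ ≫ D.c true := by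
  show sm (bhom _ _ _) ≫ D.c true = _
  rw [bhom_eta]

lemma Ph_c (i : Bool) (φ : BR k →ₐ[k] k) : sm φ ≫ D.c i = Ph D (pp φ + cP k i) := by
  cases i
  · by_cases h : IsUnit (φ (tt k))
    · rw [D.move false φ h]
      show _ = Ph D (pp φ + TP k)
      rw [← mv_pp φ h, Ph_pp]; rfl
    · have hx : φ (bx k) = -1 := by
        rw [isUnit_iff_ne_zero, not_not, map_tt] at h
        linear_combination h
      have hy : φ (yy k) = 0 := by
        have := beq φ
        rw [hx] at this
        norm_num at this
        exact this
      have e : φ = bhom (k := k) (-1) 0 (by norm_num) := bext (by rw [hx, bhom_x]) (by rw [hy, bhom_y])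
      show _ = Ph D (pp φ + TP k)
      rw [e, pp_bhom]
      exact (congrArg (Ph D) TP_add).symm
  · show _ = Ph D (pp φ + 0)
    rw [add_zero, Ph_pp]

lemma Ph_inj : Function.Injective (Ph D) := by
  have hz : ∀ (x y : k) (h : y ^ 2 = x ^ 3 + 1), sm (bhom (k := k) x y h) ≫ D.c true ≠ sm (bhom (k := k) (-1) 0 (by norm_num)) ≫ D.c false := by
    intro x y h he
    obtain ⟨hu, he⟩ := D.meet true he
    have := mv_tt _ hu
    rw [← he, map_tt (bhom (k := k) (-1) 0 _), bhom_x] at this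
    norm_num at this
  rintro (_ | ⟨x, y, h⟩) (_ | ⟨x', y', h'⟩) he
  · rfl
  · exact absurd he.symm (hz _ _ _)
  · exact absurd he (hz _ _ _)
  · have := D.inj true he
    have h1 := congrArg (fun φ : BR k →ₐ[k] k => φ (bx k)) this
    have h2 := congrArg (fun φ : BR k →ₐ[k] k => φ (yy k)) this
    simp only [bhom_x, bhom_y] at h1 h2
    exact pt_congr (h := (wc_eq _ _).mp h.1) (h' := (wc_eq _ _).mp h'.1) h1 h2

lemma Ph_surj : Function.Surjective (Ph D) := by
  intro z
  obtain ⟨i, φ, rfl⟩ := D.atLocal z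
  exact ⟨_, (Ph_c D i φ).symm⟩

def Pq (z : SpO k k ⟶ D.E) : (WC k).Point := (Ph_surj D z).choose
lemma Ph_Pq (z : SpO k k ⟶ D.E) : Ph D (Pq D z) = z := (Ph_surj D z).choose_spec
lemma Pq_Ph (P : (WC k).Point) : Pq D (Ph D P) = P := Ph_inj D (Ph_Pq D _)
lemma Pq_c (i : Bool) (φ : BR k →ₐ[k] k) : Pq D (sm φ ≫ D.c i) = pp φ + cP k i := by
  rw [Ph_c, Pq_Ph]

/-- addition in the first chart -/
lemma F12 {x1 y1 x2 y2 l : k} {h1 : y1 ^ 2 = x1 ^ 3 + 1} {h2 : y2 ^ 2 = x2 ^ 3 + 1} 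
    (hn : l * (x1 - x2) = y1 - y2 ∧ x1 ≠ x2 ∨ l * (y1 + y2) = x1 ^ 2 + x1 * x2 + x2 ^ 2 ∧ y1 + y2 ≠ 0) {x3 y3 : k} (hx : x3 = l ^ 2 - x1 - x2) (hy : y3 = - (y1 + l * (x3 - x1))) :
    ∃ h3 : y3 ^ 2 = x3 ^ 3 + 1, pt x1 y1 h1 + pt x2 y2 h2 = pt x3 y3 h3 + cP k true := by
  have e : ∀ P, P + cP k true = P := fun P => add_zero P
  simp only [e]
  rcases hn with ⟨l1, hn⟩ | ⟨l2, hn⟩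
  · refine addp (fun h => hn h.1) l1 ?_ hx hy
    apply mul_left_cancel₀ (sub_ne_zero.mpr hn)
    linear_combination (y1 + y2) * l1 + h1 - h2
  · refine addp (fun h => hn (by rw [h.2]; ring)) ?_ l2 hx hy
    apply mul_left_cancel₀ hn
    linear_combination (x1 - x2) * l2 - h1 + h2

lemma F34 {x1 y1 x2 y2 v d : k} {h1 : y1 ^ 2 = x1 ^ 3 + 1} {h2 : y2 ^ 2 = x2 ^ 3 + 1} 
    (hn : v * (y1 - y2) = x1 - x2 ∧ y1 ≠ y2 ∨ v * (x1 ^ 2 + x1 * x2 + x2 ^ 2) = y1 + y2 ∧ x1 ^ 2 + x1 * x2 + x2 ^ 2 ≠ 0)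
    (hd : (1 - v ^ 2 * (x1 + x2 - 1)) * d = 1) {x3 y3 : k}
    (hx : x3 = -1 + 3 * v ^ 2 * d) (hy : y3 = 3 * (y1 * v ^ 4 + v * (1 - v ^ 2 * (2 * x1 + x2))) * d ^ 2) :
    ∃ h3 : y3 ^ 2 = x3 ^ 3 + 1, pt x1 y1 h1 + pt x2 y2 h2 = pt x3 y3 h3 + cP k false := by
  have l12 : v * (y1 - y2) = x1 - x2 ∧ v * (x1 ^ 2 + x1 * x2 + x2 ^ 2) = y1 + y2 := by
    rcases hn with ⟨l1, hn⟩ | ⟨l2, hn⟩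
    · refine ⟨l1, ?_⟩
      apply mul_left_cancel₀ (sub_ne_zero.mpr hn)
      linear_combination (x1 ^ 2 + x1 * x2 + x2 ^ 2) * l1 - h1 + h2
    · refine ⟨?_, l2⟩
      apply mul_left_cancel₀ hn
      linear_combination (y1 - y2) * l2 + h1 - h2
  obtain ⟨l1, l2⟩ := l12
  by_cases hv : v = 0
  · subst hv
    have hx1 : x1 = x2 := by linear_combination -l1
    have hy1 : y1 = -y2 := by linear_combination -l2
    have hx3 : x3 = -1 := by rw [hx]; ring
    have hy3 : y3 = 0 := by rw [hy]; ring
    subst hx3 hy3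
    refine ⟨by norm_num, ?_⟩
    rw [addz hx1 hy1]
    exact TP_add.symm
  · have hd0 : d ≠ 0 := by rintro rfl; simp at hd
    have hD0 : 1 - v ^ 2 * (x1 + x2 - 1) ≠ 0 := by intro h; rw [h, zero_mul] at hd; exact zero_ne_one hd
    have hne : ¬ (x1 = x2 ∧ y1 = - y2) := by
      rintro ⟨rfl, rfl⟩
      rcases hn with ⟨_, hn⟩ | ⟨_, hn⟩
      · have : v * (-y2 - y2) = 0 := by rw [l1, sub_self]
        rcases mul_eq_zero.mp this with h | h
        · exact hv h
        · exact hn (by linear_combination h)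
      · have : v * (x1 ^ 2 + x1 * x1 + x1 ^ 2) = 0 := by rw [l2]; ring
        rcases mul_eq_zero.mp this with h | h
        · exact hv h
        · exact hn h
    obtain ⟨h3, e3⟩ := addp (h1 := h1) (h2 := h2) (l := v⁻¹) hne (by rw [← l1]; field_simp) (by rw [← l2]; field_simp) rfl rfl
    obtain ⟨X, hX⟩ : ∃ X, X = (v⁻¹) ^ 2 - x1 - x2 := ⟨_, rfl⟩
    obtain ⟨Y, hY⟩ : ∃ Y, Y = -(y1 + v⁻¹ * (X - x1)) := ⟨_, rfl⟩
    have hX1 : (X + 1) * (v ^ 2 * d) = 1 := by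
      refine Eq.trans ?_ hd
      rw [hX]; field_simp; ring
    subst hX hY
    have hu : IsUnit (bhom (k := k) _ _ h3 (tt k)) := by
      rw [map_tt, bhom_x]
      exact IsUnit.of_mul_eq_one _ hX1
    have hi : bhom (k := k) _ _ h3 (tt k) * (v ^ 2 * d) = 1 := by rw [map_tt, bhom_x]; exact hX1
    have e := mv_pp _ hu
    have e1 := mv_x _ hu _ hi
    have e2 := mv_y _ hu _ hi
    rw [bhom_y] at e2
    have hx' : mv _ hu (bx k) = x3 := by rw [e1, hx]; ring
    have hy' : mv _ hu (yy k) = y3 := by rw [e2, hy]; field_simp; ring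
    have hb := beq (mv _ hu)
    rw [hx', hy'] at hb
    refine ⟨hb, ?_⟩
    rw [e3, ← pp_bhom, ← pp_bhom hb]
    have : bhom x3 y3 hb = mv _ hu := bext (by rw [hx', bhom_x]) (by rw [hy', bhom_y])
    rw [this, e, add_assoc]
    show _ = _ + (TP k + TP k)
    rw [TP_add, add_zero]
end Ell
end

end

section
open CategoryTheory AlgebraicGeometry Limits
noncomputable section
set_option linter.unusedSectionVars false
namespace Ell
open PtF Glue Prd GrpF
open scoped TensorProduct
variable {k : Type} [Field k] [CharZero k] [IsAlgClosed k]

section form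
variable {A : Type} [CommRing A] [Algebra k A] [Algebra.FiniteType k A] [_root_.IsReduced A] (i1 i2 : BR k →ₐ[k] A)

lemma mkT (g : A) (i : Bool) (x3 y3 : Localization.Away g) 
    (H : ∀ ψ : Localization.Away g →ₐ[k] k, ∃ h3 : (ψ y3) ^ 2 = (ψ x3) ^ 3 + 1, 
      pp ((ψ.comp (loc k A g)).comp i1) + pp ((ψ.comp (loc k A g)).comp i2) = pt (ψ x3) (ψ y3) h3 + cP k i) :
    ∃ T : BR k →ₐ[k] Localization.Away g, ∀ ψ : Localization.Away g →ₐ[k] k, 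
      pp ((ψ.comp (loc k A g)).comp i1) + pp ((ψ.comp (loc k A g)).comp i2) = pp (ψ.comp T) + cP k i := by
  have : Algebra.FiniteType A (Localization.Away g) := IsLocalization.finiteType_of_monoid_fg (Submonoid.powers g) _
  have : Algebra.FiniteType k (Localization.Away g) := Algebra.FiniteType.trans (S := A) inferInstance inferInstance
  have : _root_.IsReduced (Localization.Away g) := inferInstance
  have e : y3 ^ 2 = x3 ^ 3 + 1 := by
    rw [← sub_eq_zero]
    refine eq_zero_of_homs (k := k) _ fun ψ => ?_
    obtain ⟨h, _⟩ := H ψ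
    simp only [map_sub, map_add, map_pow, map_one]
    rw [h, sub_self]
  refine ⟨bhom x3 y3 e, fun ψ => ?_⟩
  obtain ⟨h, h'⟩ := H ψ
  rw [h']
  congr 1
  refine pt_congr ?_ ?_
  · exact congrArg ψ (bhom_x x3 y3 e).symm
  · exact congrArg ψ (bhom_y x3 y3 e).symm

/-- the four formulas -/
lemma form (θ : A →ₐ[k] k) : ∃ (g : A) (i : Bool) (T : BR k →ₐ[k] Localization.Away g), θ g ≠ 0 ∧
    ∀ ψ : Localization.Away g →ₐ[k] k, 
      pp ((ψ.comp (loc k A g)).comp i1) + pp ((ψ.comp (loc k A g)).comp i2) = pp (ψ.comp T) + cP k i := by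
  obtain ⟨x1, hx1⟩ : ∃ x, x = i1 (bx k) := ⟨_, rfl⟩
  obtain ⟨y1, hy1⟩ : ∃ x, x = i1 (yy k) := ⟨_, rfl⟩
  obtain ⟨x2, hx2⟩ : ∃ x, x = i2 (bx k) := ⟨_, rfl⟩
  obtain ⟨y2, hy2⟩ : ∃ x, x = i2 (yy k) := ⟨_, rfl⟩
  have s1 : ∀ (g : A) (l : Localization.Away g), (∀ ψ : Localization.Away g →ₐ[k] k,
      (ψ l * (ψ (loc k A g x1) - ψ (loc k A g x2)) = ψ (loc k A g y1) - ψ (loc k A g y2) ∧ ψ (loc k A g x1) ≠ ψ (loc k A g x2) ∨ 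
       ψ l * (ψ (loc k A g y1) + ψ (loc k A g y2)) = ψ (loc k A g x1) ^ 2 + ψ (loc k A g x1) * ψ (loc k A g x2) + ψ (loc k A g x2) ^ 2 ∧
         ψ (loc k A g y1) + ψ (loc k A g y2) ≠ 0)) → ∃ (i : Bool) (T : BR k →ₐ[k] Localization.Away g), 
    ∀ ψ : Localization.Away g →ₐ[k] k, 
      pp ((ψ.comp (loc k A g)).comp i1) + pp ((ψ.comp (loc k A g)).comp i2) = pp (ψ.comp T) + cP k i := by
    intro g l h
    refine ⟨true, mkT i1 i2 g true (l ^ 2 - loc k A g x1 - loc k A g x2) (- (loc k A g y1 + l * ((l ^ 2 - loc k A g x1 - loc k A g x2) - loc k A g x1))) ?_⟩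
    intro ψ
    have h := h ψ
    subst hx1 hx2 hy1 hy2
    exact F12 h (by simp only [map_sub, map_pow]) (by simp only [map_sub, map_pow, map_neg, map_add, map_mul])
  have s2 : ∀ (g : A) (v d : Localization.Away g), (∀ ψ : Localization.Away g →ₐ[k] k,
      (ψ v * (ψ (loc k A g y1) - ψ (loc k A g y2)) = ψ (loc k A g x1) - ψ (loc k A g x2) ∧ ψ (loc k A g y1) ≠ ψ (loc k A g y2) ∨ 
       ψ v * (ψ (loc k A g x1) ^ 2 + ψ (loc k A g x1) * ψ (loc k A g x2) + ψ (loc k A g x2) ^ 2) = 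
         ψ (loc k A g y1) + ψ (loc k A g y2) ∧ ψ (loc k A g x1) ^ 2 + ψ (loc k A g x1) * ψ (loc k A g x2) + ψ (loc k A g x2) ^ 2 ≠ 0) ∧
         (1 - ψ v ^ 2 * (ψ (loc k A g x1) + ψ (loc k A g x2) - 1)) * ψ d = 1) → ∃ (i : Bool) (T : BR k →ₐ[k] Localization.Away g), 
    ∀ ψ : Localization.Away g →ₐ[k] k, 
      pp ((ψ.comp (loc k A g)).comp i1) + pp ((ψ.comp (loc k A g)).comp i2) = pp (ψ.comp T) + cP k i := by
    intro g v d h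
    refine ⟨false, mkT i1 i2 g false (-1 + 3 * v ^ 2 * d) (3 * (loc k A g y1 * v ^ 4 + v * (1 - v ^ 2 * (2 * loc k A g x1 + loc k A g x2))) * d ^ 2) ?_⟩
    intro ψ
    have h := h ψ
    subst hx1 hx2 hy1 hy2
    exact F34 h.1 h.2 (by simp only [map_add, map_neg, map_one, map_mul, map_pow, map_ofNat]) (by simp only [map_add, map_sub, map_neg, map_one, map_mul, map_pow, map_ofNat])
  have inv : ∀ (g : A), ∃ gi : Localization.Away g, ∀ ψ : Localization.Away g →ₐ[k] k, ψ (loc k A g g) * ψ gi = 1 := by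
    intro g
    refine ⟨IsLocalization.Away.invSelf g, fun ψ => ?_⟩
    have := IsLocalization.Away.mul_invSelf (S := Localization.Away g) g
    rw [← map_mul]
    exact (congrArg ψ this).trans (map_one ψ)
  have e1 : (θ y1) ^ 2 = (θ x1) ^ 3 + 1 := by subst hx1 hy1; exact beq (θ.comp i1)
  have e2 : (θ y2) ^ 2 = (θ x2) ^ 3 + 1 := by subst hx2 hy2; exact beq (θ.comp i2)
  by_cases c1 : θ x1 = θ x2
  · by_cases c2 : θ y1 + θ y2 = 0
    · by_cases c3 : θ y1 = θ y2
      · -- second type, case y = 0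
        have hy0 : θ y1 = 0 := by
          have : 2 * θ y1 = 0 := by linear_combination c2 + c3
          simpa using this
        have hx0 : θ x1 ≠ 0 := by
          intro h; rw [h, hy0] at e1; norm_num at e1
        obtain ⟨g1, hg1⟩ : ∃ g, g = x1 ^ 2 + x1 * x2 + x2 ^ 2 := ⟨_, rfl⟩
        obtain ⟨g2, hg2⟩ : ∃ g, g = g1 ^ 2 - (y1 + y2) ^ 2 * (x1 + x2 - 1) := ⟨_, rfl⟩
        obtain ⟨gi, hgi⟩ := inv (g1 * g2)
        obtain ⟨i, T, h⟩ := s2 (g1 * g2) (loc k A _ ((y1 + y2) * g2) * gi) (loc k A _ (g1 ^ 3) * gi) (by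
          intro ψ
          have h := hgi ψ
          have hq : ψ (loc k A (g1 * g2) g1) = ψ (loc k A (g1 * g2) x1) ^ 2 + ψ (loc k A (g1 * g2) x1) * ψ (loc k A (g1 * g2) x2) + ψ (loc k A (g1 * g2) x2) ^ 2 := by
            refine (congrArg (fun z => ψ (loc k A (g1 * g2) z)) hg1).trans ?_
            simp only [map_add, map_mul, map_pow]
          have hq2 : ψ (loc k A (g1 * g2) g2) = ψ (loc k A (g1 * g2) g1) ^ 2 - (ψ (loc k A (g1 * g2) y1) + ψ (loc k A (g1 * g2) y2)) ^ 2 * (ψ (loc k A (g1 * g2) x1) + ψ (loc k A (g1 * g2) x2) - 1) := by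
            refine (congrArg (fun z => ψ (loc k A (g1 * g2) z)) hg2).trans ?_
            simp only [map_add, map_mul, map_pow, map_sub, map_one]
          simp only [map_mul, map_add, map_pow] at h ⊢
          rw [← hq]
          generalize ψ (loc k A (g1 * g2) g1) = G1 at *
          generalize ψ (loc k A (g1 * g2) g2) = G2 at *
          generalize ψ (loc k A (g1 * g2) x1) = X1 at *
          generalize ψ (loc k A (g1 * g2) x2) = X2 at *
          generalize ψ (loc k A (g1 * g2) y1) = Y1 at *
          generalize ψ (loc k A (g1 * g2) y2) = Y2 at *
          generalize ψ gi = I at *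
          refine ⟨Or.inr ⟨?_, ?_⟩, ?_⟩
          · linear_combination (Y1 + Y2) * h
          · rintro rfl; simp at h
          · have e : G1 * G2 * I = 1 := h
            have hG2 : G2 ≠ 0 := by intro h'; rw [h'] at e; simp at e
            have hG1 : G1 ≠ 0 := by intro h'; rw [h'] at e; simp at e
            have hI : I = (G1 * G2)⁻¹ := eq_inv_of_mul_eq_one_right e
            rw [hI]; field_simp; linear_combination -hq2)
        refine ⟨_, i, T, ?_, h⟩
        rw [hg2, hg1, map_mul]
        simp only [map_add, map_sub, map_mul, map_pow, map_one]
        rw [c2, ← c1]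
        have : θ x1 ^ 2 + θ x1 * θ x1 + θ x1 ^ 2 ≠ 0 := by
          rw [show θ x1 ^ 2 + θ x1 * θ x1 + θ x1 ^ 2 = 3 * θ x1 ^ 2 by ring]
          exact mul_ne_zero (by norm_num) (pow_ne_zero _ hx0)
        simpa using this
      · obtain ⟨g1, hg1⟩ : ∃ g, g = y1 - y2 := ⟨_, rfl⟩
        obtain ⟨g2, hg2⟩ : ∃ g, g = g1 ^ 2 - (x1 - x2) ^ 2 * (x1 + x2 - 1) := ⟨_, rfl⟩
        obtain ⟨gi, hgi⟩ := inv (g1 * g2)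
        obtain ⟨i, T, h⟩ := s2 (g1 * g2) (loc k A _ ((x1 - x2) * g2) * gi) (loc k A _ (g1 ^ 3) * gi) (by
          intro ψ
          have h := hgi ψ
          have hq : ψ (loc k A (g1 * g2) g1) = ψ (loc k A (g1 * g2) y1) - ψ (loc k A (g1 * g2) y2) := by
            refine (congrArg (fun z => ψ (loc k A (g1 * g2) z)) hg1).trans ?_
            simp only [map_sub]
          have hq2 : ψ (loc k A (g1 * g2) g2) = ψ (loc k A (g1 * g2) g1) ^ 2 - (ψ (loc k A (g1 * g2) x1) - ψ (loc k A (g1 * g2) x2)) ^ 2 * (ψ (loc k A (g1 * g2) x1) + ψ (loc k A (g1 * g2) x2) - 1) := by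
            refine (congrArg (fun z => ψ (loc k A (g1 * g2) z)) hg2).trans ?_
            simp only [map_add, map_mul, map_pow, map_sub, map_one]
          simp only [map_mul, map_sub, map_pow] at h ⊢
          generalize ψ (loc k A (g1 * g2) g1) = G1 at *
          generalize ψ (loc k A (g1 * g2) g2) = G2 at *
          generalize ψ (loc k A (g1 * g2) x1) = X1 at *
          generalize ψ (loc k A (g1 * g2) x2) = X2 at *
          generalize ψ (loc k A (g1 * g2) y1) = Y1 at *
          generalize ψ (loc k A (g1 * g2) y2) = Y2 at *
          generalize ψ gi = I at *
          have e : G1 * G2 * I = 1 := h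
          have hG2 : G2 ≠ 0 := by intro h'; rw [h'] at e; simp at e
          have hG1 : G1 ≠ 0 := by intro h'; rw [h'] at e; simp at e
          have hI : I = (G1 * G2)⁻¹ := eq_inv_of_mul_eq_one_right e
          refine ⟨Or.inl ⟨?_, ?_⟩, ?_⟩
          · rw [← hq]; linear_combination (X1 - X2) * h
          · exact sub_ne_zero.mp (hq ▸ hG1)
          · rw [hI]; field_simp; linear_combination -hq2)
        refine ⟨_, i, T, ?_, h⟩
        rw [hg2, hg1, map_mul]
        simp only [map_add, map_sub, map_mul, map_pow, map_one]
        rw [c1]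
        have : θ y1 - θ y2 ≠ 0 := sub_ne_zero.mpr c3
        simpa using this
    · obtain ⟨g, hg⟩ : ∃ g, g = y1 + y2 := ⟨_, rfl⟩
      obtain ⟨gi, hgi⟩ := inv g
      obtain ⟨i, T, h⟩ := s1 g (loc k A _ (x1 ^ 2 + x1 * x2 + x2 ^ 2) * gi) (by
        intro ψ
        have h := hgi ψ
        have hq : ψ (loc k A g g) = ψ (loc k A g y1) + ψ (loc k A g y2) := by
          refine (congrArg (fun z => ψ (loc k A g z)) hg).trans ?_
          simp only [map_add]
        right
        rw [← hq]
        simp only [map_mul, map_add, map_pow]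
        refine ⟨?_, ?_⟩
        · rw [_root_.mul_assoc, mul_comm (ψ gi), h, _root_.mul_one]
        · intro h'; rw [h'] at h; simp at h)
      refine ⟨_, i, T, ?_, h⟩
      rw [hg, map_add]; exact c2
  · obtain ⟨g, hg⟩ : ∃ g, g = x1 - x2 := ⟨_, rfl⟩
    obtain ⟨gi, hgi⟩ := inv g
    obtain ⟨i, T, h⟩ := s1 g (loc k A _ (y1 - y2) * gi) (by
        intro ψ
        have h := hgi ψ
        have hq : ψ (loc k A g g) = ψ (loc k A g x1) - ψ (loc k A g x2) := by
          refine (congrArg (fun z => ψ (loc k A g z)) hg).trans ?_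
          simp only [map_sub]
        left
        rw [← hq]
        simp only [map_mul, map_sub]
        refine ⟨?_, ?_⟩
        · rw [_root_.mul_assoc, mul_comm (ψ gi), h, _root_.mul_one]
        · intro h'; rw [hq, h', sub_self] at h; simp at h)
    refine ⟨_, i, T, ?_, h⟩
    rw [hg, map_sub]; exact sub_ne_zero.mpr c1
end form
end Ell
end

end

section
open CategoryTheory AlgebraicGeometry Limits
noncomputable section
set_option linter.unusedSectionVars false
namespace Ell
open PtF Glue Prd GrpF
open scoped TensorProduct
variable {k : Type} [Field k] [CharZero k] [IsAlgClosed k] (D : ED k)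

lemma ED.sep : IsSeparated D.E.hom := by
  have := D.proper
  infer_instance

lemma mu_step {A : Type} [CommRing A] [Algebra k A] [Algebra.FiniteType k A] [_root_.IsReduced A] (i1 i2 : BR k →ₐ[k] A)
    (a b : Bool) (p : SpO k A ⟶ PR D.E D.E) (hp1 : p ≫ pr1 _ _ = sm i1 ≫ D.c a) (hp2 : p ≫ pr2 _ _ = sm i2 ≫ D.c b)
    (hpo : IsOpenImmersion p.left) (t : SpO k k ⟶ PR D.E D.E) (θ : A →ₐ[k] k) (htp : sm θ ≫ p = t) : 
    ∃ (T : OverR k) (j : T ⟶ PR D.E D.E) (F : T ⟶ D.E) (t' : SpO k k ⟶ T),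
      IsOpenImmersion j.left ∧ t' ≫ j = t ∧ ∀ e : SpO k k ⟶ T, 
        e ≫ F = Ph D (Pq D ((e ≫ j) ≫ pr1 D.E D.E) + Pq D ((e ≫ j) ≫ pr2 D.E D.E)) := by
  obtain ⟨g, i, T, hg, h⟩ := form i1 i2 θ
  refine ⟨SpO k (Localization.Away g), sm (loc k A g) ≫ p, sm T ≫ D.c (i == (a == b)), sm (liftA θ (isUnit_iff_ne_zero.mpr hg)), 
    comp_open _ _ (sm_loc_open g) hpo, ?_, ?_⟩
  · have e : (liftA θ (isUnit_iff_ne_zero.mpr hg)).comp (loc k A g) = θ := AlgHom.ext fun x => liftA_algebraMap θ (isUnit_iff_ne_zero.mpr hg) x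
    rw [smc, e, htp]
  · intro e
    obtain ⟨ψ, rfl⟩ := sm_surj e
    have h := h ψ
    rw [smc, Ph_c, smc, Category.assoc, Category.assoc, hp1, hp2, smc, smc, Pq_c, Pq_c]
    congr 1
    rw [← cP_xor i, ← cP_xor a b]
    calc _ = (pp (ψ.comp T) + cP k i) + (cP k a + cP k b) := by abel
      _ = _ := by rw [← h]; abel

lemma exists_mu : ∃ μ : PR D.E D.E ⟶ D.E, ∀ t : SpO k k ⟶ PR D.E D.E, 
    t ≫ μ = Ph D (Pq D (t ≫ pr1 D.E D.E) + Pq D (t ≫ pr2 D.E D.E)) := by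
  refine glue_pts (pr_lft D.lft D.lft) (pr_reduced D.lft D.lft D.red D.red) D.lft D.sep _ ?_
  intro t
  obtain ⟨a, φ1, h1⟩ := D.atLocal (t ≫ pr1 D.E D.E)
  obtain ⟨b, φ2, h2⟩ := D.atLocal (t ≫ pr2 D.E D.E)
  have hred : _root_.IsReduced (BR k ⊗[k] BR k) := tensor_reduced (k := k) _ _
  have hft : Algebra.FiniteType k (BR k ⊗[k] BR k) := Algebra.FiniteType.trans (S := BR k) inferInstance inferInstance
  obtain ⟨i1, hi1⟩ : ∃ i1 : BR k →ₐ[k] BR k ⊗[k] BR k, i1 = Algebra.TensorProduct.includeLeft := ⟨_, rfl⟩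
  obtain ⟨i2, hi2⟩ : ∃ i2 : BR k →ₐ[k] BR k ⊗[k] BR k, i2 = Algebra.TensorProduct.includeRight := ⟨_, rfl⟩
  obtain ⟨θ, hθ1, hθ2⟩ : ∃ θ : BR k ⊗[k] BR k →ₐ[k] k, θ.comp i1 = φ1 ∧ θ.comp i2 = φ2 := by
    refine ⟨Algebra.TensorProduct.productMap φ1 φ2, ?_, ?_⟩
    · rw [hi1]; exact Algebra.TensorProduct.productMap_left φ1 φ2
    · rw [hi2]; exact Algebra.TensorProduct.productMap_right φ1 φ2
  obtain ⟨p, hp⟩ : ∃ p, p = pch (D.c a) (D.c b) := ⟨_, rfl⟩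
  have hp1 : p ≫ pr1 _ _ = sm i1 ≫ D.c a := by rw [hp, pch, prl_pr1, hi1]
  have hp2 : p ≫ pr2 _ _ = sm i2 ≫ D.c b := by rw [hp, pch, prl_pr2, hi2]
  have hpo : IsOpenImmersion p.left := by rw [hp]; exact pch_open _ _ (D.op a) (D.op b)
  clear hp hi1 hi2
  have htp : sm θ ≫ p = t := by
    refine pr_ext ?_ ?_
    · rw [Category.assoc, hp1, smc, hθ1, h1]
    · rw [Category.assoc, hp2, smc, hθ2, h2]
  exact mu_step D i1 i2 a b p hp1 hp2 hpo t θ htp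

lemma exists_nu : ∃ ν : D.E ⟶ D.E, ∀ t : SpO k k ⟶ D.E, t ≫ ν = Ph D (- Pq D t) := by
  refine glue_pts D.lft D.red D.lft D.sep _ ?_
  intro t
  obtain ⟨i, φ, rfl⟩ := D.atLocal t
  have hy : (- yy k) ^ 2 = bx k ^ 3 + 1 := by rw [neg_sq, eqB]
  obtain ⟨n, hn⟩ : ∃ n : BR k →ₐ[k] BR k, n = bhom (bx k) (- yy k) hy := ⟨_, rfl⟩
  refine ⟨SpO k (BR k), D.c i, sm n ≫ D.c i, sm φ, D.op i, rfl, ?_⟩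
  intro e
  obtain ⟨ψ, rfl⟩ := sm_surj e
  rw [smc, Ph_c, Pq_c, neg_add, cP_neg]
  congr 2
  rw [pp, pp, neg_pt]
  refine pt_congr ?_ ?_
  · rw [hn]; exact congrArg ψ (bhom_x (bx k) (- yy k) hy)
  · rw [hn]; exact (congrArg ψ (bhom_y (bx k) (- yy k) hy)).trans (map_neg ψ _)

def mu : PR D.E D.E ⟶ D.E := (exists_mu D).choose
lemma mu_spec (a b : SpO k k ⟶ D.E) : prl a b ≫ mu D = Ph D (Pq D a + Pq D b) := by
  have := (exists_mu D).choose_spec (prl a b)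
  rwa [prl_pr1, prl_pr2] at this
def nu : D.E ⟶ D.E := (exists_nu D).choose
lemma nu_spec (a : SpO k k ⟶ D.E) : a ≫ nu D = Ph D (- Pq D a) := (exists_nu D).choose_spec a

/-- structure morphism to the point -/
def tpt (T : OverR k) : T ⟶ SpO k k := Over.homMk T.hom (by
  show T.hom ≫ Spec.map (CommRingCat.ofHom (algebraMap k k)) = T.hom
  have : Spec.map (CommRingCat.ofHom (algebraMap k k)) = 𝟙 _ := Spec.map_id _
  rw [this, Category.comp_id])
lemma tpt_ext {T : OverR k} (f g : T ⟶ SpO k k) : f = g := by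
  have : (SpO k k).hom = 𝟙 _ := Spec.map_id _
  ext1
  have h1 := Over.w f
  have h2 := Over.w g
  rw [this] at h1 h2
  exact ((Category.comp_id f.left).symm.trans h1).trans (h2.symm.trans (Category.comp_id g.left))

lemma g_one : prl (tpt D.E ≫ Ph D 0) (𝟙 D.E) ≫ mu D = 𝟙 D.E := by
  refine pts_ext D.lft D.sep D.lft D.red fun t => ?_
  rw [← Category.assoc, comp_prl, mu_spec, ← Category.assoc, tpt_ext (t ≫ tpt D.E) (𝟙 _), Category.id_comp, Pq_Ph, zero_add,
    Category.comp_id, Ph_Pq]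

lemma g_inv : prl (nu D) (𝟙 D.E) ≫ mu D = tpt D.E ≫ Ph D 0 := by
  refine pts_ext D.lft D.sep D.lft D.red fun t => ?_
  rw [← Category.assoc, comp_prl, mu_spec, nu_spec, Pq_Ph, Category.comp_id, neg_add_cancel, 
    ← Category.assoc, tpt_ext (t ≫ tpt D.E) (𝟙 _), Category.id_comp]

lemma g_assoc : prl (pr1 (PR D.E D.E) D.E ≫ mu D) (pr2 (PR D.E D.E) D.E) ≫ mu D =
    prl (pr1 (PR D.E D.E) D.E ≫ pr1 D.E D.E) (prl (pr1 (PR D.E D.E) D.E ≫ pr2 D.E D.E) (pr2 (PR D.E D.E) D.E) ≫ mu D) ≫ mu D := by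
  have h1 := pr_lft D.lft D.lft
  have h2 := pr_reduced D.lft D.lft D.red D.red
  refine pts_ext D.lft D.sep (pr_lft h1 D.lft) (pr_reduced h1 D.lft h2 D.red) fun t => ?_
  obtain ⟨s, hs⟩ : ∃ s, s = t ≫ pr1 (PR D.E D.E) D.E := ⟨_, rfl⟩
  obtain ⟨c, hc⟩ : ∃ s, s = t ≫ pr2 (PR D.E D.E) D.E := ⟨_, rfl⟩
  obtain ⟨a, ha⟩ : ∃ a, a = s ≫ pr1 D.E D.E := ⟨_, rfl⟩
  obtain ⟨b, hb⟩ : ∃ a, a = s ≫ pr2 D.E D.E := ⟨_, rfl⟩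
  have hab : s = prl a b := pr_ext (by rw [prl_pr1, ha]) (by rw [prl_pr2, hb])
  rw [← Category.assoc, ← Category.assoc, comp_prl, comp_prl, ← Category.assoc, ← Category.assoc, ← Category.assoc, comp_prl,
    ← Category.assoc, ← hs, ← hc, ← ha, ← hb, hab]
  simp only [mu_spec, Pq_Ph, add_assoc]

def EG : GroupScheme k where
  G := D.E
  mul a b := prl a b ≫ mu D
  one T := tpt T ≫ Ph D 0
  inv a := a ≫ nu D
  mul_assoc {T} a b c := by
    have h := congrArg (fun z => prl (prl a b) c ≫ z) (g_assoc D)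
    rw [← Category.assoc, ← Category.assoc, comp_prl, comp_prl, ← Category.assoc, ← Category.assoc, ← Category.assoc, comp_prl,
    ← Category.assoc, prl_pr1, prl_pr2, prl_pr1, prl_pr2] at h
    exact h
  one_mul {T} a := by
    have h := congrArg (fun z => a ≫ z) (g_one D)
    rw [← Category.assoc, comp_prl, ← Category.assoc, tpt_ext (a ≫ tpt D.E) (tpt T), Category.comp_id] at h
    exact h
  inv_mul {T} a := by
    have h := congrArg (fun z => a ≫ z) (g_inv D)
    rw [← Category.assoc, comp_prl, ← Category.assoc, tpt_ext (a ≫ tpt D.E) (tpt T), Category.comp_id] at h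
    exact h
  mul_natural f a b := by rw [← Category.assoc, comp_prl]
  one_natural {T T'} f := by rw [← Category.assoc, tpt_ext (f ≫ tpt T') (tpt T)]

lemma EG_ab : (EG D).IsAbelianVariety := ⟨⟨D.lft, D.qc, D.conn⟩, D.proper⟩
end Ell
end

end

section
open CategoryTheory AlgebraicGeometry Limits
noncomputable section
set_option linter.unusedSectionVars false
namespace Ell
open PtF Glue Prd GrpF
variable {k : Type} [Field k]

lemma lp_ext {R : Type} [CommRing R] [Algebra k R] {φ ψ : LP k →ₐ[k] R} (h : φ (LaurentPolynomial.T 1) = ψ (LaurentPolynomial.T 1)) :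
    φ = ψ := by
  have h2 : φ.toRingHom = ψ.toRingHom := by
    refine IsLocalization.ringHom_ext (Submonoid.powers (Polynomial.X : Polynomial k)) ?_
    refine Polynomial.ringHom_ext (fun a => ?_) ?_
    · have e : algebraMap (Polynomial k) (LP k) (Polynomial.C a) = algebraMap k (LP k) a := by
        rw [LaurentPolynomial.algebraMap_eq_toLaurent, Polynomial.toLaurent_C]; rfl
      show φ (algebraMap (Polynomial k) (LP k) (Polynomial.C a)) = ψ (algebraMap (Polynomial k) (LP k) (Polynomial.C a))
      rw [e, AlgHom.commutes, AlgHom.commutes]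
    · show φ (algebraMap (Polynomial k) (LP k) Polynomial.X) = ψ (algebraMap (Polynomial k) (LP k) Polynomial.X)
      rw [LaurentPolynomial.algebraMap_eq_toLaurent, Polynomial.toLaurent_X]
      exact h
  exact AlgHom.ext fun x => RingHom.congr_fun h2 x

lemma lp_hom {R : Type} [CommRing R] [Algebra k R] (u : Rˣ) : ∃ φ : LP k →ₐ[k] R, φ (LaurentPolynomial.T 1) = u := 
  ⟨{ LaurentPolynomial.eval₂ (algebraMap k R) u with
    commutes' := fun r => LaurentPolynomial.eval₂_C (algebraMap k R) u r }, by
    refine (LaurentPolynomial.eval₂_T (algebraMap k R) u 1).trans ?_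
    rw [zpow_one]⟩

lemma back_ab {X : OverR k} (H : ∀ Γ : GroupScheme k, Γ.IsAbelianVariety →
        ∀ f : Γ.G.left.PartialMap X.left, f.hom ≫ X.hom = f.domain.ι ≫ Γ.G.hom →
          IsConstantHom (f.domain.ι ≫ Γ.G.hom) f.hom) (Γ : GroupScheme k) (hΓ : Γ.IsAbelianVariety) (f : Γ.G ⟶ X) : IsConstant f := by
  obtain ⟨y, hy⟩ := H Γ hΓ ⟨⊤, dense_univ, (⊤ : Γ.G.left.Opens).ι ≫ f.left⟩ (by
    show ((⊤ : Γ.G.left.Opens).ι ≫ f.left) ≫ X.hom = (⊤ : Γ.G.left.Opens).ι ≫ Γ.G.hom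
    rw [Category.assoc, Over.w])
  refine ⟨y, ?_⟩
  have hy : (⊤ : Γ.G.left.Opens).ι ≫ f.left = ((⊤ : Γ.G.left.Opens).ι ≫ Γ.G.hom) ≫ y := hy
  rw [Category.assoc] at hy
  have hi : IsIso (⊤ : Γ.G.left.Opens).ι := (Scheme.topIso Γ.G.left).isIso_hom
  exact (@cancel_epi _ _ _ _ _ (⊤ : Γ.G.left.Opens).ι (@IsIso.epi_of_iso _ _ _ _ _ hi) _ _).mp hy

variable [CharZero k] [IsAlgClosed k]

lemma back_gm {X : OverR k} (hXf : LocallyOfFiniteType X.hom) (hXs : IsSeparated X.hom) (H : ∀ Γ : GroupScheme k, Γ.IsAbelianVariety →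
        ∀ f : Γ.G.left.PartialMap X.left, f.hom ≫ X.hom = f.domain.ι ≫ Γ.G.hom →
          IsConstantHom (f.domain.ι ≫ Γ.G.hom) f.hom) (g : GmO k ⟶ X) : IsConstant g := by
  obtain ⟨D⟩ := exists_ED (k := k)
  obtain ⟨g, hg⟩ : ∃ g' : SpO k (LP k) ⟶ X, g' = g := ⟨g, rfl⟩
  subst hg
  obtain ⟨η, hη⟩ : ∃ η : LP k →ₐ[k] Localization.Away (bx k), η (LaurentPolynomial.T 1) = loc k _ (bx k) (bx k) := 
    lp_hom (IsLocalization.Away.algebraMap_isUnit (S := Localization.Away (bx k)) (bx k)).unit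
  obtain ⟨j, hj⟩ : ∃ j, j = sm (loc k _ (bx k)) ≫ D.c true := ⟨_, rfl⟩
  have hjo : IsOpenImmersion j.left := by rw [hj]; exact comp_open _ _ (sm_loc_open _) (D.op true)
  obtain ⟨ψ0, hψ0⟩ : ∃ ψ : Localization.Away (bx k) →ₐ[k] k, True := by
    obtain ⟨b, hb⟩ := IsAlgClosed.exists_pow_nat_eq ((1 : k) ^ 3 + 1) (n := 2) (by norm_num)
    exact ⟨liftA (bhom 1 b hb) (by rw [bhom_x]; exact isUnit_one), trivial⟩
  have hconn := D.conn
  have hirr : IrreducibleSpace D.E.left := by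
    apply irreducible_of_cover
    intro x
    obtain ⟨i, u, hu⟩ := D.sur x
    refine ⟨Set.range (D.c i).left, (D.op i).base_open.isOpen_range, ⟨u, hu⟩, ?_⟩
    have : IrreducibleSpace (PrimeSpectrum (BR k)) := inferInstance
    have hi : IsPreirreducible (Set.univ : Set (SpO k (BR k)).left) := this.toPreirreducibleSpace.isPreirreducible_univ
    rw [← Set.image_univ]
    exact hi.image _ (D.c i).left.continuous.continuousOn
  obtain ⟨a⟩ : Nonempty (SpO k k).left := inferInstanceAs (Nonempty (PrimeSpectrum k))
  have hd : Dense (j.left.opensRange : Set D.E.left) := 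
    j.left.opensRange.isOpen.dense ⟨_, ⟨(sm ψ0).left a, rfl⟩⟩
  obtain ⟨y, hy⟩ := H (EG D) (EG_ab D) ⟨j.left.opensRange, hd, j.left.isoOpensRange.inv ≫ (sm η ≫ g).left⟩ (by
    show (j.left.isoOpensRange.inv ≫ (sm η ≫ g).left) ≫ X.hom = j.left.opensRange.ι ≫ D.E.hom
    rw [Category.assoc, Over.w, ← Scheme.Hom.isoOpensRange_inv_comp, Category.assoc, Over.w])
  have hy : j.left.isoOpensRange.inv ≫ (sm η ≫ g).left = (j.left.opensRange.ι ≫ D.E.hom) ≫ y := hy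
  have hy2 : (sm η ≫ g).left = (SpO k (Localization.Away (bx k))).hom ≫ y := by
    rw [← Scheme.Hom.isoOpensRange_inv_comp, Category.assoc, Category.assoc, Over.w_assoc] at hy
    exact (cancel_epi _).mp hy
  have hc : IsConstant (sm η ≫ g) := ⟨y, hy2⟩
  have hc' := const_sp ψ0 _ hc
  have key : g = tpt (SpO k (LP k)) ≫ (sm ψ0 ≫ sm η ≫ g) := by
    refine pts_ext hXf hXs (sp_lft _ lp_ft) (sp_reduced (k := k) _) fun t => ?_
    obtain ⟨τ, rfl⟩ := sm_surj t
    rw [← Category.assoc, tpt_ext (sm τ ≫ tpt _) (𝟙 _), Category.id_comp]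
    obtain ⟨u, hu⟩ : ∃ u, u = τ (LaurentPolynomial.T 1) := ⟨_, rfl⟩
    have huu : IsUnit u := by rw [hu]; exact (LaurentPolynomial.isUnit_T 1).map τ
    obtain ⟨b, hb⟩ := IsAlgClosed.exists_pow_nat_eq (u ^ 3 + 1) (n := 2) (by norm_num)
    have hub : IsUnit (bhom (k := k) u b hb (bx k)) := by rw [bhom_x]; exact huu
    have e : (liftA (bhom u b hb) hub).comp η = τ := by
      refine lp_ext ?_
      rw [← hu]
      show liftA (bhom u b hb) hub (η (LaurentPolynomial.T 1)) = u
      rw [hη]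
      exact (liftA_algebraMap (bhom u b hb) hub (bx k)).trans (bhom_x u b hb)
    rw [← e, ← smc, hc']
    simp only [← Category.assoc]
    congr 3
    exact tpt_ext _ _
  refine ⟨(sm ψ0 ≫ sm η ≫ g).left, ?_⟩
  conv_lhs => rw [key]
  rfl
end Ell
end

end

/-- Let `k` be an algebraically closed field of characteristic zero. A
proper variety `X` over `k` is groupless if and only if, for every abelian variety `A`
over `k`, every rational map `A ⤏ X` (encoded as a morphism to `X` from a dense open
subscheme of `A`, compatible with the structure morphisms) is constant. -/
theorem stmt_5 (k : Type) [Field k] [IsAlgClosed k] [CharZero k]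
    (X : OverR k) (hX : IsVarietyOver X) (hproper : IsProper X.hom) :
    IsGroupless k X ↔
      ∀ Γ : GroupScheme k, Γ.IsAbelianVariety →
        ∀ f : Γ.G.left.PartialMap X.left, f.hom ≫ X.hom = f.domain.ι ≫ Γ.G.hom →
          IsConstantHom (f.domain.ι ≫ Γ.G.hom) f.hom := by
  constructor
  · intro hG Γ hΓ f hf
    exact Glue.forward hX.1 hproper hG Γ hΓ f hf
  · intro H
    exact ⟨fun g => Ell.back_gm hX.1 hX.2.2 H g, fun Γ hΓ f => Ell.back_ab H Γ hΓ f⟩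

end
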